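/- Let α > 0 and let s ∈ ℝ satisfy either (i) 1/2 − α ≤ −1/2 and s ≤ 1/2 − α, or (ii) 1/2 − α > −1/2, s < 1/2 − α, and s ≠ 0. Then for every ε > 0 there exist a time T ∈ (0, ε) and a family a : ℤ → ℝ → ℂ of continuously differentiable functions, with Σ_{n∈ℤ} (1+|n|)^m sup_{t∈[0,T]} |a_n(t)| < ∞ for every m ∈ ℕ, satisfying the Fourier-coefficient form of the defocusing cubic fractional Schrödinger equation i ∂_t u + (−∂_x²)^α u + |u|²u = 0, namely i a_n'(t) + (2π|n|)^{2α} a_n(t) + Σ_{(n₁,n₂,n₃)∈Γ(n)} a_{n₁}(t) \overline{a_{n₂}(t)} a_{n₃}(t) = 0 for all n ∈ ℤ and t ∈ ℝ, such that (Σ_{n∈ℤ} (1+n²)^s |a_n(0)|²)^{1/2} < ε and (Σ_{n∈ℤ} (1+n²)^s |a_n(T)|²)^{1/2} > ε^{−1}. -/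

import Mathlib

open scoped Real

/-- `H^s` norm of a sequence of Fourier coefficients:
`(Σ_{n∈ℤ} (1+n²)^s |a_n|²)^{1/2}`. -/
noncomputable def HsSeq (s : ℝ) (a : ℤ → ℂ) : ℝ :=
  Real.sqrt (∑' n : ℤ, ((1:ℝ) + (n:ℝ)^2) ^ s * ‖a n‖^2)

section
open scoped Real

/-- The trilinear term with `n = x - y + (n - x + y)`. -/
noncomputable def cubT (a : ℤ → ℂ) (n : ℤ) (q : ℤ × ℤ) : ℂ :=
  a q.1 * (starRingEnd ℂ) (a q.2) * a (n - q.1 + q.2)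

/-- The cubic nonlinearity. -/
noncomputable def cubN (a : ℤ → ℂ) (n : ℤ) : ℂ := ∑' q : ℤ × ℤ, cubT a n q

/-- Parametrisation of `Γ(n)`. -/
def gamEquiv (n : ℤ) : {p : ℤ × ℤ × ℤ // n = p.1 - p.2.1 + p.2.2} ≃ ℤ × ℤ where
  toFun p := (p.1.1, p.1.2.1)
  invFun q := ⟨(q.1, q.2, n - q.1 + q.2), by simp⟩
  left_inv := by
    rintro ⟨⟨x, y, z⟩, h⟩
    simp only [Subtype.mk.injEq, Prod.mk.injEq, true_and]
    simp at h
    omega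
  right_inv := by
    rintro ⟨x, y⟩
    rfl

lemma tsum_gam (a : ℤ → ℂ) (n : ℤ) :
    (∑' p : {p : ℤ × ℤ × ℤ // n = p.1 - p.2.1 + p.2.2},
      a p.1.1 * (starRingEnd ℂ) (a p.1.2.1) * a p.1.2.2) = cubN a n := by
  unfold cubN
  rw [← (gamEquiv n).symm.tsum_eq]
  rfl

/-- Positive trilinear form. -/
noncomputable def triS (f g h : ℤ → ENNReal) (n : ℤ) : ENNReal :=
  ∑' q : ℤ × ℤ, f q.1 * g q.2 * h (n - q.1 + q.2)

lemma tsum_shift (h : ℤ → ENNReal) (c : ℤ) : ∑' y, h (c + y) = ∑' y, h y :=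
  (Equiv.addLeft c).tsum_eq h

lemma tsum_refl (h : ℤ → ENNReal) (c : ℤ) : ∑' x, h (c - x) = ∑' y, h y :=
  (Equiv.subLeft c).tsum_eq h

lemma triS_eq (f g h : ℤ → ENNReal) (n : ℤ) :
    triS f g h n = ∑' x, f x * ∑' y, g y * h (n - x + y) := by
  unfold triS
  rw [ENNReal.tsum_prod (f := fun x y => f x * g y * h (n - x + y))]
  refine tsum_congr fun x => ?_
  rw [← ENNReal.tsum_mul_left]
  exact tsum_congr fun y => by simp [mul_assoc]

lemma triS_eq2 (f g h : ℤ → ENNReal) (n : ℤ) :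
    triS f g h n = ∑' y, g y * ∑' x, f x * h (n - x + y) := by
  unfold triS
  rw [ENNReal.tsum_prod (f := fun x y => f x * g y * h (n - x + y)), ENNReal.tsum_comm]
  refine tsum_congr fun x => ?_
  rw [← ENNReal.tsum_mul_left]
  exact tsum_congr fun y => by ring

lemma triS_eq3 (f g h : ℤ → ENNReal) (n : ℤ) :
    triS f g h n = ∑' k, h k * ∑' x, f x * g (k - n + x) := by
  rw [triS_eq]
  have : ∀ x, ∑' y, g y * h (n - x + y) = ∑' k, g (k - n + x) * h k := by
    intro x
    rw [← tsum_shift (fun k => g (k - n + x) * h k) (n - x)]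
    refine tsum_congr fun y => ?_
    congr 2; ring
  simp_rw [this]
  simp_rw [← ENNReal.tsum_mul_left]
  rw [ENNReal.tsum_comm]
  exact tsum_congr fun k => tsum_congr fun x => by ring

lemma triS_sup3 (f g h : ℤ → ENNReal) (n : ℤ) (ζ : ENNReal) (hz : ∀ k, h k ≤ ζ) :
    triS f g h n ≤ (∑' x, f x) * (∑' x, g x) * ζ := by
  rw [triS_eq]
  calc _ ≤ ∑' x, f x * ((∑' y, g y) * ζ) := by
        gcongr with x
        rw [← ENNReal.tsum_mul_right]
        gcongr with y
        exact hz _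
    _ = _ := by rw [ENNReal.tsum_mul_right, mul_assoc]

lemma triS_sup2 (f g h : ℤ → ENNReal) (n : ℤ) (ζ : ENNReal) (hz : ∀ k, g k ≤ ζ) :
    triS f g h n ≤ (∑' x, f x) * (∑' x, h x) * ζ := by
  rw [triS_eq]
  calc _ ≤ ∑' x, f x * ((∑' y, h y) * ζ) := by
        gcongr with x
        rw [← ENNReal.tsum_mul_right, ← tsum_shift (fun y => h y * ζ) (n - x)]
        refine ENNReal.tsum_le_tsum fun y => ?_
        rw [mul_comm]
        gcongr
        exact hz _
    _ = _ := by rw [ENNReal.tsum_mul_right, mul_assoc]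

lemma triS_sup1 (f g h : ℤ → ENNReal) (n : ℤ) (ζ : ENNReal) (hz : ∀ k, f k ≤ ζ) :
    triS f g h n ≤ (∑' x, g x) * (∑' x, h x) * ζ := by
  rw [triS_eq2]
  calc _ ≤ ∑' x, g x * ((∑' y, h y) * ζ) := by
        gcongr with y
        rw [← ENNReal.tsum_mul_right, ← tsum_refl (fun y => h y * ζ) (n + y)]
        refine ENNReal.tsum_le_tsum fun x => ?_
        rw [mul_comm]
        gcongr
        · apply le_of_eq; congr 1; ring
        · exact hz _
    _ = _ := by rw [ENNReal.tsum_mul_right, mul_assoc]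

lemma ennreal_mul_le_sq (a b : ENNReal) : a * b ≤ a ^ 2 + b ^ 2 := by
  rcases le_total a b with h | h
  · calc a * b ≤ b * b := by gcongr
      _ = b ^ 2 := (sq b).symm
      _ ≤ _ := le_add_self
  · calc a * b ≤ a * a := by gcongr
      _ = a ^ 2 := (sq a).symm
      _ ≤ _ := le_self_add

lemma triS_l21 (f g h : ℤ → ENNReal) (n : ℤ) :
    triS f g h n ≤ (∑' x, f x) * (∑' x, g x ^ 2 + ∑' x, h x ^ 2) := by
  rw [triS_eq, ← ENNReal.tsum_mul_right]
  gcongr with x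
  rw [← tsum_shift (fun y => h y ^ 2) (n - x), ← ENNReal.tsum_add]
  gcongr with y
  exact ennreal_mul_le_sq _ _

lemma triS_l22 (f g h : ℤ → ENNReal) (n : ℤ) :
    triS f g h n ≤ (∑' x, g x) * (∑' x, f x ^ 2 + ∑' x, h x ^ 2) := by
  rw [triS_eq2, ← ENNReal.tsum_mul_right]
  gcongr with y
  rw [← tsum_refl (fun y => h y ^ 2) (n + y), ← ENNReal.tsum_add]
  gcongr with x
  rw [show n - x + y = n + y - x by ring]
  exact ennreal_mul_le_sq _ _

lemma triS_l23 (f g h : ℤ → ENNReal) (n : ℤ) :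
    triS f g h n ≤ (∑' x, h x) * (∑' x, f x ^ 2 + ∑' x, g x ^ 2) := by
  rw [triS_eq3, ← ENNReal.tsum_mul_right]
  gcongr with k
  rw [← tsum_shift (fun y => g y ^ 2) (k - n), ← ENNReal.tsum_add]
  gcongr with x
  exact ennreal_mul_le_sq _ _

lemma cross_bound (a z : ℤ → ℂ) (n : ℤ) (ζ : ENNReal) (hz : ∀ k, ‖z k‖ₑ ≤ ζ) :
    ∑' q, ‖cubT (a + z) n q - cubT a n q - cubT z n q‖ₑ ≤
      3 * ((∑' x, ‖a x‖ₑ) * (∑' x, ‖a x‖ₑ) * ζ)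
      + 6 * ((∑' x, ‖a x‖ₑ) * ∑' x, ‖z x‖ₑ ^ 2) := by
  set A : ℤ → ENNReal := fun x => ‖a x‖ₑ
  set Z : ℤ → ENNReal := fun x => ‖z x‖ₑ
  have h1 : ∑' q, ‖cubT (a + z) n q - cubT a n q - cubT z n q‖ₑ ≤
      triS Z A A n + triS A Z A n + triS A A Z n + triS A Z Z n + triS Z A Z n + triS Z Z A n := by
    unfold triS
    rw [← ENNReal.tsum_add, ← ENNReal.tsum_add, ← ENNReal.tsum_add, ← ENNReal.tsum_add,
      ← ENNReal.tsum_add]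
    gcongr with q
    have e : cubT (a + z) n q - cubT a n q - cubT z n q =
        z q.1 * (starRingEnd ℂ) (a q.2) * a (n - q.1 + q.2)
        + a q.1 * (starRingEnd ℂ) (z q.2) * a (n - q.1 + q.2)
        + a q.1 * (starRingEnd ℂ) (a q.2) * z (n - q.1 + q.2)
        + a q.1 * (starRingEnd ℂ) (z q.2) * z (n - q.1 + q.2)
        + z q.1 * (starRingEnd ℂ) (a q.2) * z (n - q.1 + q.2)
        + z q.1 * (starRingEnd ℂ) (z q.2) * a (n - q.1 + q.2) := by
      simp only [cubT, Pi.add_apply, map_add]; ring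
    rw [e]
    have key : ∀ u v w : ℂ, ‖u * (starRingEnd ℂ) v * w‖ₑ = ‖u‖ₑ * ‖v‖ₑ * ‖w‖ₑ := by
      intro u v w
      rw [enorm_mul, enorm_mul]
      congr 2
      rw [← ofReal_norm, ← ofReal_norm, RCLike.norm_conj]
    have h6 : ∀ u1 u2 u3 u4 u5 u6 : ℂ, ‖u1 + u2 + u3 + u4 + u5 + u6‖ₑ ≤
        ‖u1‖ₑ + ‖u2‖ₑ + ‖u3‖ₑ + ‖u4‖ₑ + ‖u5‖ₑ + ‖u6‖ₑ := by
      intro u1 u2 u3 u4 u5 u6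
      refine (enorm_add_le _ _).trans ?_
      gcongr
      refine (enorm_add_le _ _).trans ?_
      gcongr
      refine (enorm_add_le _ _).trans ?_
      gcongr
      refine (enorm_add_le _ _).trans ?_
      gcongr
      exact enorm_add_le _ _
    refine (h6 _ _ _ _ _ _).trans ?_
    simp only [key]
    exact le_rfl
  refine h1.trans ?_
  have e1 := triS_sup1 Z A A n ζ hz
  have e2 := triS_sup2 A Z A n ζ hz
  have e3 := triS_sup3 A A Z n ζ hz
  have e4 := triS_l21 A Z Z n
  have e5 := triS_l22 Z A Z n
  have e6 := triS_l23 Z Z A n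
  refine (add_le_add (add_le_add (add_le_add (add_le_add (add_le_add e1 e2) e3) e4) e5) e6).trans ?_
  apply le_of_eq; ring

end

section
open scoped Real

lemma blob_comb (p L D W X : ℤ) (K : ℕ) (hp : |p| ≤ L) (hD : D = 2 * L + 1) (hW : W = 2 * K * D)
    (hX : X = 10 * (W + L) + 10) (n k1 k2 k3 : ℤ) (hn : |n| ≤ L) (hk : k1 - k2 + k3 = n)
    (Bs Cs : Finset ℤ) (hB : Bs = (Finset.range K).image (fun i : ℕ => X + i * D))
    (hC : Cs = (Finset.range (2 * K)).image (fun i : ℕ => (2 * X - p) + i * D))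
    (h1 : k1 ∈ Bs ∪ Cs) (h2 : k2 ∈ Bs ∪ Cs) (h3 : k3 ∈ Bs ∪ Cs) :
    n = p ∧ ∃ i i' : ℕ, i < K ∧ i' < K ∧ k1 = X + i * D ∧ k2 = (2 * X - p) + (i + i') * D := by
  have hL : 0 ≤ L := (abs_nonneg _).trans hp
  have hD0 : 0 < D := by omega
  have bd : ∀ i : ℕ, i < 2 * K → 0 ≤ (i : ℤ) * D ∧ (i : ℤ) * D ≤ W := by
    intro i hi
    refine ⟨by positivity, ?_⟩
    rw [hW]
    have : (i : ℤ) ≤ 2 * K := by exact_mod_cast hi.le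
    nlinarith
  have hW0 : 0 ≤ W := by rw [hW]; positivity
  rw [abs_le] at hn hp
  have mem : ∀ k ∈ Bs ∪ Cs, (∃ i : ℕ, i < K ∧ k = X + i * D) ∨
      (∃ i : ℕ, i < 2 * K ∧ k = (2 * X - p) + i * D) := by
    intro k hk
    rw [hB, hC, Finset.mem_union, Finset.mem_image, Finset.mem_image] at hk
    rcases hk with ⟨i, hi, h⟩ | ⟨i, hi, h⟩
    · left; exact ⟨i, Finset.mem_range.1 hi, h.symm⟩
    · right; exact ⟨i, Finset.mem_range.1 hi, h.symm⟩
  rcases mem k1 h1 with ⟨i1, hi1, e1⟩ | ⟨i1, hi1, e1⟩ <;>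
  rcases mem k2 h2 with ⟨i2, hi2, e2⟩ | ⟨i2, hi2, e2⟩ <;>
  rcases mem k3 h3 with ⟨i3, hi3, e3⟩ | ⟨i3, hi3, e3⟩ <;>
  have b1 := bd i1 (by omega) <;> have b2 := bd i2 (by omega) <;> have b3 := bd i3 (by omega)
  case inl.inr.inl =>
    have e : ((i1 : ℤ) + i3 - i2) * D = n - p := by rw [← hk, e1, e2, e3]; ring
    have z : (i1 : ℤ) + i3 - i2 = 0 := by
      by_contra hne
      rcases lt_or_gt_of_ne hne with h | h
      · have : ((i1 : ℤ) + i3 - i2) * D ≤ -D := by nlinarith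
        omega
      · have : D ≤ ((i1 : ℤ) + i3 - i2) * D := by nlinarith
        omega
    rw [z] at e
    refine ⟨by omega, i1, i3, hi1, hi3, e1, ?_⟩
    rw [e2]; congr 2; omega
  all_goals (exfalso; omega)

lemma enorm_tri (u v w : ℂ) : ‖u * (starRingEnd ℂ) v * w‖ₑ = ‖u‖ₑ * ‖v‖ₑ * ‖w‖ₑ := by
  rw [enorm_mul, enorm_mul]
  congr 2
  rw [← ofReal_norm, ← ofReal_norm, RCLike.norm_conj]

lemma blob (p L : ℤ) (hp : |p| ≤ L) (h0 : ℝ → ℂ) (hh0 : ContDiff ℝ 1 h0) (G : ℝ)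
    (hG : ∀ t, ‖h0 t‖ ≤ G) (χ : ℝ → ℝ) (hχ : ContDiff ℝ 1 χ) (hχ0 : ∀ t, 0 ≤ χ t)
    (hχ1 : ∀ t, χ t ≤ 1) (δ : ℝ) (hδ : 0 < δ) :
    ∃ z : ℤ → ℝ → ℂ, (∃ F : Finset ℤ, ∀ k ∉ F, ∀ t, z k t = 0) ∧
      (∀ k, ContDiff ℝ 1 (z k)) ∧ (∀ k, |k| ≤ L → ∀ t, z k t = 0) ∧
      (∀ k t, ‖z k t‖ ≤ δ) ∧ (∀ t, ∑' k, ‖z k t‖ₑ ^ 2 ≤ ENNReal.ofReal δ) ∧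
      (∀ k t, χ t = 0 → h0 t = 0 → z k t = 0) ∧
      (∀ n t, |n| ≤ L → n ≠ p → ∀ q, cubT (fun k => z k t) n q = 0) ∧
      (∀ t, ∑' q, ‖cubT (fun k => z k t) p q‖ₑ ≤ ‖h0 t‖ₑ ∧
        cubN (fun k => z k t) p = - (h0 t * (χ t : ℂ) ^ 2)) := by
  have hG0 : 0 ≤ G := (norm_nonneg _).trans (hG 0)
  have hL : 0 ≤ L := (abs_nonneg _).trans hp
  obtain ⟨m, hm⟩ := exists_nat_gt (max 1 (3 * (1 + G) ^ 2 / δ))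
  have hm1 : (1 : ℝ) < m := (le_max_left _ _).trans_lt hm
  have hm0 : (0 : ℝ) < m := by linarith
  have hm2 : 3 * (1 + G) ^ 2 / m ≤ δ := by
    have := (le_max_right _ _).trans_lt hm
    rw [div_lt_iff₀ hδ] at this
    rw [div_le_iff₀ hm0]; linarith
  set K : ℕ := m ^ 8 with hK
  set β : ℝ := ((m : ℝ) ^ 5)⁻¹ with hβ
  set γ : ℝ := ((m : ℝ) ^ 6)⁻¹ with hγ
  have hβ0 : 0 < β := by positivity
  have hγ0 : 0 < γ := by positivity
  set D : ℤ := 2 * L + 1 with hD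
  set W : ℤ := 2 * K * D with hW
  set X : ℤ := 10 * (W + L) + 10 with hX
  have hD0 : 0 < D := by omega
  have hW0 : 0 ≤ W := by positivity
  have hKK : (K : ℝ) ^ 2 * β ^ 2 * γ = 1 := by
    rw [hK, hβ, hγ]; push_cast; field_simp
  obtain ⟨Bs, hB⟩ : ∃ Bs, Bs = (Finset.range K).image (fun i : ℕ => X + i * D) := ⟨_, rfl⟩
  obtain ⟨Cs, hC⟩ : ∃ Cs, Cs = (Finset.range (2 * K)).image
    (fun i : ℕ => (2 * X - p) + i * D) := ⟨_, rfl⟩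
  have hp' := abs_le.1 hp
  have bd : ∀ i : ℕ, i < 2 * K → 0 ≤ (i : ℤ) * D ∧ (i : ℤ) * D ≤ W := by
    intro i hi
    refine ⟨by positivity, ?_⟩
    rw [hW]
    have : (i : ℤ) ≤ 2 * K := by exact_mod_cast hi.le
    nlinarith
  have memB : ∀ k ∈ Bs, X ≤ k ∧ k ≤ X + W := by
    intro k hk
    rw [hB, Finset.mem_image] at hk
    obtain ⟨i, hi, rfl⟩ := hk
    have := bd i (by have := Finset.mem_range.1 hi; omega)
    omega
  have memC : ∀ k ∈ Cs, 2 * X - p ≤ k ∧ k ∉ Bs := by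
    intro k hk
    rw [hC, Finset.mem_image] at hk
    obtain ⟨i, hi, rfl⟩ := hk
    have := bd i (by have := Finset.mem_range.1 hi; omega)
    refine ⟨by omega, fun h => ?_⟩
    have := memB _ h
    omega
  have memU : ∀ k ∈ Bs ∪ Cs, L < |k| := by
    intro k hk
    rw [lt_abs]; left
    rcases Finset.mem_union.1 hk with h | h
    · have := memB k h; omega
    · have := memC k h; omega
  set z : ℤ → ℝ → ℂ := fun k t => if k ∈ Bs then ((β * χ t : ℝ) : ℂ) else
    if k ∈ Cs then -((γ : ℂ) * (starRingEnd ℂ) (h0 t)) else 0 with hz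
  have zB : ∀ k ∈ Bs, ∀ t, z k t = ((β * χ t : ℝ) : ℂ) := fun k hk t => by simp [hz, hk]
  have zC : ∀ k ∈ Cs, ∀ t, z k t = -((γ : ℂ) * (starRingEnd ℂ) (h0 t)) := fun k hk t => by
    simp [hz, hk, (memC k hk).2]
  have z0 : ∀ k ∉ Bs ∪ Cs, ∀ t, z k t = 0 := fun k hk t => by
    rw [Finset.mem_union, not_or] at hk
    simp [hz, hk.1, hk.2]
  have τb : (1 + G) * β ≤ δ := by
    refine le_trans ?_ hm2
    rw [hβ, ← div_eq_mul_inv]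
    have h5 : (m : ℝ) ≤ m ^ 5 := le_self_pow₀ hm1.le (by norm_num)
    calc (1 + G) / (m : ℝ) ^ 5 ≤ (1 + G) / m := by gcongr
      _ ≤ 3 * (1 + G) ^ 2 / m := by gcongr; nlinarith
  have zn : ∀ k t, ‖z k t‖ ≤ (1 + G) * β := by
    intro k t
    by_cases h1 : k ∈ Bs
    · rw [zB k h1, Complex.norm_real, Real.norm_eq_abs, abs_of_nonneg (mul_nonneg hβ0.le (hχ0 t))]
      have := hχ1 t
      nlinarith [mul_nonneg hβ0.le hG0, mul_le_mul_of_nonneg_left this hβ0.le]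
    · by_cases h2 : k ∈ Cs
      · rw [zC k h2, norm_neg, norm_mul, RCLike.norm_conj, Complex.norm_real, Real.norm_eq_abs,
          abs_of_pos hγ0]
        have h3 : γ ≤ β := by
          rw [hγ, hβ]; gcongr; exact hm1.le; norm_num
        have := hG t
        have h4 : γ * ‖h0 t‖ ≤ β * G := by gcongr
        nlinarith
      · rw [z0 k (by simp [h1, h2])]; simp; positivity
  refine ⟨z, ⟨Bs ∪ Cs, z0⟩, ?_, ?_, fun k t => (zn k t).trans τb, ?_, ?_, ?_, ?_⟩
  · intro k
    by_cases h1 : k ∈ Bs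
    · have : z k = fun t => ((β * χ t : ℝ) : ℂ) := funext fun t => zB k h1 t
      rw [this]
      exact Complex.ofRealCLM.contDiff.comp (contDiff_const.mul hχ)
    · by_cases h2 : k ∈ Cs
      · have : z k = fun t => -((γ : ℂ) * (starRingEnd ℂ) (h0 t)) := funext fun t => zC k h2 t
        rw [this]
        exact (contDiff_const.mul (Complex.conjCLE.contDiff.comp hh0)).neg
      · have : z k = fun t => 0 := funext fun t => z0 k (by simp [h1, h2]) t
        rw [this]; exact contDiff_const
  · intro k hk t
    exact z0 k (fun h => absurd (memU k h) (by omega)) t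
  · intro t
    rw [tsum_eq_sum (s := Bs ∪ Cs) (fun k hk => by simp [z0 k hk t])]
    have h1 : ∀ k ∈ Bs ∪ Cs, ‖z k t‖ₑ ^ 2 ≤ ENNReal.ofReal (((1 + G) * β) ^ 2) := by
      intro k _
      rw [← ofReal_norm, ← ENNReal.ofReal_pow (norm_nonneg _)]
      gcongr
      exact zn k t
    refine (Finset.sum_le_card_nsmul _ _ _ h1).trans ?_
    rw [← ENNReal.ofReal_nsmul]
    apply ENNReal.ofReal_le_ofReal
    have hcard : (Bs ∪ Cs).card ≤ 3 * K := by
      refine (Finset.card_union_le _ _).trans ?_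
      have c1 : Bs.card ≤ K := by rw [hB]; exact Finset.card_image_le.trans (by simp)
      have c2 : Cs.card ≤ 2 * K := by rw [hC]; exact Finset.card_image_le.trans (by simp)
      omega
    rw [nsmul_eq_mul]
    have hcard' : ((Bs ∪ Cs).card : ℝ) ≤ 3 * (m : ℝ) ^ 8 := by
      have : ((Bs ∪ Cs).card : ℝ) ≤ ((3 * K : ℕ) : ℝ) := by exact_mod_cast hcard
      rw [hK] at this; push_cast at this; exact this
    calc ((Bs ∪ Cs).card : ℝ) * ((1 + G) * β) ^ 2 ≤ 3 * (m : ℝ) ^ 8 * ((1 + G) * β) ^ 2 := by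
          gcongr
      _ = 3 * (1 + G) ^ 2 / (m : ℝ) ^ 2 := by rw [hβ]; field_simp
      _ ≤ 3 * (1 + G) ^ 2 / m := by
          gcongr; exact le_self_pow₀ hm1.le (by norm_num)
      _ ≤ δ := hm2
  · intro k t h1 h2
    by_cases hb : k ∈ Bs
    · rw [zB k hb, h1]; simp
    · by_cases hc : k ∈ Cs
      · rw [zC k hc, h2]; simp
      · exact z0 k (by simp [hb, hc]) t
  · intro n t hn hnp q
    by_contra hne
    simp only [cubT] at hne
    have g1 : q.1 ∈ Bs ∪ Cs := by by_contra h; exact hne (by rw [z0 _ h]; simp)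
    have g2 : q.2 ∈ Bs ∪ Cs := by by_contra h; exact hne (by rw [z0 _ h]; simp)
    have g3 : n - q.1 + q.2 ∈ Bs ∪ Cs := by by_contra h; exact hne (by rw [z0 _ h]; simp)
    exact hnp (blob_comb p L D W X K hp hD hW hX n q.1 q.2 _ hn (by ring) Bs Cs hB hC g1 g2 g3).1
  · intro t
    set φ : ℕ × ℕ → ℤ × ℤ := fun i => (X + i.1 * D, (2 * X - p) + (i.1 + i.2) * D) with hφ
    have φinj : Function.Injective φ := by
      rintro ⟨i, i'⟩ ⟨j, j'⟩ h
      simp only [hφ, Prod.mk.injEq, add_right_inj, mul_eq_mul_right_iff, hD0.ne', or_false] at h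
      ext <;> simp <;> omega
    set Q : Finset (ℤ × ℤ) := (Finset.range K ×ˢ Finset.range K).image φ with hQ
    have hQc : Q.card = K ^ 2 := by
      rw [hQ, Finset.card_image_of_injective _ φinj]; simp [sq]
    have off : ∀ q ∉ Q, cubT (fun k => z k t) p q = 0 := by
      intro q hq
      by_contra hne
      simp only [cubT] at hne
      have g1 : q.1 ∈ Bs ∪ Cs := by by_contra h; exact hne (by rw [z0 _ h]; simp)
      have g2 : q.2 ∈ Bs ∪ Cs := by by_contra h; exact hne (by rw [z0 _ h]; simp)
      have g3 : p - q.1 + q.2 ∈ Bs ∪ Cs := by by_contra h; exact hne (by rw [z0 _ h]; simp)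
      obtain ⟨-, i, i', hi, hi', e1, e2⟩ :=
        blob_comb p L D W X K hp hD hW hX p q.1 q.2 _ hp (by ring) Bs Cs hB hC g1 g2 g3
      apply hq
      rw [hQ, Finset.mem_image]
      exact ⟨(i, i'), by simp [hi, hi'], Prod.ext e1.symm e2.symm⟩
    have on : ∀ q ∈ Q, cubT (fun k => z k t) p q
        = - ((β ^ 2 * γ : ℝ) * (h0 t * (χ t : ℂ) ^ 2)) := by
      intro q hq
      rw [hQ, Finset.mem_image] at hq
      obtain ⟨⟨i, i'⟩, hi, rfl⟩ := hq
      simp only [Finset.mem_product, Finset.mem_range] at hi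
      simp only [cubT, hφ]
      rw [zB (X + i * D) (by rw [hB]; exact Finset.mem_image.2 ⟨i, by simp [hi.1], rfl⟩),
        zC ((2 * X - p) + (i + i') * D) (by
          rw [hC]; exact Finset.mem_image.2 ⟨i + i', by simp; omega, by push_cast; rfl⟩),
        zB (p - (X + i * D) + ((2 * X - p) + (i + i') * D)) (by
          rw [hB]; exact Finset.mem_image.2 ⟨i', by simp [hi.2], by ring⟩)]
      simp
      ring
    constructor
    · rw [tsum_eq_sum (s := Q) (fun q hq => by simp [off q hq])]
      have h1 : ∀ q ∈ Q, ‖cubT (fun k => z k t) p q‖ₑ ≤ ENNReal.ofReal (β ^ 2 * γ * ‖h0 t‖) := by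
        intro q hq
        rw [on q hq, ← ofReal_norm]
        apply ENNReal.ofReal_le_ofReal
        rw [norm_neg, norm_mul, norm_mul, norm_pow, Complex.norm_real, Complex.norm_real,
          Real.norm_eq_abs, Real.norm_eq_abs, abs_of_nonneg (hχ0 t),
          abs_of_pos (by positivity : 0 < β ^ 2 * γ)]
        have : χ t ^ 2 ≤ 1 := pow_le_one₀ (hχ0 t) (hχ1 t)
        gcongr
        calc ‖h0 t‖ * χ t ^ 2 ≤ ‖h0 t‖ * 1 := by gcongr
          _ = _ := mul_one _
      refine (Finset.sum_le_card_nsmul _ _ _ h1).trans ?_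
      rw [← ENNReal.ofReal_nsmul, ← ofReal_norm, hQc, nsmul_eq_mul]
      apply ENNReal.ofReal_le_ofReal
      push_cast
      calc (K : ℝ) ^ 2 * (β ^ 2 * γ * ‖h0 t‖) = ((K : ℝ) ^ 2 * β ^ 2 * γ) * ‖h0 t‖ := by ring
        _ ≤ _ := by rw [hKK, one_mul]
    · rw [cubN, tsum_eq_sum (s := Q) off, Finset.sum_congr rfl on, Finset.sum_const, hQc,
        nsmul_eq_mul]
      have : ((K : ℂ)) ^ 2 * (β : ℂ) ^ 2 * γ = 1 := by exact_mod_cast congrArg Complex.ofReal hKK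
      push_cast
      linear_combination (- (h0 t * (χ t : ℂ) ^ 2)) * this

end

section
open scoped Real Topology

/-- Residual of the equation. -/
noncomputable def Res (ω : ℤ → ℝ) (a : ℤ → ℝ → ℂ) (n : ℤ) (t : ℝ) : ℂ :=
  Complex.I * deriv (a n) t + (ω n : ℂ) * a n t + cubN (fun k => a k t) n

/-- Coefficient families which are `C¹` with an absolutely summable majorant. -/
def GoodS (a : ℤ → ℝ → ℂ) : Prop :=
  (∀ n, ContDiff ℝ 1 (a n)) ∧ ∃ B : ℤ → ℝ, Summable B ∧ ∀ n t, ‖a n t‖ ≤ B n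

lemma summable_tri (B : ℤ → ℝ) (hB : Summable B) (hB0 : ∀ n, 0 ≤ B n) (n : ℤ) :
    Summable (fun q : ℤ × ℤ => B q.1 * B q.2 * B (n - q.1 + q.2)) := by
  have h := (hB.mul_of_nonneg hB hB0 hB0).mul_right (∑' k, B k)
  refine Summable.of_nonneg_of_le (fun q => ?_) (fun q => ?_) h
  · exact mul_nonneg (mul_nonneg (hB0 _) (hB0 _)) (hB0 _)
  · exact mul_le_mul_of_nonneg_left (hB.le_tsum _ (fun j _ => hB0 j))
      (mul_nonneg (hB0 _) (hB0 _))

lemma norm_cubT_le (v : ℤ → ℂ) (B : ℤ → ℝ) (h : ∀ n, ‖v n‖ ≤ B n) (n : ℤ) (q : ℤ × ℤ) :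
    ‖cubT v n q‖ ≤ B q.1 * B q.2 * B (n - q.1 + q.2) := by
  have hB0 : ∀ n, 0 ≤ B n := fun n => (norm_nonneg _).trans (h n)
  rw [cubT, norm_mul, norm_mul, RCLike.norm_conj]
  have h1 := h q.1
  have h2 := h q.2
  have h3 := h (n - q.1 + q.2)
  have := hB0 q.1
  have := hB0 q.2
  gcongr

lemma summable_cubT (v : ℤ → ℂ) (B : ℤ → ℝ) (hB : Summable B) (h : ∀ n, ‖v n‖ ≤ B n) (n : ℤ) :
    Summable (cubT v n) :=
  Summable.of_norm_bounded (summable_tri B hB (fun n => (norm_nonneg _).trans (h n)) n)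
    (norm_cubT_le v B h n)

lemma continuous_cubN (a : ℤ → ℝ → ℂ) (h : GoodS a) (n : ℤ) :
    Continuous (fun t => cubN (fun k => a k t) n) := by
  obtain ⟨hc, B, hB, hb⟩ := h
  have hB0 : ∀ n, 0 ≤ B n := fun n => (norm_nonneg _).trans (hb n 0)
  unfold cubN
  refine continuous_tsum (fun q => ?_) (summable_tri B hB hB0 n) (fun q t => ?_)
  · unfold cubT
    have := fun k => (hc k).continuous
    exact (((this _).mul (Complex.continuous_conj.comp (this _)))).mul (this _)
  · exact norm_cubT_le _ B (fun k => hb k t) n q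

lemma continuous_Res (ω : ℤ → ℝ) (a : ℤ → ℝ → ℂ) (h : GoodS a) (n : ℤ) :
    Continuous (Res ω a n) := by
  unfold Res
  refine (((continuous_const.mul ?_).add (continuous_const.mul (h.1 n).continuous))).add
    (continuous_cubN a h n)
  exact (h.1 n).continuous_deriv le_rfl

lemma norm_tsum_sub_le_of_enorm {ι : Type*} (f g : ι → ℂ) (hf : Summable f) (hg : Summable g) (C : ℝ) (hC : 0 ≤ C)
    (h : ∑' q, ‖f q - g q‖ₑ ≤ ENNReal.ofReal C) : ‖∑' q, f q - ∑' q, g q‖ ≤ C := by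
  rw [← hf.tsum_sub hg]
  have h2 : ‖∑' q, (f q - g q)‖ₑ ≤ ENNReal.ofReal C := (enorm_tsum_le_tsum_enorm).trans h
  rw [← ofReal_norm] at h2
  exact (ENNReal.ofReal_le_ofReal_iff hC).1 h2

lemma step (ω : ℤ → ℝ) (a : ℤ → ℝ → ℂ) (ha : GoodS a) (p L : ℤ) (hp : |p| ≤ L)
    (χ : ℝ → ℝ) (hχ : ContDiff ℝ 1 χ) (hχ0 : ∀ t, 0 ≤ χ t)
    (hχ1 : ∀ t, χ t ≤ 1) (hχc : HasCompactSupport χ) (η : ℝ) (hη : 0 < η) :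
    ∃ a' : ℤ → ℝ → ℂ, GoodS a' ∧ (∀ n, |n| ≤ L → a' n = a n) ∧
      (∀ t, (∀ᶠ s in 𝓝 t, χ s = 0) → ∀ n, a' n =ᶠ[𝓝 t] a n) ∧
      (∀ n t, |n| ≤ L → n ≠ p →
        ∑' q, ‖cubT (fun k => a' k t) n q - cubT (fun k => a k t) n q‖ₑ ≤ ENNReal.ofReal η) ∧
      (∀ t, ∑' q, ‖cubT (fun k => a' k t) p q - cubT (fun k => a k t) p q‖ₑ
          ≤ ENNReal.ofReal (‖Res ω a p t‖ + 2 * η)) ∧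
      (∀ t, χ t = 1 → ‖Res ω a' p t‖ ≤ 2 * η) := by
  have hcont := continuous_Res ω a ha p
  obtain ⟨g, hg, hgR, -⟩ := hcont.exists_contDiff_approx 1 (continuous_const (y := η))
    (fun _ => hη)
  obtain ⟨hc, B, hB, hb⟩ := id ha
  have hB0 : ∀ n, 0 ≤ B n := fun n => (norm_nonneg _).trans (hb n 0)
  set S := ∑' k, B k with hS
  have hS0 : 0 ≤ S := tsum_nonneg hB0
  set h0 : ℝ → ℂ := fun t => g t * (χ t : ℂ) with hh
  have hh0 : ContDiff ℝ 1 h0 := hg.mul (Complex.ofRealCLM.contDiff.comp hχ)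
  obtain ⟨G, hG⟩ : ∃ G, ∀ t, ‖h0 t‖ ≤ G := by
    have : HasCompactSupport h0 := by
      have h1 : HasCompactSupport (fun t => (χ t : ℂ)) := hχc.comp_left Complex.ofReal_zero
      exact h1.mul_left
    exact hh0.continuous.bounded_above_of_compact_support this
  set δ := η / (3 * S ^ 2 + 6 * S + 1) with hδ
  have hden : 0 < 3 * S ^ 2 + 6 * S + 1 := by positivity
  have hδ0 : 0 < δ := by positivity
  have hδ1 : (3 * S ^ 2 + 6 * S) * δ ≤ η := by
    rw [hδ, mul_div_assoc', div_le_iff₀ hden]; nlinarith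
  obtain ⟨z, ⟨F, hF⟩, zc, zL, zn, z2, zz, zcub, zp⟩ :=
    blob p L hp h0 hh0 G hG χ hχ hχ0 hχ1 δ hδ0
  set a' : ℤ → ℝ → ℂ := fun n => a n + z n with ha'
  have good' : GoodS a' := by
    refine ⟨fun n => (hc n).add (zc n), fun n => B n + if n ∈ F then δ else 0, ?_, ?_⟩
    · refine hB.add (summable_of_ne_finset_zero (s := F) fun n hn => by simp [hn])
    · intro n t
      refine (norm_add_le _ _).trans (add_le_add (hb n t) ?_)
      split_ifs with h
      · exact zn n t
      · rw [hF n h]; simp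
  have eqL : ∀ n, |n| ≤ L → a' n = a n := by
    intro n hn; ext t; simp [ha', zL n hn t]
  have hsumA : ∀ t, ∑' x, ‖a x t‖ₑ ≤ ENNReal.ofReal S := by
    intro t
    rw [hS, ENNReal.ofReal_tsum_of_nonneg hB0 hB]
    refine ENNReal.tsum_le_tsum fun n => ?_
    rw [← ofReal_norm]; exact ENNReal.ofReal_le_ofReal (hb n t)
  have cross : ∀ n t, ∑' q, ‖cubT (fun k => a' k t) n q - cubT (fun k => a k t) n q
      - cubT (fun k => z k t) n q‖ₑ ≤ ENNReal.ofReal η := by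
    intro n t
    have h := cross_bound (fun k => a k t) (fun k => z k t) n (ENNReal.ofReal δ) (fun k => by
      rw [← ofReal_norm]; exact ENNReal.ofReal_le_ofReal (zn k t))
    refine h.trans ?_
    calc _ ≤ 3 * (ENNReal.ofReal S * ENNReal.ofReal S * ENNReal.ofReal δ)
          + 6 * (ENNReal.ofReal S * ENNReal.ofReal δ) := by
          gcongr
          · exact hsumA t
          · exact hsumA t
          · exact hsumA t
          · exact z2 t
      _ = ENNReal.ofReal ((3 * S ^ 2 + 6 * S) * δ) := by
          rw [← ENNReal.ofReal_mul hS0, ← ENNReal.ofReal_mul (by positivity),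
            ← ENNReal.ofReal_mul hS0, show (3 : ENNReal) = ENNReal.ofReal 3 by simp,
            show (6 : ENNReal) = ENNReal.ofReal 6 by simp, ← ENNReal.ofReal_mul (by norm_num),
            ← ENNReal.ofReal_mul (by norm_num), ← ENNReal.ofReal_add (by positivity) (by positivity)]
          congr 1; ring
      _ ≤ _ := ENNReal.ofReal_le_ofReal hδ1
  have gR : ∀ t, ‖g t - Res ω a p t‖ ≤ η := fun t => by
    rw [← dist_eq_norm]; exact (hgR t).le
  have sum1 : ∀ n t, Summable (cubT (fun k => a k t) n) := fun n t =>
    summable_cubT _ B hB (fun k => hb k t) n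
  have sum2 : ∀ n t, Summable (cubT (fun k => a' k t) n) := fun n t => by
    obtain ⟨-, B', hB', hb'⟩ := good'
    exact summable_cubT _ B' hB' (fun k => hb' k t) n
  have sum3 : ∀ n t, Summable (cubT (fun k => z k t) n) := fun n t =>
    summable_cubT _ (fun n => if n ∈ F then δ else 0)
      (summable_of_ne_finset_zero (s := F) fun n hn => by simp [hn]) (fun k => by
        split_ifs with h
        · exact zn k t
        · rw [hF k h]; simp) n
  refine ⟨a', good', eqL, ?_, ?_, ?_, ?_⟩
  · intro t ht n
    filter_upwards [ht] with s hs
    simp [ha', zz n s hs (by simp [hh, hs])]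
  · intro n t hn hnp
    have := cross n t
    simp only [zcub n t hn hnp, sub_zero] at this
    exact this
  · intro t
    have h1 : ‖h0 t‖ ≤ ‖Res ω a p t‖ + η := by
      rw [hh, norm_mul, Complex.norm_real, Real.norm_eq_abs, abs_of_nonneg (hχ0 t)]
      have : ‖g t‖ ≤ ‖Res ω a p t‖ + η := by
        have := norm_add_le (Res ω a p t) (g t - Res ω a p t)
        rw [add_sub_cancel] at this
        linarith [gR t]
      calc ‖g t‖ * χ t ≤ ‖g t‖ * 1 := by gcongr; exact hχ1 t
        _ ≤ _ := by linarith
    calc _ ≤ ∑' q, (‖cubT (fun k => a' k t) p q - cubT (fun k => a k t) p q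
      - cubT (fun k => z k t) p q‖ₑ + ‖cubT (fun k => z k t) p q‖ₑ) := by
          refine ENNReal.tsum_le_tsum fun q => ?_
          refine le_trans (le_of_eq ?_) (enorm_add_le _ _)
          rw [sub_add_cancel]
      _ ≤ ENNReal.ofReal η + ENNReal.ofReal (‖Res ω a p t‖ + η) := by
          rw [ENNReal.tsum_add]
          gcongr
          · exact cross p t
          · refine (zp t).1.trans ?_
            rw [← ofReal_norm]; exact ENNReal.ofReal_le_ofReal h1
      _ = _ := by
          rw [← ENNReal.ofReal_add hη.le (by positivity)]; congr 1; ring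
  · intro t ht
    have h1 : ‖∑' q, (cubT (fun k => a' k t) p q - cubT (fun k => a k t) p q)
        - ∑' q, cubT (fun k => z k t) p q‖ ≤ η :=
      norm_tsum_sub_le_of_enorm _ _ ((sum2 p t).sub (sum1 p t)) (sum3 p t) η hη.le (cross p t)
    rw [(sum2 p t).tsum_sub (sum1 p t)] at h1
    have h2 := (zp t).2
    have h3 : h0 t = g t := by simp [hh, ht]
    rw [ht, h3] at h2
    have e : Res ω a' p t = (cubN (fun k => a' k t) p - cubN (fun k => a k t) p
        - cubN (fun k => z k t) p) - (g t - Res ω a p t) := by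
      rw [h2]
      unfold Res
      rw [eqL p hp]
      push_cast
      ring
    rw [e]
    refine (norm_sub_le _ _).trans ?_
    have := gR t
    unfold cubN
    linarith

end

section
open scoped Real Topology
open Filter

/-- limit of the trilinear terms along a sequence with summable increments -/
lemma limit_tsum {ι : Type*} (c : ℕ → ι → ℂ) (d : ι → ℂ) (hs : ∀ j, Summable (c j))
    (hd : ∀ q, ∀ᶠ j in atTop, c j q = d q)
    (hD : ∃ j0, ∑' j, ∑' q, ‖c (j + j0 + 1) q - c (j + j0) q‖ₑ ≠ ⊤) :
    Tendsto (fun j => ∑' q, c j q) atTop (𝓝 (∑' q, d q)) := by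
  obtain ⟨j0, hD⟩ := hD
  set D : ℕ → ENNReal := fun j => ∑' q, ‖c (j + j0 + 1) q - c (j + j0) q‖ₑ with hDd
  have tail : ∀ j, ∑' q, ‖d q - c (j + j0) q‖ₑ ≤ ∑' k, D (k + j) := by
    intro j
    have : ∀ q, ‖d q - c (j + j0) q‖ₑ ≤ ∑' k, ‖c (k + j + j0 + 1) q - c (k + j + j0) q‖ₑ := by
      intro q
      obtain ⟨M, hM⟩ := eventually_atTop.1 (hd q)
      have h1 : ∀ m, ‖c (m + j + j0) q - c (j + j0) q‖ₑ ≤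
          ∑ k ∈ Finset.range m, ‖c (k + j + j0 + 1) q - c (k + j + j0) q‖ₑ := by
        intro m
        induction m with
        | zero => simp
        | succ m ih =>
          rw [Finset.sum_range_succ]
          calc _ = ‖(c (m + j + j0) q - c (j + j0) q)
                + (c (m + j + j0 + 1) q - c (m + j + j0) q)‖ₑ := by
                congr 1
                rw [show m + 1 + j + j0 = m + j + j0 + 1 by ring]; ring
            _ ≤ _ := enorm_add_le _ _
            _ ≤ _ := by gcongr
      rw [← hM (M + j + j0) (by omega)]
      exact (h1 M).trans (ENNReal.sum_le_tsum _)
    calc _ ≤ ∑' q, ∑' k, ‖c (k + j + j0 + 1) q - c (k + j + j0) q‖ₑ := ENNReal.tsum_le_tsum this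
      _ = _ := ENNReal.tsum_comm
  have t0 : Tendsto (fun j => ∑' k, D (k + j)) atTop (𝓝 0) := ENNReal.tendsto_sum_nat_add D hD
  have sumd : Summable d := by
    have h1 : ∑' q, ‖d q - c (0 + j0) q‖ₑ ≠ ⊤ := by
      refine ne_top_of_le_ne_top ?_ (tail 0)
      simpa using hD
    have h2 : Summable (fun q => d q - c (0 + j0) q) := by
      apply Summable.of_norm
      have := ENNReal.summable_toReal h1
      simpa using this
    simpa using h2.add (hs (0 + j0))
  rw [← tendsto_add_atTop_iff_nat j0]
  rw [tendsto_iff_edist_tendsto_0]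
  refine tendsto_of_tendsto_of_tendsto_of_le_of_le tendsto_const_nhds t0 (fun _ => zero_le) ?_
  intro j
  refine le_trans ?_ (tail j)
  simp only
  rw [edist_comm, edist_eq_enorm_sub, ← sumd.tsum_sub (hs _)]
  exact enorm_tsum_le_tsum_enorm

lemma ext_lemma (ω : ℤ → ℝ) (a0 : ℤ → ℝ → ℂ) (ha0 : GoodS a0) (J : Set ℝ) (χ : ℕ → ℝ → ℝ)
    (hχ : ∀ j, ContDiff ℝ 1 (χ j)) (hχ0 : ∀ j t, 0 ≤ χ j t) (hχ1 : ∀ j t, χ j t ≤ 1)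
    (hχc : ∀ j, HasCompactSupport (χ j)) (hχJ : ∀ t ∉ J, ∀ j, ∀ᶠ s in 𝓝 t, χ j s = 0)
    (hχJ' : ∀ t ∈ J, ∀ᶠ j in atTop, χ j t = 1)
    (hres : ∀ n, ∀ t ∉ J, Res ω a0 n t = 0) :
    ∃ a : ℤ → ℝ → ℂ, (∀ n, ContDiff ℝ 1 (a n)) ∧ (∀ t ∉ J, ∀ n, a n =ᶠ[𝓝 t] a0 n) ∧
      ∀ n t, Res ω a n t = 0 := by
  set p : ℕ → ℤ := fun j => (Denumerable.eqv ℤ).symm (Nat.unpair j).1 with hp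
  have hvis : ∀ n : ℤ, ∀ M : ℕ, ∃ j, M ≤ j ∧ p j = n := by
    intro n M
    refine ⟨Nat.pair (Denumerable.eqv ℤ n) M, Nat.right_le_pair _ _, ?_⟩
    simp [hp]
  have hst : ∀ (j : ℕ) (a : {a // GoodS a}), ∃ a' : {a // GoodS a},
      (∀ n, |n| ≤ (j : ℤ) + |p j| → a'.1 n = a.1 n) ∧
      (∀ t, (∀ᶠ s in 𝓝 t, χ j s = 0) → ∀ n, a'.1 n =ᶠ[𝓝 t] a.1 n) ∧
      (∀ n t, |n| ≤ (j : ℤ) + |p j| → n ≠ p j →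
        ∑' q, ‖cubT (fun k => a'.1 k t) n q - cubT (fun k => a.1 k t) n q‖ₑ
          ≤ ENNReal.ofReal ((1/2 : ℝ) ^ j)) ∧
      (∀ t, ∑' q, ‖cubT (fun k => a'.1 k t) (p j) q - cubT (fun k => a.1 k t) (p j) q‖ₑ
          ≤ ENNReal.ofReal (‖Res ω a.1 (p j) t‖ + 2 * (1/2 : ℝ) ^ j)) ∧
      (∀ t, χ j t = 1 → ‖Res ω a'.1 (p j) t‖ ≤ 2 * (1/2 : ℝ) ^ j) := by
    intro j a
    obtain ⟨a', h1, h2⟩ := step ω a.1 a.2 (p j) ((j : ℤ) + |p j|) (by omega) (χ j) (hχ j) (hχ0 j)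
      (hχ1 j) (hχc j) ((1/2 : ℝ) ^ j) (by positivity)
    exact ⟨⟨a', h1⟩, h2⟩
  choose f hf1 hf2 hf3 hf4 hf5 using hst
  let sq : ℕ → {a // GoodS a} := fun j => Nat.rec ⟨a0, ha0⟩ (fun j a => f j a) j
  have sq0 : (sq 0).1 = a0 := rfl
  have sqs : ∀ j, sq (j + 1) = f j (sq j) := fun j => rfl
  have stab : ∀ (n : ℤ) (j : ℕ), (sq (n.natAbs + j)).1 n = (sq n.natAbs).1 n := by
    intro n j
    induction j with
    | zero => rfl
    | succ j ih =>
      rw [← add_assoc, sqs, hf1 _ _ n (by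
        have := abs_nonneg (p (n.natAbs + j)); have := Int.abs_eq_natAbs n; omega), ih]
  set a : ℤ → ℝ → ℂ := fun n => (sq n.natAbs).1 n with ha
  have stab' : ∀ (n : ℤ) (j : ℕ), n.natAbs ≤ j → (sq j).1 n = a n := by
    intro n j hj
    obtain ⟨k, rfl⟩ := Nat.exists_eq_add_of_le hj
    exact stab n k
  have loc : ∀ t ∉ J, ∀ (j : ℕ) n, (sq j).1 n =ᶠ[𝓝 t] a0 n := by
    intro t ht j n
    induction j with
    | zero => rfl
    | succ j ih => rw [sqs]; exact (hf2 j _ t (hχJ t ht j) n).trans ih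
  have loc' : ∀ t ∉ J, ∀ n, a n =ᶠ[𝓝 t] a0 n := fun t ht n => loc t ht _ n
  refine ⟨a, fun n => (sq n.natAbs).2.1 n, loc', ?_⟩
  intro n t
  by_cases ht : t ∈ J
  swap
  · have h1 : ∀ k, a k t = a0 k t := fun k => (loc' t ht k).self_of_nhds
    rw [← hres n t ht]
    unfold Res
    rw [(loc' t ht n).deriv_eq]
    simp only [h1]
  obtain ⟨M0, hM0⟩ := eventually_atTop.1 (hχJ' t ht)
  set M := max M0 n.natAbs with hM
  set c : ℕ → ℤ × ℤ → ℂ := fun j => cubT (fun k => (sq j).1 k t) n with hc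
  have csum : ∀ j, Summable (c j) := fun j => by
    obtain ⟨-, B, hB, hb⟩ := (sq j).2
    exact summable_cubT _ B hB (fun k => hb k t) n
  set r : ℕ → ℝ := fun j => ‖Res ω (sq j).1 n t‖ with hr
  have resdiff : ∀ j ≥ M, ∀ C : ℝ, 0 ≤ C → ∑' q, ‖c (j + 1) q - c j q‖ₑ ≤ ENNReal.ofReal C →
      r (j + 1) ≤ r j + C := by
    intro j hj C hC h
    have h1 := norm_tsum_sub_le_of_enorm _ _ (csum (j + 1)) (csum j) C hC h
    have h2 : Res ω (sq (j + 1)).1 n t - Res ω (sq j).1 n t = ∑' q, c (j + 1) q - ∑' q, c j q := by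
      unfold Res cubN
      rw [stab' n (j + 1) (by omega), stab' n j (by omega)]
      simp only [hc]
      ring
    rw [← h2] at h1
    have := norm_sub_norm_le (Res ω (sq (j + 1)).1 n t) (Res ω (sq j).1 n t)
    simp only [hr]
    linarith
  have dbound : ∀ j ≥ M, ∑' q, ‖c (j + 1) q - c j q‖ₑ ≤
      ENNReal.ofReal (r j - r (j + 1) + 4 * (1/2 : ℝ) ^ j) ∧
      0 ≤ r j - r (j + 1) + 4 * (1/2 : ℝ) ^ j := by
    intro j hj
    have pw : 0 < (1/2 : ℝ) ^ j := by positivity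
    by_cases h : n = p j
    · have h4 := hf4 j (sq j) t
      have h5 := hf5 j (sq j) t (hM0 j (by omega))
      rw [← sqs, ← h] at h4 h5
      have h6 : r (j + 1) ≤ 2 * (1/2 : ℝ) ^ j := h5
      have h7 : 0 ≤ r j := norm_nonneg _
      refine ⟨h4.trans (ENNReal.ofReal_le_ofReal ?_), by linarith⟩
      show r j + _ ≤ _
      linarith
    · have h3 := hf3 j (sq j) n t (by
        have := abs_nonneg (p j); have := Int.abs_eq_natAbs n; omega) h
      rw [← sqs] at h3
      have h6 := resdiff j hj _ pw.le h3
      refine ⟨h3.trans (ENNReal.ofReal_le_ofReal ?_), by linarith⟩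
      linarith
  have lim := limit_tsum c (cubT (fun k => a k t) n) csum (fun q => by
      refine eventually_atTop.2 ⟨q.1.natAbs + q.2.natAbs + (n - q.1 + q.2).natAbs, fun j hj => ?_⟩
      simp only [hc, cubT]
      rw [stab' q.1 j (by omega), stab' q.2 j (by omega), stab' (n - q.1 + q.2) j (by omega)])
    ⟨M, by
      set w : ℕ → ℝ := fun j => r (j + M) - r (j + M + 1) + 4 * (1/2 : ℝ) ^ (j + M) with hw
      have hw0 : ∀ j, 0 ≤ w j := fun j => (dbound (j + M) (by omega)).2
      have hws : Summable w := by
        refine summable_of_sum_range_le (c := r M + 8) hw0 fun k => ?_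
        have h1 : ∀ k, ∑ j ∈ Finset.range k, w j = r M - r (k + M)
            + 4 * ∑ j ∈ Finset.range k, (1/2 : ℝ) ^ (j + M) := by
          intro k
          induction k with
          | zero => simp
          | succ k ih =>
            rw [Finset.sum_range_succ, Finset.sum_range_succ, ih]
            simp only [hw]
            rw [show k + 1 + M = k + M + 1 by ring]
            ring
        have h2 : ∑ j ∈ Finset.range k, (1/2 : ℝ) ^ (j + M) ≤ 2 := by
          calc _ ≤ ∑ j ∈ Finset.range k, (1/2 : ℝ) ^ j := by
                refine Finset.sum_le_sum fun j _ => ?_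
                exact pow_le_pow_of_le_one (by norm_num) (by norm_num) (by omega)
            _ ≤ ∑' j : ℕ, (1/2 : ℝ) ^ j := by
                exact summable_geometric_two.sum_le_tsum _ (fun _ _ => by positivity)
            _ = 2 := tsum_geometric_two
        rw [h1]
        have : 0 ≤ r (k + M) := norm_nonneg _
        linarith
      refine ne_top_of_le_ne_top ?_ (ENNReal.tsum_le_tsum fun j => (dbound (j + M) (by omega)).1)
      show ∑' j, ENNReal.ofReal (w j) ≠ ⊤
      rw [← ENNReal.ofReal_tsum_of_nonneg hw0 hws]
      exact ENNReal.ofReal_ne_top⟩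
  have limR : Tendsto (fun j => Res ω (sq j).1 n t) atTop (𝓝 (Res ω a n t)) := by
    have h1 : Tendsto (fun j => Complex.I * deriv (a n) t + (ω n : ℂ) * a n t + ∑' q, c j q) atTop
        (𝓝 (Res ω a n t)) := tendsto_const_nhds.add lim
    refine h1.congr' ?_
    filter_upwards [eventually_ge_atTop n.natAbs] with j hj
    unfold Res cubN
    rw [stab' n j hj]
  have h0 : ∀ δ > 0, ‖Res ω a n t‖ ≤ δ := by
    intro δ hδ
    have e1 : ∀ᶠ j in atTop, ‖Res ω a n t‖ ≤ r (j + 1) + δ / 2 := by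
      have h2 := (tendsto_add_atTop_iff_nat 1).2 limR
      rw [Metric.tendsto_atTop] at h2
      obtain ⟨N, hN⟩ := h2 (δ / 2) (by positivity)
      filter_upwards [eventually_ge_atTop N] with j hj
      have := hN j hj
      rw [dist_comm, dist_eq_norm] at this
      have h4 := norm_sub_norm_le (Res ω a n t) (Res ω (sq (j + 1)).1 n t)
      simp only [hr]
      linarith
    have e2 : ∀ᶠ j : ℕ in atTop, 2 * (1/2 : ℝ) ^ j ≤ δ / 2 := by
      have h3 : Tendsto (fun j : ℕ => 2 * (1/2 : ℝ) ^ j) atTop (𝓝 (2 * 0)) :=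
        (tendsto_pow_atTop_nhds_zero_of_lt_one (by norm_num) (by norm_num)).const_mul 2
      exact (h3.eventually_lt_const (by simpa using half_pos hδ)).mono fun _ h => h.le
    obtain ⟨N, hN⟩ := eventually_atTop.1 (e1.and e2)
    obtain ⟨j, hj, hpj⟩ := hvis n (max N M)
    have h5 := hf5 j (sq j) t (hM0 j (by omega))
    rw [← sqs, hpj] at h5
    have h6 : r (j + 1) ≤ 2 * (1/2 : ℝ) ^ j := h5
    have := hN j (by omega)
    linarith
  have : ‖Res ω a n t‖ ≤ 0 := le_of_forall_pos_le_add fun δ hδ => by simpa using h0 δ hδ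
  exact norm_le_zero_iff.1 this

end

section
open scoped Real Topology
open Filter Set

/-- Smooth cutoffs exhausting an interval. -/
noncomputable def cutI (c d : ℝ) (j : ℕ) (t : ℝ) : ℝ :=
  Real.smoothTransition (j * (t - c) - 1) * Real.smoothTransition (j * (d - t) - 1)

lemma cutI_contDiff (c d : ℝ) (j : ℕ) : ContDiff ℝ 1 (cutI c d j) := by
  unfold cutI
  refine ContDiff.mul ?_ ?_
  · exact Real.smoothTransition.contDiff.comp (n := 1)
      ((contDiff_const.mul (contDiff_id.sub contDiff_const)).sub contDiff_const)
  · exact Real.smoothTransition.contDiff.comp (n := 1)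
      ((contDiff_const.mul (contDiff_const.sub contDiff_id)).sub contDiff_const)

lemma cutI_nonneg (c d : ℝ) (j : ℕ) (t : ℝ) : 0 ≤ cutI c d j t :=
  mul_nonneg (Real.smoothTransition.nonneg _) (Real.smoothTransition.nonneg _)

lemma cutI_le_one (c d : ℝ) (j : ℕ) (t : ℝ) : cutI c d j t ≤ 1 :=
  mul_le_one₀ (Real.smoothTransition.le_one _) (Real.smoothTransition.nonneg _)
    (Real.smoothTransition.le_one _)

lemma cutI_ev_zero (c d : ℝ) (j : ℕ) (t : ℝ) (ht : t ∉ Ioo c d) :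
    ∀ᶠ s in 𝓝 t, cutI c d j s = 0 := by
  have hj : (0 : ℝ) ≤ j := Nat.cast_nonneg j
  by_cases h : t ≤ c
  · have h1 : ∀ᶠ s in 𝓝 t, (j : ℝ) * (s - c) - 1 < 0 := by
      have : Continuous fun s : ℝ => (j : ℝ) * (s - c) - 1 := by fun_prop
      refine this.continuousAt.eventually_lt_const (?_ : (j : ℝ) * (t - c) - 1 < 0)
      nlinarith
    filter_upwards [h1] with s hs
    rw [cutI, Real.smoothTransition.zero_of_nonpos hs.le, zero_mul]
  · have h' : d ≤ t := by
      by_contra h2; exact ht ⟨not_le.1 h, not_le.1 h2⟩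
    have h1 : ∀ᶠ s in 𝓝 t, (j : ℝ) * (d - s) - 1 < 0 := by
      have : Continuous fun s : ℝ => (j : ℝ) * (d - s) - 1 := by fun_prop
      refine this.continuousAt.eventually_lt_const (?_ : (j : ℝ) * (d - t) - 1 < 0)
      nlinarith
    filter_upwards [h1] with s hs
    rw [cutI, Real.smoothTransition.zero_of_nonpos hs.le, mul_zero]

lemma cutI_zero (c d : ℝ) (j : ℕ) (t : ℝ) (ht : t ∉ Ioo c d) : cutI c d j t = 0 :=
  (cutI_ev_zero c d j t ht).self_of_nhds

lemma cutI_ev_one (c d : ℝ) (t : ℝ) (ht : t ∈ Ioo c d) :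
    ∀ᶠ j in atTop, cutI c d j t = 1 := by
  have h1 : 0 < t - c := sub_pos.2 ht.1
  have h2 : 0 < d - t := sub_pos.2 ht.2
  have e1 : ∀ᶠ j : ℕ in atTop, 2 ≤ (j : ℝ) * (t - c) :=
    (tendsto_natCast_atTop_atTop.atTop_mul_const h1).eventually_ge_atTop 2
  have e2 : ∀ᶠ j : ℕ in atTop, 2 ≤ (j : ℝ) * (d - t) :=
    (tendsto_natCast_atTop_atTop.atTop_mul_const h2).eventually_ge_atTop 2
  filter_upwards [e1, e2] with j g1 g2
  rw [cutI, Real.smoothTransition.one_of_one_le (by linarith),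
    Real.smoothTransition.one_of_one_le (by linarith), one_mul]

lemma assemble (ω : ℤ → ℝ) (T : ℝ) (hT : 0 < T) (u d : ℤ → ℝ → ℂ) (B : ℤ → ℝ) (hB : Summable B)
    (hu : ∀ n, ∀ t ∈ Icc 0 T, ‖u n t‖ ≤ B n) (hd : ∀ n, ∀ t ∈ Icc 0 T, ‖d n t‖ ≤ B n)
    (hdc : ∀ n, ContinuousOn (d n) (Icc 0 T))
    (hud : ∀ n, ∀ t ∈ Icc 0 T, HasDerivWithinAt (u n) (d n t) (Icc 0 T) t)
    (heq : ∀ n, ∀ t ∈ Icc 0 T,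
      Complex.I * d n t + (ω n : ℂ) * u n t + cubN (fun k => u k t) n = 0) :
    ∃ a : ℤ → ℝ → ℂ, (∀ n, ContDiff ℝ 1 (a n)) ∧ (∀ n, ∀ t ∈ Icc 0 T, a n t = u n t) ∧
      ∀ n t, Res ω a n t = 0 := by
  have h0T : (0 : ℝ) ∈ Icc 0 T := ⟨le_rfl, hT.le⟩
  set e : ℤ → ℝ → ℂ := fun n => IccExtend hT.le ((Icc 0 T).domRestrict (d n)) with he
  have ec : ∀ n, Continuous (e n) := fun n =>
    (continuousOn_iff_continuous_domRestrict.1 (hdc n)).Icc_extend'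
  have ee : ∀ n, ∀ t ∈ Icc 0 T, e n t = d n t := by
    intro n t ht
    simp only [he]
    rw [IccExtend_of_mem _ _ ht]; rfl
  have eb : ∀ n t, ‖e n t‖ ≤ B n := fun n t => hd n _ (projIcc 0 T hT.le t).2
  have hB0 : ∀ n, 0 ≤ B n := fun n => (norm_nonneg _).trans (hu n 0 h0T)
  set w : ℤ → ℝ → ℂ := fun n t => u n 0 + ∫ s in (0:ℝ)..t, e n s with hw
  have wd : ∀ n t, HasDerivAt (w n) (e n t) t := fun n t =>
    ((ec n).integral_hasStrictDerivAt 0 t).hasDerivAt.const_add _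
  have wc : ∀ n, ContDiff ℝ 1 (w n) := by
    intro n
    rw [contDiff_one_iff_deriv]
    refine ⟨fun t => (wd n t).differentiableAt, ?_⟩
    have : deriv (w n) = e n := funext fun t => (wd n t).deriv
    rw [this]; exact ec n
  have wu : ∀ n, ∀ t ∈ Icc 0 T, w n t = u n t := by
    intro n
    refine eq_of_derivWithin_eq (a := 0) (b := T) (f := w n) (g := u n)
      (fun t _ => (wd n t).differentiableAt.differentiableWithinAt)
      (fun t ht => (hud n t ht).differentiableWithinAt) ?_ (by simp [hw])
    intro t ht
    have ht' : t ∈ Icc 0 T := Ico_subset_Icc_self ht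
    have hun := uniqueDiffOn_Icc hT t ht'
    rw [(hud n t ht').derivWithin hun, ((wd n t).hasDerivWithinAt).derivWithin hun, ee n t ht']
  have wb : ∀ n t, ‖w n t‖ ≤ B n * (1 + |t|) := by
    intro n t
    refine (norm_add_le _ _).trans ?_
    have h1 := hu n 0 h0T
    have h2 := intervalIntegral.norm_integral_le_of_norm_le_const
      (f := e n) (a := 0) (b := t) (C := B n) (fun s _ => eb n s)
    rw [sub_zero] at h2
    linarith
  set θ : ℝ → ℝ := fun t => Real.smoothTransition (t + 2) * Real.smoothTransition (T + 2 - t)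
    with hθ
  have θc : ContDiff ℝ 1 θ :=
    (Real.smoothTransition.contDiff.comp (n := 1) (contDiff_id.add contDiff_const)).mul
      (Real.smoothTransition.contDiff.comp (n := 1) (contDiff_const.sub contDiff_id))
  have θ1 : ∀ t, -1 ≤ t → t ≤ T + 1 → θ t = 1 := by
    intro t h1 h2
    simp only [hθ]
    rw [Real.smoothTransition.one_of_one_le (by linarith),
      Real.smoothTransition.one_of_one_le (by linarith), one_mul]
  have θ0 : ∀ t, t ≤ -2 ∨ T + 2 ≤ t → θ t = 0 := by
    rintro t (h | h) <;> simp only [hθ]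
    · rw [Real.smoothTransition.zero_of_nonpos (by linarith), zero_mul]
    · rw [Real.smoothTransition.zero_of_nonpos (x := T + 2 - t) (by linarith), mul_zero]
  have θb : ∀ t, ‖(θ t : ℂ)‖ ≤ 1 := by
    intro t
    rw [Complex.norm_real, Real.norm_eq_abs, abs_of_nonneg
      (mul_nonneg (Real.smoothTransition.nonneg _) (Real.smoothTransition.nonneg _))]
    exact mul_le_one₀ (Real.smoothTransition.le_one _) (Real.smoothTransition.nonneg _)
      (Real.smoothTransition.le_one _)
  set a0 : ℤ → ℝ → ℂ := fun n t => (θ t : ℂ) * w n t with ha0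
  have good : GoodS a0 := by
    refine ⟨fun n => (Complex.ofRealCLM.contDiff.comp θc).mul (wc n), fun n => B n * (T + 3),
      hB.mul_right _, fun n t => ?_⟩
    by_cases h : t ≤ -2 ∨ T + 2 ≤ t
    · simp only [ha0]
      rw [θ0 t h]; simp; have := hB0 n; positivity
    · rw [not_or, not_le, not_le] at h
      simp only [ha0]
      rw [norm_mul]
      have h1 : |t| ≤ T + 2 := abs_le.2 ⟨by linarith, by linarith⟩
      calc _ ≤ 1 * ‖w n t‖ := by gcongr; exact θb t
        _ ≤ B n * (1 + |t|) := by rw [one_mul]; exact wb n t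
        _ ≤ _ := mul_le_mul_of_nonneg_left (by linarith) (hB0 n)
  have near : ∀ t ∈ Icc 0 T, ∀ n, a0 n =ᶠ[𝓝 t] w n := by
    intro t ht n
    filter_upwards [Ioo_mem_nhds (show -1 < t by linarith [ht.1]) (show t < T + 1 by linarith [ht.2])]
      with s hs
    simp [ha0, θ1 s hs.1.le hs.2.le]
  have far : ∀ t, t ≤ -3 ∨ T + 3 ≤ t → ∀ n, a0 n =ᶠ[𝓝 t] fun _ => 0 := by
    rintro t (h | h) n
    · filter_upwards [Iio_mem_nhds (show t < -2 by linarith)] with s hs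
      simp [ha0, θ0 s (Or.inl (le_of_lt hs))]
    · filter_upwards [Ioi_mem_nhds (show T + 2 < t by linarith)] with s hs
      simp [ha0, θ0 s (Or.inr (le_of_lt hs))]
  have hres : ∀ n, ∀ t ∉ Ioo (-3) 0 ∪ Ioo T (T + 3), Res ω a0 n t = 0 := by
    intro n t ht
    rw [mem_union, not_or, mem_Ioo, mem_Ioo, not_and_or, not_and_or, not_lt, not_lt, not_lt,
      not_lt] at ht
    by_cases h : t ≤ -3 ∨ T + 3 ≤ t
    · unfold Res
      rw [(far t h n).deriv_eq]
      have : (fun k => a0 k t) = fun _ => 0 := funext fun k => (far t h k).self_of_nhds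
      rw [this, (far t h n).self_of_nhds]
      simp [cubN, cubT]
    · rw [not_or] at h
      have ht' : t ∈ Icc 0 T := by
        constructor
        · rcases ht.1 with h1 | h1
          · exact absurd h1 h.1
          · exact h1
        · rcases ht.2 with h1 | h1
          · exact h1
          · exact absurd h1 h.2
      unfold Res
      rw [(near t ht' n).deriv_eq, (wd n t).deriv, ee n t ht']
      have : (fun k => a0 k t) = fun k => u k t := funext fun k => by
        rw [(near t ht' k).self_of_nhds, wu k t ht']
      rw [this, (near t ht' n).self_of_nhds, wu n t ht']
      exact heq n t ht'
  obtain ⟨a, h1, h2, h3⟩ := ext_lemma ω a0 good (Ioo (-3) 0 ∪ Ioo T (T + 3))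
    (fun j t => cutI (-3) 0 j t + cutI T (T + 3) j t)
    (fun j => (cutI_contDiff _ _ j).add (cutI_contDiff _ _ j))
    (fun j t => add_nonneg (cutI_nonneg _ _ _ _) (cutI_nonneg _ _ _ _))
    (fun j t => by
      by_cases h : t ≤ 0
      · rw [cutI_zero T (T + 3) j t (fun hh => by linarith [hh.1]), add_zero]
        exact cutI_le_one _ _ _ _
      · rw [cutI_zero (-3) 0 j t (fun hh => h hh.2.le), zero_add]
        exact cutI_le_one _ _ _ _)
    (fun j => HasCompactSupport.intro (isCompact_Icc (a := (-3 : ℝ)) (b := T + 3)) fun t ht => by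
      rw [cutI_zero (-3) 0 j t (fun hh => ht ⟨hh.1.le, by linarith [hh.2]⟩),
        cutI_zero T (T + 3) j t (fun hh => ht ⟨by linarith [hh.1], hh.2.le⟩), add_zero])
    (fun t ht j => by
      rw [mem_union, not_or] at ht
      filter_upwards [cutI_ev_zero _ _ j t ht.1, cutI_ev_zero _ _ j t ht.2] with s g1 g2
      rw [g1, g2, add_zero])
    (fun t ht => by
      rcases ht with ht | ht
      · filter_upwards [cutI_ev_one _ _ t ht] with j hj
        rw [hj, cutI_zero T (T + 3) j t (fun hh => by linarith [hh.1, ht.2]), add_zero]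
      · filter_upwards [cutI_ev_one _ _ t ht] with j hj
        rw [hj, cutI_zero (-3) 0 j t (fun hh => by linarith [hh.2, ht.1]), zero_add])
    hres
  refine ⟨a, h1, fun n t ht => ?_, h3⟩
  have : t ∉ Ioo (-3) 0 ∪ Ioo T (T + 3) := by
    rintro (h | h)
    · linarith [h.2, ht.1]
    · linarith [h.1, ht.2]
  rw [(h2 t this n).self_of_nhds, (near t ht n).self_of_nhds, wu n t ht]

end

section
open scoped Real Topology NNReal
open Filter Set

section tube
variable {E : Type*} [NormedAddCommGroup E] [NormedSpace ℝ E]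

/-- Radial retraction onto the unit ball. -/
noncomputable def ret (z : E) : E := (max 1 ‖z‖)⁻¹ • z

lemma ret_norm_le_one (z : E) : ‖ret z‖ ≤ 1 := by
  have h : 0 < max 1 ‖z‖ := lt_max_of_lt_left one_pos
  rw [ret, norm_smul, norm_inv, Real.norm_eq_abs, abs_of_pos h, inv_mul_le_iff₀ h, mul_one]
  exact le_max_right _ _

lemma ret_norm_le (z : E) : ‖ret z‖ ≤ ‖z‖ := by
  have h : 0 < max 1 ‖z‖ := lt_max_of_lt_left one_pos
  rw [ret, norm_smul, norm_inv, Real.norm_eq_abs, abs_of_pos h, inv_mul_le_iff₀ h]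
  nlinarith [le_max_left 1 ‖z‖, norm_nonneg z]

lemma ret_of_le (z : E) (h : ‖z‖ ≤ 1) : ret z = z := by
  rw [ret, max_eq_left h]; simp

lemma ret_lip (z w : E) : ‖ret z - ret w‖ ≤ 2 * ‖z - w‖ := by
  have hm : 1 ≤ max 1 ‖z‖ := le_max_left _ _
  have hm' : 1 ≤ max 1 ‖w‖ := le_max_left _ _
  set m := max 1 ‖z‖ with hmd
  set m' := max 1 ‖w‖ with hmd'
  have hw : ‖w‖ ≤ m' := le_max_right _ _
  have hd : |m' - m| ≤ ‖z - w‖ := by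
    have h1 : |m' - m| ≤ |‖w‖ - ‖z‖| := by
      have := abs_max_sub_max_le_max 1 ‖w‖ 1 ‖z‖
      simpa using this
    have h2 := abs_norm_sub_norm_le w z
    rw [norm_sub_rev] at h2
    exact h1.trans h2
  have e : ret z - ret w = m⁻¹ • (z - w) + (m⁻¹ - m'⁻¹) • w := by
    simp only [ret, ← hmd, ← hmd']; rw [smul_sub, sub_smul]; abel
  rw [e]
  refine (norm_add_le _ _).trans ?_
  rw [norm_smul, norm_smul, norm_inv, Real.norm_eq_abs, Real.norm_eq_abs,
    abs_of_pos (by linarith : 0 < m)]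
  have h1 : m⁻¹ * ‖z - w‖ ≤ ‖z - w‖ := by
    rw [inv_mul_le_iff₀ (by linarith)]; nlinarith [norm_nonneg (z - w)]
  have h2 : |m⁻¹ - m'⁻¹| * ‖w‖ ≤ ‖z - w‖ := by
    have : m⁻¹ - m'⁻¹ = (m' - m) / (m * m') := by
      have : m ≠ 0 := by linarith
      have : m' ≠ 0 := by linarith
      field_simp
    rw [this, abs_div, abs_of_pos (by nlinarith : 0 < m * m'), div_mul_eq_mul_div,
      div_le_iff₀ (by nlinarith)]
    calc |m' - m| * ‖w‖ ≤ ‖z - w‖ * m' := by gcongr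
      _ ≤ ‖z - w‖ * (m * m') := by gcongr; nlinarith
  linarith

lemma tube [CompleteSpace E] (F : ℝ → E → E) (b b' : ℝ → E) (l S η K : ℝ) (hl : 0 < l) (hη : 0 ≤ η)
    (hK : 0 < K)
    (hLip : ∀ t ∈ Icc 0 l, ∀ v w, ‖v‖ ≤ S + 1 → ‖w‖ ≤ S + 1 → ‖F t v - F t w‖ ≤ K * ‖v - w‖)
    (hcont : ∀ v, ContinuousOn (fun t => F t v) (Icc 0 l))
    (hb : ∀ t ∈ Icc 0 l, HasDerivWithinAt b (b' t) (Icc 0 l) t)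
    (hb' : ContinuousOn b' (Icc 0 l)) (hS : ∀ t ∈ Icc 0 l, ‖b t‖ ≤ S)
    (hres : ∀ t ∈ Icc 0 l, ‖b' t - F t (b t)‖ ≤ η)
    (hsmall : η / K * (Real.exp (K * l) - 1) < 1) :
    ∃ V : ℝ → E, V 0 = b 0 ∧ (∀ t ∈ Icc 0 l, HasDerivWithinAt V (F t (V t)) (Icc 0 l) t) ∧
      (∀ t ∈ Icc 0 l, ‖V t - b t‖ ≤ η / K * (Real.exp (K * l) - 1)) ∧
      ContinuousOn (fun t => F t (V t)) (Icc 0 l) := by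
  have bc : ContinuousOn b (Icc 0 l) := fun t ht => (hb t ht).continuousWithinAt
  -- joint continuity
  have joint : ∀ w : ℝ → E, ContinuousOn w (Icc 0 l) → (∀ t ∈ Icc 0 l, ‖w t‖ ≤ S + 1) →
      ContinuousOn (fun t => F t (w t)) (Icc 0 l) := by
    intro w hw hwS t0 ht0
    have h1 : Tendsto (fun t => K * ‖w t - w t0‖ + ‖F t (w t0) - F t0 (w t0)‖) (𝓝[Icc 0 l] t0)
        (𝓝 0) := by
      have a1 : Tendsto (fun t => K * ‖w t - w t0‖) (𝓝[Icc 0 l] t0) (𝓝 (K * 0)) :=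
        (tendsto_iff_norm_sub_tendsto_zero.1 (hw t0 ht0)).const_mul K
      have a2 := tendsto_iff_norm_sub_tendsto_zero.1 (hcont (w t0) t0 ht0)
      simpa using a1.add a2
    refine tendsto_iff_norm_sub_tendsto_zero.2 ?_
    refine tendsto_of_tendsto_of_tendsto_of_le_of_le' tendsto_const_nhds h1
      (Eventually.of_forall fun _ => norm_nonneg _) ?_
    filter_upwards [self_mem_nhdsWithin] with t ht
    have := hLip t ht (w t) (w t0) (hwS t ht) (hwS t0 ht0)
    have e : F t (w t) - F t0 (w t0) = (F t (w t) - F t (w t0)) + (F t (w t0) - F t0 (w t0)) := by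
      abel
    rw [e]
    exact (norm_add_le _ _).trans (by linarith)
  have bret : ∀ t ∈ Icc 0 l, ∀ z, ‖b t + ret z‖ ≤ S + 1 := fun t ht z =>
    (norm_add_le _ _).trans (add_le_add (hS t ht) (ret_norm_le_one z))
  have bS : ∀ t ∈ Icc 0 l, ‖b t‖ ≤ S + 1 := fun t ht => by linarith [hS t ht]
  set f : ℝ → E → E := fun t z => F t (b t + ret z) - b' t with hf
  have fb : ∀ t ∈ Icc 0 l, ∀ z, ‖f t z‖ ≤ K * ‖ret z‖ + η := by
    intro t ht z
    have h1 := hLip t ht (b t + ret z) (b t) (bret t ht z) (bS t ht)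
    rw [add_sub_cancel_left] at h1
    have e : f t z = (F t (b t + ret z) - F t (b t)) - (b' t - F t (b t)) := by simp only [hf]; abel
    rw [e]
    exact (norm_sub_le _ _).trans (add_le_add h1 (hres t ht))
  have h0l : (0 : ℝ) ∈ Icc 0 l := ⟨le_rfl, hl.le⟩
  have pl : IsPicardLindelof f (⟨0, h0l⟩ : Icc 0 l) (0 : E) ⟨(K + η) * l, by positivity⟩ 0
      ⟨K + η, by positivity⟩ ⟨2 * K, by positivity⟩ := by
    constructor
    · intro t ht
      refine LipschitzOnWith.of_dist_le_mul fun z _ w _ => ?_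
      rw [dist_eq_norm, dist_eq_norm]
      simp only [hf, sub_sub_sub_cancel_right]
      refine (hLip t ht _ _ (bret t ht z) (bret t ht w)).trans ?_
      rw [add_sub_add_left_eq_sub]
      have := ret_lip z w
      show _ ≤ 2 * K * ‖z - w‖
      nlinarith
    · intro z _
      exact (joint (fun t => b t + ret z) (bc.add continuousOn_const)
        (fun t ht => bret t ht z)).sub hb'
    · intro t ht z _
      refine (fb t ht z).trans ?_
      show _ ≤ K + η
      nlinarith [ret_norm_le_one z]
    · show (K + η) * max (l - 0) (0 - 0) ≤ (K + η) * l - 0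
      rw [sub_zero, sub_zero, sub_zero, max_eq_left hl.le]
  obtain ⟨z, hz0, hz⟩ := pl.exists_eq_forall_mem_Icc_hasDerivWithinAt₀
  have hz0 : z 0 = 0 := hz0
  have zc : ContinuousOn z (Icc 0 l) := fun t ht => (hz t ht).continuousWithinAt
  have gr := norm_le_gronwallBound_of_norm_deriv_right_le (f := z) (f' := fun t => f t (z t))
    (δ := 0) (K := K) (ε := η) (a := 0) (b := l) zc (fun t ht => by
      have ht' : t ∈ Icc 0 l := Ico_subset_Icc_self ht
      have h := hz t ht'
      refine h.mono_of_mem_nhdsWithin ?_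
      refine mem_nhdsWithin.2 ⟨Iio l, isOpen_Iio, ht.2, fun x hx => ⟨ht.1.trans hx.2, le_of_lt hx.1⟩⟩)
    (by simp [hz0]) (fun t ht => by
      refine (fb t (Ico_subset_Icc_self ht) _).trans ?_
      have := ret_norm_le (z t)
      gcongr)
  have zb : ∀ t ∈ Icc 0 l, ‖z t‖ ≤ η / K * (Real.exp (K * l) - 1) := by
    intro t ht
    have h1 := gr t ht
    rw [sub_zero] at h1
    have h2 := gronwallBound_mono (δ := 0) (K := K) (ε := η) le_rfl hη hK.le ht.2
    refine h1.trans (h2.trans ?_)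
    rw [gronwallBound_of_K_ne_0 hK.ne']; simp
  have zr : ∀ t ∈ Icc 0 l, ret (z t) = z t := fun t ht =>
    ret_of_le _ ((zb t ht).trans hsmall.le)
  refine ⟨fun t => b t + z t, by simp [hz0], ?_, ?_, ?_⟩
  · intro t ht
    have h1 := (hb t ht).add (hz t ht)
    refine h1.congr_deriv ?_
    simp only [hf, zr t ht]; abel
  · intro t ht
    simpa using zb t ht
  · refine joint _ (bc.add zc) fun t ht => ?_
    have := bret t ht (z t)
    rwa [zr t ht] at this

end tube

end

section
open scoped Real Topology NNReal
open Filter Set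

/-- cubic form with kernel -/
noncomputable def cubK (κ : ℤ → ℤ × ℤ → ℂ) (v : ℤ → ℂ) (n : ℤ) : ℂ :=
  ∑' q : ℤ × ℤ, κ n q * cubT v n q

lemma tsum_triS (f g h : ℤ → ENNReal) :
    ∑' n, triS f g h n = (∑' x, f x) * (∑' x, g x) * (∑' x, h x) := by
  have : ∀ n, triS f g h n = ∑' x, f x * ∑' y, g y * h (n - x + y) := triS_eq f g h
  simp_rw [this]
  rw [ENNReal.tsum_comm]
  simp_rw [ENNReal.tsum_mul_left]
  rw [mul_assoc, ← ENNReal.tsum_mul_right]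
  refine tsum_congr fun x => ?_
  congr 1
  rw [ENNReal.tsum_comm]
  simp_rw [ENNReal.tsum_mul_left]
  rw [← ENNReal.tsum_mul_right]
  refine tsum_congr fun y => ?_
  congr 1
  rw [← tsum_shift h (-x + y)]
  exact tsum_congr fun n => by congr 1; ring

lemma tsum_norm_le_of_enorm {ι : Type*} (f : ι → ℂ) (C : ℝ) (hC : 0 ≤ C)
    (h : ∑' n, ‖f n‖ₑ ≤ ENNReal.ofReal C) : Summable (fun n => ‖f n‖) ∧ ∑' n, ‖f n‖ ≤ C := by
  have hs : Summable (fun n => ‖f n‖) := by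
    have := ENNReal.summable_toReal (ne_top_of_le_ne_top ENNReal.ofReal_ne_top h)
    simpa using this
  refine ⟨hs, ?_⟩
  rw [← ENNReal.ofReal_le_ofReal_iff hC, ENNReal.ofReal_tsum_of_nonneg (fun _ => norm_nonneg _) hs]
  simpa using h

lemma sum_le_enorm {ι : Type*} (f : ι → ℂ) (C : ℝ) (hs : Summable (fun n => ‖f n‖))
    (h : ∑' n, ‖f n‖ ≤ C) : ∑' n, ‖f n‖ₑ ≤ ENNReal.ofReal C := by
  have := ENNReal.ofReal_le_ofReal h
  rw [ENNReal.ofReal_tsum_of_nonneg (fun _ => norm_nonneg _) hs] at this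
  simpa using this

/-- The sequence space. -/
noncomputable abbrev L1 := lp (fun _ : ℤ => ℂ) 1

lemma L1_summable (v : L1) : Summable (fun n => ‖v n‖) := by
  have := (lp.memℓp v).summable (by norm_num)
  simpa using this

lemma L1_norm (v : L1) : ‖v‖ = ∑' n, ‖v n‖ := by
  rw [lp.norm_eq_tsum_rpow (by norm_num)]; simp

lemma L1_enorm (v : L1) : ∑' n, ‖v n‖ₑ = ENNReal.ofReal ‖v‖ := by
  rw [L1_norm, ENNReal.ofReal_tsum_of_nonneg (fun _ => norm_nonneg _) (L1_summable v)]
  simp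

lemma L1_norm_le (v : L1) (C : ℝ) (hC : 0 ≤ C) (h : ∑' n, ‖v n‖ₑ ≤ ENNReal.ofReal C) :
    ‖v‖ ≤ C := by
  rw [L1_norm]; exact (tsum_norm_le_of_enorm _ C hC h).2

lemma mem_L1 (f : ℤ → ℂ) (h : Summable (fun n => ‖f n‖)) : Memℓp f 1 := by
  apply memℓp_gen; simpa using h

lemma enorm_kap_le {κ : ℤ → ℤ × ℤ → ℂ} (hκ : ∀ n q, ‖κ n q‖ ≤ 1) (n q) (z : ℂ) :
    ‖κ n q * z‖ₑ ≤ ‖z‖ₑ := by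
  rw [enorm_mul]
  calc _ ≤ 1 * ‖z‖ₑ := by
        gcongr
        rw [← ofReal_norm, ENNReal.ofReal_le_one]; exact hκ n q
    _ = _ := one_mul _

lemma tsum_enorm_cubT (v : ℤ → ℂ) (n : ℤ) :
    ∑' q, ‖cubT v n q‖ₑ = triS (fun x => ‖v x‖ₑ) (fun x => ‖v x‖ₑ) (fun x => ‖v x‖ₑ) n := by
  unfold triS cubT
  exact tsum_congr fun q => enorm_tri _ _ _

lemma cubK_enorm (κ : ℤ → ℤ × ℤ → ℂ) (hκ : ∀ n q, ‖κ n q‖ ≤ 1) (v : ℤ → ℂ) :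
    ∑' n, ‖cubK κ v n‖ₑ ≤ (∑' n, ‖v n‖ₑ) ^ 3 := by
  calc _ ≤ ∑' n, triS (fun x => ‖v x‖ₑ) (fun x => ‖v x‖ₑ) (fun x => ‖v x‖ₑ) n := by
        refine ENNReal.tsum_le_tsum fun n => ?_
        rw [← tsum_enorm_cubT]
        refine enorm_tsum_le_tsum_enorm.trans (ENNReal.tsum_le_tsum fun q => ?_)
        exact enorm_kap_le hκ n q _
    _ = _ := by rw [tsum_triS]; ring

lemma cubK_summable_norm (κ : ℤ → ℤ × ℤ → ℂ) (hκ : ∀ n q, ‖κ n q‖ ≤ 1) (v : L1) :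
    Summable (fun n => ‖cubK κ v n‖) := by
  refine (tsum_norm_le_of_enorm _ (‖v‖ ^ 3) (by positivity) ?_).1
  refine (cubK_enorm κ hκ v).trans ?_
  rw [L1_enorm, ENNReal.ofReal_pow (norm_nonneg _)]

/-- cubic form as a map on `L1` -/
noncomputable def cubL (κ : ℤ → ℤ × ℤ → ℂ) (hκ : ∀ n q, ‖κ n q‖ ≤ 1) (v : L1) : L1 :=
  ⟨fun n => Complex.I * cubK κ v n, mem_L1 _ (by
    simpa using cubK_summable_norm κ hκ v)⟩

lemma cubL_apply (κ : ℤ → ℤ × ℤ → ℂ) (hκ : ∀ n q, ‖κ n q‖ ≤ 1) (v : L1) (n : ℤ) :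
    cubL κ hκ v n = Complex.I * cubK κ v n := rfl

lemma cubKT_summable (κ : ℤ → ℤ × ℤ → ℂ) (hκ : ∀ n q, ‖κ n q‖ ≤ 1) (v : ℤ → ℂ)
    (hv : Summable fun n => ‖v n‖) (n : ℤ) :
    Summable (fun q => κ n q * cubT v n q) := by
  refine Summable.of_norm_bounded (summable_tri (fun n => ‖v n‖) hv (fun _ => norm_nonneg _) n)
    fun q => ?_
  rw [norm_mul]
  calc _ ≤ 1 * ‖cubT v n q‖ := by gcongr; exact hκ n q
    _ ≤ _ := by rw [one_mul]; exact norm_cubT_le v _ (fun _ => le_rfl) n q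

lemma cubK_lip_enorm (κ : ℤ → ℤ × ℤ → ℂ) (hκ : ∀ n q, ‖κ n q‖ ≤ 1) (v w : ℤ → ℂ)
    (hv : Summable fun n => ‖v n‖) (hw : Summable fun n => ‖w n‖) :
    ∑' n, ‖cubK κ v n - cubK κ w n‖ₑ ≤ (∑' n, ‖v n - w n‖ₑ) * (∑' n, ‖v n‖ₑ) * (∑' n, ‖v n‖ₑ)
      + (∑' n, ‖w n‖ₑ) * (∑' n, ‖v n - w n‖ₑ) * (∑' n, ‖v n‖ₑ)
      + (∑' n, ‖w n‖ₑ) * (∑' n, ‖w n‖ₑ) * (∑' n, ‖v n - w n‖ₑ) := by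
  rw [← tsum_triS, ← tsum_triS, ← tsum_triS, ← ENNReal.tsum_add, ← ENNReal.tsum_add]
  refine ENNReal.tsum_le_tsum fun n => ?_
  unfold triS cubK
  rw [← (cubKT_summable κ hκ v hv n).tsum_sub (cubKT_summable κ hκ w hw n), ← ENNReal.tsum_add,
    ← ENNReal.tsum_add]
  refine enorm_tsum_le_tsum_enorm.trans (ENNReal.tsum_le_tsum fun q => ?_)
  rw [← mul_sub]
  refine (enorm_kap_le hκ n q _).trans ?_
  have e : cubT v n q - cubT w n q =
      (v q.1 - w q.1) * (starRingEnd ℂ) (v q.2) * v (n - q.1 + q.2)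
      + w q.1 * (starRingEnd ℂ) (v q.2 - w q.2) * v (n - q.1 + q.2)
      + w q.1 * (starRingEnd ℂ) (w q.2) * (v (n - q.1 + q.2) - w (n - q.1 + q.2)) := by
    simp only [cubT, map_sub]; ring
  rw [e, ← enorm_tri, ← enorm_tri, ← enorm_tri]
  refine (enorm_add_le _ _).trans ?_
  gcongr
  exact enorm_add_le _ _

lemma cubL_lip (κ : ℤ → ℤ × ℤ → ℂ) (hκ : ∀ n q, ‖κ n q‖ ≤ 1) (v w : L1) (M : ℝ)
    (hv : ‖v‖ ≤ M) (hw : ‖w‖ ≤ M) :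
    ‖cubL κ hκ v - cubL κ hκ w‖ ≤ 3 * M ^ 2 * ‖v - w‖ := by
  have hM : 0 ≤ M := (norm_nonneg _).trans hv
  refine L1_norm_le _ _ (by positivity) ?_
  have h1 : ∀ n, ‖(cubL κ hκ v - cubL κ hκ w) n‖ₑ = ‖cubK κ v n - cubK κ w n‖ₑ := by
    intro n
    show ‖Complex.I * cubK κ v n - Complex.I * cubK κ w n‖ₑ = _
    rw [← mul_sub, enorm_mul]
    rw [← ofReal_norm, Complex.norm_I]; simp
  simp_rw [h1]
  refine (cubK_lip_enorm κ hκ v w (L1_summable v) (L1_summable w)).trans ?_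
  have h2 : ∑' n, ‖v n - w n‖ₑ = ENNReal.ofReal ‖v - w‖ := by rw [← L1_enorm]; rfl
  rw [h2, L1_enorm, L1_enorm]
  have a1 := ENNReal.ofReal_le_ofReal hv
  have a2 := ENNReal.ofReal_le_ofReal hw
  calc _ ≤ ENNReal.ofReal ‖v - w‖ * ENNReal.ofReal M * ENNReal.ofReal M
      + ENNReal.ofReal M * ENNReal.ofReal ‖v - w‖ * ENNReal.ofReal M
      + ENNReal.ofReal M * ENNReal.ofReal M * ENNReal.ofReal ‖v - w‖ := by gcongr
    _ = _ := by
      rw [← ENNReal.ofReal_mul (norm_nonneg _), ← ENNReal.ofReal_mul (by positivity),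
        ← ENNReal.ofReal_mul hM, ← ENNReal.ofReal_mul (by positivity),
        ← ENNReal.ofReal_mul hM, ← ENNReal.ofReal_mul (by positivity),
        ← ENNReal.ofReal_add (by positivity) (by positivity),
        ← ENNReal.ofReal_add (by positivity) (by positivity)]
      congr 1; ring

lemma summable_cubT_all (v : L1) :
    Summable (fun p : ℤ × (ℤ × ℤ) => ‖cubT v p.1 p.2‖) := by
  refine (tsum_norm_le_of_enorm (fun p : ℤ × (ℤ × ℤ) => cubT v p.1 p.2) (‖v‖ ^ 3) (by positivity) ?_).1
  rw [ENNReal.tsum_prod (f := fun n q => ‖cubT v n q‖ₑ)]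
  simp_rw [tsum_enorm_cubT]
  rw [tsum_triS, L1_enorm, ENNReal.ofReal_pow (norm_nonneg _)]
  apply le_of_eq; ring

lemma cubL_cont (κ : ℝ → ℤ → ℤ × ℤ → ℂ) (hκ : ∀ t n q, ‖κ t n q‖ ≤ 1)
    (hc : ∀ n q, Continuous fun t => κ t n q) (v : L1) :
    Continuous (fun t => cubL (κ t) (hκ t) v) := by
  rw [continuous_iff_continuousAt]
  intro t0
  have hsum := summable_cubT_all v
  set f : ℝ → ℝ := fun t => ∑' p : ℤ × (ℤ × ℤ), ‖κ t p.1 p.2 - κ t0 p.1 p.2‖ * ‖cubT v p.1 p.2‖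
    with hf
  have b2 : ∀ t n q, ‖κ t n q - κ t0 n q‖ ≤ 2 := fun t n q =>
    (norm_sub_le _ _).trans (by linarith [hκ t n q, hκ t0 n q])
  have fsum : ∀ t, Summable fun p : ℤ × (ℤ × ℤ) =>
      ‖κ t p.1 p.2 - κ t0 p.1 p.2‖ * ‖cubT v p.1 p.2‖ := fun t =>
    Summable.of_nonneg_of_le (fun p => by positivity)
      (fun p => mul_le_mul_of_nonneg_right (b2 t _ _) (norm_nonneg _)) (hsum.mul_left 2)
  have fc : Continuous f := by
    refine continuous_tsum (fun p => ?_) (hsum.mul_left 2) (fun p t => ?_)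
    · exact (((hc _ _).sub continuous_const).norm).mul continuous_const
    · rw [norm_mul, norm_norm, norm_norm]
      exact mul_le_mul_of_nonneg_right (b2 t _ _) (norm_nonneg _)
  have f0 : f t0 = 0 := by simp [hf]
  have key : ∀ t, ‖cubL (κ t) (hκ t) v - cubL (κ t0) (hκ t0) v‖ ≤ f t := by
    intro t
    refine L1_norm_le _ _ (tsum_nonneg fun p => by positivity) ?_
    have h1 : ∀ n, ‖(cubL (κ t) (hκ t) v - cubL (κ t0) (hκ t0) v) n‖ₑ
        = ‖cubK (κ t) v n - cubK (κ t0) v n‖ₑ := by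
      intro n
      show ‖Complex.I * cubK (κ t) v n - Complex.I * cubK (κ t0) v n‖ₑ = _
      rw [← mul_sub, enorm_mul]
      rw [← ofReal_norm, Complex.norm_I]; simp
    simp_rw [h1]
    rw [hf, ENNReal.ofReal_tsum_of_nonneg (fun p => by positivity) (fsum t),
      ENNReal.tsum_prod (f := fun n q => ENNReal.ofReal (‖κ t n q - κ t0 n q‖ * ‖cubT v n q‖))]
    refine ENNReal.tsum_le_tsum fun n => ?_
    unfold cubK
    rw [← (cubKT_summable _ (hκ t) v (L1_summable v) n).tsum_sub
      (cubKT_summable _ (hκ t0) v (L1_summable v) n)]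
    refine enorm_tsum_le_tsum_enorm.trans (ENNReal.tsum_le_tsum fun q => ?_)
    rw [← sub_mul, ← norm_mul, ofReal_norm]
  refine tendsto_iff_norm_sub_tendsto_zero.2 ?_
  have := fc.tendsto t0
  rw [f0] at this
  exact tendsto_of_tendsto_of_tendsto_of_le_of_le tendsto_const_nhds this (fun _ => norm_nonneg _) key

end

section
open scoped Real Topology NNReal
open Filter Set

/-- Interaction-picture kernel with analytic weights. -/
noncomputable def kap (ω : ℤ → ℝ) (A ρ : ℝ) (τ : ℝ) (n : ℤ) (q : ℤ × ℤ) : ℂ :=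
  Complex.exp (((ρ * (|(n:ℝ)| - |(q.1:ℝ)| - |(q.2:ℝ)| - |((n - q.1 + q.2 : ℤ):ℝ)|) : ℝ) : ℂ)
    + ((τ / A ^ 2 * (- ω n + ω q.1 - ω q.2 + ω (n - q.1 + q.2)) : ℝ) : ℂ) * Complex.I)

lemma kap_norm_le (ω : ℤ → ℝ) (A ρ : ℝ) (hρ : 0 ≤ ρ) (τ : ℝ) (n : ℤ) (q : ℤ × ℤ) :
    ‖kap ω A ρ τ n q‖ ≤ 1 := by
  rw [kap, Complex.norm_exp]
  simp only [Complex.add_re, Complex.ofReal_re, Complex.mul_re, Complex.I_re, Complex.I_im,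
    Complex.ofReal_im]
  rw [Real.exp_le_one_iff]
  have h : |(n:ℝ)| ≤ |(q.1:ℝ)| + |(q.2:ℝ)| + |((n - q.1 + q.2 : ℤ):ℝ)| := by
    have e : (n : ℝ) = (q.1 : ℝ) - q.2 + ((n - q.1 + q.2 : ℤ):ℝ) := by push_cast; ring
    calc |(n:ℝ)| = |(q.1 : ℝ) - q.2 + ((n - q.1 + q.2 : ℤ):ℝ)| := by rw [← e]
      _ ≤ _ := (abs_add_le _ _).trans (add_le_add (abs_sub _ _) le_rfl)
  nlinarith

lemma kap_cont (ω : ℤ → ℝ) (A ρ : ℝ) (n : ℤ) (q : ℤ × ℤ) :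
    Continuous fun τ => kap ω A ρ τ n q := by
  unfold kap; fun_prop

/-- evaluation functional -/
noncomputable def evL (n : ℤ) : L1 →L[ℝ] ℂ := lp.evalCLM ℝ (fun _ : ℤ => ℂ) 1 n

lemma evL_apply (n : ℤ) (v : L1) : evL n v = v n := rfl

lemma solver (ω : ℤ → ℝ) (A l ρ : ℝ) (hl : 0 < l) (hρ : 0 ≤ ρ) (Fs : Finset ℤ)
    (b b' : ℤ → ℝ → ℂ) (S η : ℝ) (hη : 0 ≤ η) (hS0 : 0 ≤ S)
    (hbF : ∀ n ∉ Fs, ∀ τ, b n τ = 0) (hbF' : ∀ n ∉ Fs, ∀ τ, b' n τ = 0)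
    (hbd : ∀ n τ, HasDerivAt (b n) (b' n τ) τ) (hbc : ∀ n, Continuous (b' n))
    (hS : ∀ τ ∈ Icc 0 l, ∑ n ∈ Fs, ‖b n τ‖ ≤ S)
    (hres : ∀ τ ∈ Icc 0 l, ∑' n, ‖b' n τ - Complex.I * cubK (kap ω A ρ τ) (fun k => b k τ) n‖ₑ
      ≤ ENNReal.ofReal η)
    (hsmall : η / (3 * (S + 1) ^ 2) * (Real.exp ((3 * (S + 1) ^ 2) * l) - 1) < 1) :
    ∃ V : ℤ → ℝ → ℂ, (∀ n, V n 0 = b n 0) ∧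
      (∀ τ ∈ Icc 0 l, ∑' n, ‖V n τ - b n τ‖ₑ ≤
        ENNReal.ofReal (η / (3 * (S + 1) ^ 2) * (Real.exp ((3 * (S + 1) ^ 2) * l) - 1))) ∧
      (∀ n, ∀ τ ∈ Icc 0 l, HasDerivWithinAt (V n)
        (Complex.I * cubK (kap ω A ρ τ) (fun k => V k τ) n) (Icc 0 l) τ) ∧
      (∀ n, ContinuousOn (fun τ => Complex.I * cubK (kap ω A ρ τ) (fun k => V k τ) n) (Icc 0 l)) ∧
      (∀ τ ∈ Icc 0 l, ∑' n, ‖V n τ‖ₑ ≤ ENNReal.ofReal (S + 1)) := by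
  set κ := kap ω A ρ with hκd
  have hκ : ∀ t n q, ‖κ t n q‖ ≤ 1 := fun t n q => kap_norm_le ω A ρ hρ t n q
  set F : ℝ → L1 → L1 := fun t v => cubL (κ t) (hκ t) v with hF
  set B : ℝ → L1 := fun τ => ∑ n ∈ Fs, b n τ • (lp.single 1 n (1 : ℂ) : L1) with hB
  set B' : ℝ → L1 := fun τ => ∑ n ∈ Fs, b' n τ • (lp.single 1 n (1 : ℂ) : L1) with hB'
  have ev : ∀ (c : ℤ → ℂ), (∀ n ∉ Fs, c n = 0) → ∀ k,
      (∑ n ∈ Fs, c n • (lp.single 1 n (1 : ℂ) : L1)) k = c k := by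
    intro c hc k
    rw [lp.coeFn_sum, Finset.sum_apply]
    simp only [lp.coeFn_smul, Pi.smul_apply, lp.single_apply, smul_eq_mul]
    by_cases hk : k ∈ Fs
    · rw [Finset.sum_eq_single k]
      · simp
      · intro m _ hm; simp [Pi.single_apply, hm.symm]
      · intro h; exact absurd hk h
    · rw [hc k hk]
      refine Finset.sum_eq_zero fun m hm => ?_
      have : k ≠ m := fun h => hk (h ▸ hm)
      simp [Pi.single_apply, this]
  have evB : ∀ τ k, B τ k = b k τ := fun τ => ev _ (fun n hn => hbF n hn τ)
  have evB' : ∀ τ k, B' τ k = b' k τ := fun τ => ev _ (fun n hn => hbF' n hn τ)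
  have Bd : ∀ τ, HasDerivAt B (B' τ) τ := by
    intro τ
    exact HasDerivAt.fun_sum fun n _ => (hbd n τ).smul_const _
  have Bc' : Continuous B' := by
    exact continuous_finset_sum _ fun n _ => (hbc n).smul continuous_const
  have BS : ∀ t ∈ Icc 0 l, ‖B t‖ ≤ S := by
    intro t ht
    rw [L1_norm]
    simp_rw [evB]
    rw [tsum_eq_sum (s := Fs) (fun n hn => by simp [hbF n hn t])]
    exact hS t ht
  have bfun : ∀ τ, (fun k => b k τ) = ⇑(B τ) := fun τ => funext fun k => (evB τ k).symm
  obtain ⟨V, hV0, hVd, hVb, hVc⟩ := tube F B B' l S η (3 * (S + 1) ^ 2) hl hη (by positivity)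
    (fun t _ v w hv hw => cubL_lip (κ t) (hκ t) v w (S + 1) hv hw)
    (fun v => (cubL_cont κ hκ (fun n q => kap_cont ω A ρ n q) v).continuousOn)
    (fun t _ => (Bd t).hasDerivWithinAt) Bc'.continuousOn BS
    (fun t ht => by
      refine L1_norm_le _ _ hη ?_
      refine le_trans (le_of_eq ?_) (hres t ht)
      refine tsum_congr fun n => ?_
      show ‖B' t n - Complex.I * cubK (κ t) (B t) n‖ₑ = _
      rw [evB', bfun])
    hsmall
  refine ⟨fun n τ => V τ n, fun n => by simp only [hV0, evB], fun τ ht => ?_, fun n τ ht => ?_,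
    fun n => ?_, fun τ ht => ?_⟩
  · have h1 := ENNReal.ofReal_le_ofReal (hVb τ ht)
    rw [← L1_enorm] at h1
    refine le_trans (le_of_eq (tsum_congr fun n => ?_)) h1
    show _ = ‖V τ n - B τ n‖ₑ
    rw [evB]
  · exact (evL n).hasFDerivAt.comp_hasDerivWithinAt τ (hVd τ ht)
  · exact (evL n).continuous.comp_continuousOn hVc
  · show ∑' n, ‖V τ n‖ₑ ≤ _
    rw [L1_enorm]
    apply ENNReal.ofReal_le_ofReal
    have h1 := hVb τ ht
    have h2 := BS τ ht
    have h3 := norm_add_le (V τ - B τ) (B τ)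
    rw [sub_add_cancel] at h3
    linarith

end

section
open scoped Real Topology NNReal
open Filter Set


lemma summable_poly_exp (m : ℕ) (ρ : ℝ) (hρ : 0 < ρ) :
    Summable (fun n : ℤ => (1 + |(n:ℝ)|) ^ m * Real.exp (-ρ * |(n:ℝ)|)) := by
  have key : Summable (fun n : ℕ => (1 + (n:ℝ)) ^ m * Real.exp (-ρ * (n:ℝ))) := by
    have h := (summable_nat_add_iff 1).2 (Real.summable_pow_mul_exp_neg_nat_mul m hρ)
    refine (h.mul_left (Real.exp ρ)).congr fun n => ?_
    push_cast
    rw [show -ρ * (n:ℝ) = ρ + (-ρ * ((n:ℝ) + 1)) by ring, Real.exp_add]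
    ring
  refine Summable.of_nat_of_neg ?_ ?_ <;>
  · refine key.congr fun n => ?_
    simp

/-- The dispersion relation. -/
noncomputable def om (α : ℝ) (n : ℤ) : ℝ := (2 * π * |(n:ℝ)|) ^ (2 * α)

lemma om_nonneg (α : ℝ) (n : ℤ) : 0 ≤ om α n := by unfold om; positivity

lemma om_le (α : ℝ) (hα : 0 < α) (n : ℤ) :
    om α n ≤ (2 * π) ^ (2 * α) * (1 + |(n:ℝ)|) ^ ⌈2 * α⌉₊ := by
  unfold om
  rw [Real.mul_rpow (by positivity) (by positivity), ← Real.rpow_natCast]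
  have h1 : (0:ℝ) ≤ |(n:ℝ)| := abs_nonneg _
  gcongr ?_ * ?_
  calc |(n:ℝ)| ^ (2 * α) ≤ (1 + |(n:ℝ)|) ^ (2 * α) := by
        apply Real.rpow_le_rpow h1 (by linarith) (by linarith)
    _ ≤ _ := Real.rpow_le_rpow_of_exponent_le (by linarith) (Nat.le_ceil _)

lemma norm_le_of_tsum_enorm (f : ℤ → ℂ) (C : ℝ) (hC : 0 ≤ C)
    (h : ∑' n, ‖f n‖ₑ ≤ ENNReal.ofReal C) (n : ℤ) : ‖f n‖ ≤ C := by
  have h1 := (ENNReal.le_tsum n).trans h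
  rw [← ofReal_norm] at h1
  exact (ENNReal.ofReal_le_ofReal_iff hC).1 h1

lemma reduct (α s : ℝ) (hα : 0 < α) (ε : ℝ) (A l ρ : ℝ) (hA : 0 < A) (hl : 0 < l)
    (hρ : 0 < ρ) (S : ℝ) (hS : 0 ≤ S) (V : ℤ → ℝ → ℂ)
    (hV : ∀ n, ∀ τ ∈ Icc 0 l, HasDerivWithinAt (V n)
        (Complex.I * cubK (kap (om α) A ρ τ) (fun k => V k τ) n) (Icc 0 l) τ)
    (hVc : ∀ n, ContinuousOn
      (fun τ => Complex.I * cubK (kap (om α) A ρ τ) (fun k => V k τ) n) (Icc 0 l))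
    (hVs : ∀ τ ∈ Icc 0 l, ∑' n, ‖V n τ‖ₑ ≤ ENNReal.ofReal S)
    (hT : l / A ^ 2 < ε)
    (hi : HsSeq s (fun n => ((A * Real.exp (-ρ * |(n:ℝ)|) : ℝ) : ℂ) * V n 0) < ε)
    (hf : HsSeq s (fun n => ((A * Real.exp (-ρ * |(n:ℝ)|) : ℝ) : ℂ) * V n l) > ε⁻¹) :
    ∃ (T : ℝ) (a : ℤ → ℝ → ℂ),
      0 < T ∧ T < ε ∧
      (∀ n : ℤ, ContDiff ℝ 1 (a n)) ∧
      (∀ m : ℕ,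
        Summable (fun n : ℤ =>
          ((1:ℝ) + |(n:ℝ)|)^m * ⨆ t : Set.Icc (0:ℝ) T, ‖a n (t:ℝ)‖)) ∧
      (∀ (n : ℤ) (t : ℝ),
        Complex.I * deriv (a n) t
          + (((2 * π * |(n:ℝ)|) ^ (2*α) : ℝ) : ℂ) * a n t
          + ∑' p : {p : ℤ × ℤ × ℤ // n = p.1 - p.2.1 + p.2.2},
              a p.1.1 t * (starRingEnd ℂ) (a p.1.2.1 t) * a p.1.2.2 t = 0) ∧
      HsSeq s (fun n => a n 0) < ε ∧
      HsSeq s (fun n => a n T) > ε⁻¹ := by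
  set ω := om α with hω
  set T := l / A ^ 2 with hTd
  have hT0 : 0 < T := by positivity
  have hAT : A ^ 2 * T = l := by rw [hTd]; field_simp
  have hmem : ∀ t ∈ Icc 0 T, A ^ 2 * t ∈ Icc 0 l := by
    intro t ht
    refine ⟨by have := ht.1; positivity, ?_⟩
    rw [← hAT]
    exact mul_le_mul_of_nonneg_left ht.2 (by positivity)
  set g : ℤ → ℂ := fun n => ((A * Real.exp (-ρ * |(n:ℝ)|) : ℝ) : ℂ) with hg
  set D : ℤ → ℝ → ℂ := fun n τ => Complex.I * cubK (kap ω A ρ τ) (fun k => V k τ) n with hD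
  set u : ℤ → ℝ → ℂ := fun n t => Complex.exp (((ω n * t : ℝ) : ℂ) * Complex.I) * g n * V n (A ^ 2 * t) with hu
  set d : ℤ → ℝ → ℂ := fun n t => Complex.exp (((ω n * t : ℝ) : ℂ) * Complex.I) * g n *
    ((ω n : ℂ) * Complex.I * V n (A ^ 2 * t) + (A:ℂ) ^ 2 * D n (A ^ 2 * t)) with hd
  have hVn : ∀ n, ∀ τ ∈ Icc 0 l, ‖V n τ‖ ≤ S := fun n τ hτ => norm_le_of_tsum_enorm _ S hS (hVs τ hτ) n
  have hDn : ∀ n, ∀ τ ∈ Icc 0 l, ‖D n τ‖ ≤ S ^ 3 := by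
    intro n τ hτ
    simp only [hD]
    rw [norm_mul, Complex.norm_I, one_mul]
    refine norm_le_of_tsum_enorm (fun n => cubK (kap ω A ρ τ) (fun k => V k τ) n) (S ^ 3) (by positivity) ?_ n
    refine (cubK_enorm _ (kap_norm_le ω A ρ hρ.le τ) _).trans ?_
    rw [ENNReal.ofReal_pow hS]
    gcongr
    exact hVs τ hτ
  have hgn : ∀ n, ‖g n‖ = A * Real.exp (-ρ * |(n:ℝ)|) := by
    intro n
    simp only [hg]
    rw [Complex.norm_real, Real.norm_of_nonneg (by positivity)]
  set M := ⌈2 * α⌉₊ with hM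
  set C : ℝ := A * (S + (2 * π) ^ (2 * α) * S + A ^ 2 * S ^ 3) with hC
  have hC0 : 0 ≤ C := by positivity
  have hun : ∀ n, ∀ t ∈ Icc 0 T, ‖u n t‖ ≤ A * S * Real.exp (-ρ * |(n:ℝ)|) := by
    intro n t ht
    simp only [hu]
    rw [norm_mul, norm_mul, Complex.norm_exp_ofReal_mul_I, hgn, one_mul]
    have := hVn n _ (hmem t ht)
    calc _ ≤ A * Real.exp (-ρ * |(n:ℝ)|) * S := by gcongr
      _ = _ := by ring
  have hp1 : ∀ n : ℤ, (1:ℝ) ≤ (1 + |(n:ℝ)|) ^ M := fun n =>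
    one_le_pow₀ (by have := abs_nonneg (n:ℝ); linarith)
  have asm : ∃ a : ℤ → ℝ → ℂ, (∀ n, ContDiff ℝ 1 (a n)) ∧ (∀ n, ∀ t ∈ Icc 0 T, a n t = u n t) ∧
      ∀ n t, Res ω a n t = 0 := by
    refine assemble ω T hT0 u d
      (fun n => C * ((1 + |(n:ℝ)|) ^ M * Real.exp (-ρ * |(n:ℝ)|)))
      ((summable_poly_exp M ρ hρ).mul_left C) ?_ ?_ ?_ ?_ ?_
    · intro n t ht
      refine (hun n t ht).trans ?_
      have hE := Real.exp_pos (-ρ * |(n:ℝ)|)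
      have h1 := hp1 n
      have h2 : A * S ≤ C := by
        rw [hC]
        apply mul_le_mul_of_nonneg_left _ hA.le
        have : 0 ≤ (2 * π) ^ (2 * α) * S + A ^ 2 * S ^ 3 := by positivity
        linarith
      calc _ ≤ C * (1 * Real.exp (-ρ * |(n:ℝ)|)) := by rw [one_mul]; gcongr
        _ ≤ _ := by gcongr
    · intro n t ht
      simp only [hd]
      rw [norm_mul, norm_mul, Complex.norm_exp_ofReal_mul_I, hgn, one_mul]
      have h1 := hVn n _ (hmem t ht)
      have h2 := hDn n _ (hmem t ht)
      have h3 := om_le α hα n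
      have h0 := om_nonneg α n
      rw [← hM] at h3
      have h4 : ‖(ω n : ℂ) * Complex.I * V n (A ^ 2 * t) + (A:ℂ) ^ 2 * D n (A ^ 2 * t)‖ ≤
          ((2 * π) ^ (2 * α) * S + A ^ 2 * S ^ 3) * (1 + |(n:ℝ)|) ^ M := by
        refine (norm_add_le _ _).trans ?_
        simp only [norm_mul, norm_pow, Complex.norm_I, mul_one, Complex.norm_real]
        rw [Real.norm_of_nonneg h0, Real.norm_of_nonneg hA.le]
        calc _ ≤ ((2 * π) ^ (2 * α) * (1 + |(n:ℝ)|) ^ M) * S + A ^ 2 * S ^ 3 * 1 := by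
              rw [mul_one]; gcongr
          _ ≤ ((2 * π) ^ (2 * α) * (1 + |(n:ℝ)|) ^ M) * S + A ^ 2 * S ^ 3 * (1 + |(n:ℝ)|) ^ M := by
              gcongr; exact hp1 n
          _ = _ := by ring
      calc _ ≤ A * Real.exp (-ρ * |(n:ℝ)|) * (((2 * π) ^ (2 * α) * S + A ^ 2 * S ^ 3) * (1 + |(n:ℝ)|) ^ M) := by
            gcongr
        _ ≤ A * Real.exp (-ρ * |(n:ℝ)|) * ((S + (2 * π) ^ (2 * α) * S + A ^ 2 * S ^ 3) * (1 + |(n:ℝ)|) ^ M) := by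
            gcongr; linarith
        _ = _ := by rw [hC]; ring
    · intro n
      have hc : ContinuousOn (fun t : ℝ => A ^ 2 * t) (Icc 0 T) := by fun_prop
      have hVcont : ContinuousOn (V n) (Icc 0 l) := fun τ hτ => (hV n τ hτ).continuousWithinAt
      have e1 := hVcont.comp hc hmem
      have e2 := (hVc n).comp hc hmem
      simp only [hd]
      refine ContinuousOn.mul (by fun_prop) ?_
      exact (continuousOn_const.mul e1).add (continuousOn_const.mul e2)
    · intro n t ht
      have h1 : HasDerivWithinAt (fun t : ℝ => A ^ 2 * t) (A ^ 2) (Icc 0 T) t := by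
        simpa using ((hasDerivAt_id t).const_mul (A ^ 2)).hasDerivWithinAt
      have h2 := (hV n _ (hmem t ht)).scomp t h1 hmem
      have h3 : HasDerivAt (fun t : ℝ => Complex.exp (((ω n * t : ℝ) : ℂ) * Complex.I))
          (Complex.exp (((ω n * t : ℝ) : ℂ) * Complex.I) * ((ω n : ℂ) * Complex.I)) t := by
        apply HasDerivAt.cexp
        have : HasDerivAt (fun t : ℝ => ((ω n * t : ℝ) : ℂ)) (ω n : ℂ) t := by
          apply HasDerivAt.ofReal_comp
          simpa using (hasDerivAt_id t).const_mul (ω n)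
        exact this.mul_const _
      have h4 := (h3.hasDerivWithinAt (s := Icc 0 T)).mul_const (g n) |>.mul h2
      refine h4.congr_deriv ?_
      simp only [hd, hD, Function.comp, Complex.real_smul, Complex.ofReal_pow]
      ring
    · intro n t ht
      have hcub : cubN (fun k => u k t) n = (A:ℂ) ^ 2 *
          (Complex.exp (((ω n * t : ℝ) : ℂ) * Complex.I) * g n) *
            cubK (kap ω A ρ (A ^ 2 * t)) (fun k => V k (A ^ 2 * t)) n := by
        unfold cubN cubK
        rw [← tsum_mul_left]
        refine tsum_congr fun q => ?_
        obtain ⟨x, y⟩ := q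
        simp only [cubT, kap, hu, hg, map_mul, ← Complex.exp_conj, Complex.conj_ofReal, Complex.conj_I]
        push_cast
        have eA : (A:ℂ) ^ 2 * t / (A:ℂ) ^ 2 = t := by
          have : (A:ℂ) ≠ 0 := by exact_mod_cast hA.ne'
          field_simp
        rw [eA]
        set z := (n:ℤ) - x + y with hz
        have key : ∀ a b c e1 e2 e3 r0 r1 r2 r3 w0 w1 w2 w3 : ℂ,
            (Complex.exp (w1) * (A * Complex.exp r1) * a) * (Complex.exp w2 * (A * Complex.exp r2) * b) *
            (Complex.exp w3 * (A * Complex.exp r3) * c)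
            = A ^ 2 * (Complex.exp w0 * (A * Complex.exp r0)) *
              (Complex.exp ((r1 + r2 + r3 - r0) + (w1 + w2 + w3 - w0)) * (a * b * c)) := by
          intros
          simp only [Complex.exp_add, Complex.exp_sub]
          have := Complex.exp_ne_zero
          field_simp [this]
        rw [key _ _ _ 0 0 0 (-(ρ:ℂ) * |(n:ℝ)|) _ _ _ ((ω n : ℂ) * t * Complex.I)]
        congr 3
        congr 1 <;> ring
      rw [hcub]
      simp only [hd, hu, hD]
      have hI := Complex.I_sq
      linear_combination (Complex.exp (((ω n * t : ℝ) : ℂ) * Complex.I) * g n * ((ω n : ℂ) * V n (A ^ 2 * t)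
        + (A:ℂ) ^ 2 * cubK (kap ω A ρ (A ^ 2 * t)) (fun k => V k (A ^ 2 * t)) n)) * hI
  obtain ⟨a, ha1, ha2, ha3⟩ := asm
  · refine ⟨T, a, hT0, hT, ha1, ?_, ?_, ?_, ?_⟩
    · intro m
      refine Summable.of_nonneg_of_le (fun n => ?_) (fun n => ?_)
        ((summable_poly_exp m ρ hρ).mul_left (A * S))
      · exact mul_nonneg (by positivity) (Real.iSup_nonneg fun _ => norm_nonneg _)
      · have : (⨆ t : Set.Icc (0:ℝ) T, ‖a n (t:ℝ)‖) ≤ A * S * Real.exp (-ρ * |(n:ℝ)|) := by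
          refine Real.iSup_le (fun t => ?_) (by positivity)
          rw [ha2 n t t.2]; exact hun n t t.2
        calc _ ≤ (1 + |(n:ℝ)|) ^ m * (A * S * Real.exp (-ρ * |(n:ℝ)|)) := by gcongr
          _ = _ := by ring
    · intro n t
      have h := ha3 n t
      unfold Res at h
      rw [← tsum_gam] at h
      exact h
    · convert hi using 3 with n
      rw [ha2 n 0 ⟨le_rfl, hT0.le⟩]
      simp [hu, hg]
    · have : HsSeq s (fun n => a n T) =
          HsSeq s (fun n => ((A * Real.exp (-ρ * |(n:ℝ)|) : ℝ) : ℂ) * V n l) := by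
        unfold HsSeq
        congr 1
        refine tsum_congr fun n => ?_
        beta_reduce
        rw [ha2 n T ⟨hT0.le, le_rfl⟩]
        simp only [hu, hAT]
        rw [mul_assoc, norm_mul, Complex.norm_exp_ofReal_mul_I, one_mul]
      rw [this]; exact hf

end

section
open scoped Real Topology NNReal
open Filter Set

lemma om_mono (α : ℝ) (hα : 0 < α) (n : ℤ) (M : ℝ) (h : |(n:ℝ)| ≤ M) :
    om α n ≤ (2 * π * M) ^ (2 * α) := by
  unfold om
  gcongr

lemma kap_near (α : ℝ) (hα : 0 < α) (A ρ l M δ : ℝ) (hρ : 0 ≤ ρ) (hδ : δ ≤ 1)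
    (h : ρ * (6 * M) + l / A ^ 2 * (4 * (2 * π * (3 * M)) ^ (2 * α)) ≤ δ / 2)
    (τ : ℝ) (hτ : τ ∈ Icc 0 l) (n : ℤ) (q : ℤ × ℤ) (h1 : |(q.1:ℝ)| ≤ M) (h2 : |(q.2:ℝ)| ≤ M)
    (h3 : |((n - q.1 + q.2 : ℤ):ℝ)| ≤ M) : ‖kap (om α) A ρ τ n q - 1‖ ≤ δ := by
  have hM : 0 ≤ M := (abs_nonneg _).trans h1
  have h0 : |(n:ℝ)| ≤ 3 * M := by
    have e : (n : ℝ) = (q.1 : ℝ) - q.2 + ((n - q.1 + q.2 : ℤ):ℝ) := by push_cast; ring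
    rw [e]
    refine (abs_add_le _ _).trans ?_
    have := abs_sub (q.1:ℝ) q.2
    linarith
  set W := (2 * π * (3 * M)) ^ (2 * α) with hW
  have w0 := om_mono α hα n (3 * M) h0
  have w1 := om_mono α hα q.1 (3 * M) (by linarith)
  have w2 := om_mono α hα q.2 (3 * M) (by linarith)
  have w3 := om_mono α hα (n - q.1 + q.2) (3 * M) (by linarith)
  have p0 := om_nonneg α n
  have p1 := om_nonneg α q.1
  have p2 := om_nonneg α q.2
  have p3 := om_nonneg α (n - q.1 + q.2)
  rw [← hW] at w0 w1 w2 w3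
  have hW0 : 0 ≤ W := by positivity
  unfold kap
  set z : ℂ := (((ρ * (|(n:ℝ)| - |(q.1:ℝ)| - |(q.2:ℝ)| - |((n - q.1 + q.2 : ℤ):ℝ)|) : ℝ) : ℂ)
    + ((τ / A ^ 2 * (- om α n + om α q.1 - om α q.2 + om α (n - q.1 + q.2)) : ℝ) : ℂ) * Complex.I) with hz
  have hzn : ‖z‖ ≤ δ / 2 := by
    refine le_trans ?_ h
    rw [hz]
    refine (norm_add_le _ _).trans ?_
    rw [norm_mul, Complex.norm_I, mul_one, Complex.norm_real, Complex.norm_real, Real.norm_eq_abs,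
      Real.norm_eq_abs, abs_mul, abs_mul, abs_of_nonneg hρ]
    have hτA : |τ / A ^ 2| ≤ l / A ^ 2 := by
      rw [abs_of_nonneg (by have := hτ.1; positivity)]
      have := hτ.2
      gcongr
    have := abs_nonneg (n:ℝ)
    have := abs_nonneg (q.1:ℝ)
    have := abs_nonneg (q.2:ℝ)
    have := abs_nonneg ((n - q.1 + q.2 : ℤ):ℝ)
    gcongr
    · rw [abs_le]; constructor <;> linarith
    · have := hτ.1.trans hτ.2
      positivity
    · rw [abs_le]; constructor <;> linarith
  have h1 := Complex.norm_exp_sub_one_le (x := z) (by linarith)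
  linarith

lemma Hs_summable (s A ρ S : ℝ) (hρ : 0 < ρ) (V : ℤ → ℂ) (hV : ∀ n, ‖V n‖ ≤ S) :
    Summable (fun n : ℤ => ((1:ℝ) + (n:ℝ)^2) ^ s *
      ‖((A * Real.exp (-ρ * |(n:ℝ)|) : ℝ) : ℂ) * V n‖^2) := by
  refine Summable.of_nonneg_of_le (fun n => by positivity) (fun n => ?_)
    ((summable_poly_exp (2 * ⌈|s|⌉₊) (2 * ρ) (by linarith)).mul_left (A ^ 2 * S ^ 2))
  have h1 : (1:ℝ) ≤ 1 + (n:ℝ)^2 := by nlinarith [sq_nonneg (n:ℝ)]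
  have h2 : ((1:ℝ) + (n:ℝ)^2) ^ s ≤ (1 + |(n:ℝ)|) ^ (2 * ⌈|s|⌉₊) := by
    calc ((1:ℝ) + (n:ℝ)^2) ^ s ≤ ((1:ℝ) + (n:ℝ)^2) ^ ((⌈|s|⌉₊ : ℕ) : ℝ) :=
          Real.rpow_le_rpow_of_exponent_le h1 ((le_abs_self s).trans (Nat.le_ceil _))
      _ = ((1:ℝ) + (n:ℝ)^2) ^ ⌈|s|⌉₊ := Real.rpow_natCast _ _
      _ ≤ ((1 + |(n:ℝ)|) ^ 2) ^ ⌈|s|⌉₊ := by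
          gcongr
          have := sq_abs (n:ℝ)
          have := abs_nonneg (n:ℝ)
          nlinarith
      _ = _ := by rw [pow_mul]
  rw [norm_mul, Complex.norm_real, mul_pow, Real.norm_eq_abs, sq_abs]
  have h3 : ‖V n‖ ^ 2 ≤ S ^ 2 := by
    have := hV n
    gcongr
  calc _ ≤ (1 + |(n:ℝ)|) ^ (2 * ⌈|s|⌉₊) * ((A * Real.exp (-ρ * |(n:ℝ)|)) ^ 2 * S ^ 2) := by
        gcongr
    _ = _ := by
        rw [mul_pow, ← Real.exp_nat_mul]
        push_cast
        rw [show (2:ℝ) * (-ρ * |(n:ℝ)|) = -(2 * ρ) * |(n:ℝ)| by ring]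
        ring

lemma Hs_lower (s A ρ S X : ℝ) (hρ : 0 < ρ) (V : ℤ → ℂ) (hV : ∀ n, ‖V n‖ ≤ S)
    (F : Finset ℤ) (hX : X ^ 2 < ∑ n ∈ F, ((1:ℝ) + (n:ℝ)^2) ^ s *
      ((A * Real.exp (-ρ * |(n:ℝ)|)) ^ 2 * ‖V n‖^2)) :
    X < HsSeq s (fun n => ((A * Real.exp (-ρ * |(n:ℝ)|) : ℝ) : ℂ) * V n) := by
  unfold HsSeq
  apply Real.lt_sqrt_of_sq_lt
  refine hX.trans_le ?_
  refine le_trans (Finset.sum_le_sum fun n _ => le_of_eq ?_)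
    ((Hs_summable s A ρ S hρ V hV).sum_le_tsum F (fun n _ => by positivity))
  rw [norm_mul, Complex.norm_real, mul_pow _ ‖V n‖, Real.norm_eq_abs, sq_abs]

lemma Hs_upper (s A ρ ε : ℝ) (hA : 0 < A) (hρ : 0 ≤ ρ) (hε : 0 < ε) (V : ℤ → ℂ)
    (F : Finset ℤ) (hF : ∀ n ∉ F, V n = 0) (h : A ^ 2 * ∑ n ∈ F, ((1:ℝ) + (n:ℝ)^2) ^ s * ‖V n‖^2 < ε ^ 2) :
    HsSeq s (fun n => ((A * Real.exp (-ρ * |(n:ℝ)|) : ℝ) : ℂ) * V n) < ε := by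
  unfold HsSeq
  rw [Real.sqrt_lt' hε]
  refine lt_of_le_of_lt ?_ h
  rw [tsum_eq_sum (s := F) (fun n hn => by simp [hF n hn]), Finset.mul_sum]
  refine Finset.sum_le_sum fun n _ => ?_
  rw [norm_mul, Complex.norm_real, mul_pow, Real.norm_eq_abs, sq_abs]
  have h1 : Real.exp (-ρ * |(n:ℝ)|) ≤ 1 := by
    rw [Real.exp_le_one_iff]
    have := abs_nonneg (n:ℝ)
    nlinarith
  have h2 : (A * Real.exp (-ρ * |(n:ℝ)|)) ^ 2 ≤ A ^ 2 := by
    apply pow_le_pow_left₀ (by positivity)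
    exact mul_le_of_le_one_right hA.le h1
  calc _ ≤ ((1:ℝ) + (n:ℝ)^2) ^ s * (A ^ 2 * ‖V n‖ ^ 2) := by gcongr
    _ = _ := by ring

lemma cubK_near (κ : ℤ → ℤ × ℤ → ℂ) (hκ : ∀ n q, ‖κ n q‖ ≤ 1) (b : ℤ → ℂ) (S δ : ℝ) (hS : 0 ≤ S)
    (hδ : 0 ≤ δ)
    (hb : ∑' n, ‖b n‖ₑ ≤ ENNReal.ofReal S) (h : ∀ n q, cubT b n q ≠ 0 → ‖κ n q - 1‖ ≤ δ) :
    ∑' n, ‖cubK κ b n - cubN b n‖ₑ ≤ ENNReal.ofReal (δ * S ^ 3) := by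
  have hs := (tsum_norm_le_of_enorm b S hS hb).1
  calc ∑' n, ‖cubK κ b n - cubN b n‖ₑ
      ≤ ∑' n, ENNReal.ofReal δ * triS (fun x => ‖b x‖ₑ) (fun x => ‖b x‖ₑ) (fun x => ‖b x‖ₑ) n := by
        refine ENNReal.tsum_le_tsum fun n => ?_
        have s2 := cubKT_summable (fun _ _ => 1) (fun _ _ => by simp) b hs n
        simp only [one_mul] at s2
        unfold cubK cubN
        rw [← (cubKT_summable κ hκ b hs n).tsum_sub s2, ← tsum_enorm_cubT, ← ENNReal.tsum_mul_left]
        refine enorm_tsum_le_tsum_enorm.trans (ENNReal.tsum_le_tsum fun q => ?_)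
        rw [show κ n q * cubT b n q - cubT b n q = (κ n q - 1) * cubT b n q by ring, enorm_mul]
        by_cases h0 : cubT b n q = 0
        · simp [h0]
        · gcongr
          rw [← ofReal_norm]
          exact ENNReal.ofReal_le_ofReal (h n q h0)
    _ = ENNReal.ofReal δ * (∑' n, ‖b n‖ₑ) ^ 3 := by
        rw [ENNReal.tsum_mul_left, tsum_triS]; ring
    _ ≤ ENNReal.ofReal δ * (ENNReal.ofReal S) ^ 3 := by gcongr
    _ = _ := by rw [← ENNReal.ofReal_pow hS, ← ENNReal.ofReal_mul hδ]

end

section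
open scoped Real Topology NNReal
open Filter Set

lemma norm_le_of_enorm_le (z : ℂ) (C : ℝ) (hC : 0 ≤ C) (h : ‖z‖ₑ ≤ ENNReal.ofReal C) : ‖z‖ ≤ C := by
  rw [← ofReal_norm] at h
  exact (ENNReal.ofReal_le_ofReal_iff hC).1 h

lemma enorm_le_ofReal (z : ℂ) (C : ℝ) (h : ‖z‖ ≤ C) : ‖z‖ₑ ≤ ENNReal.ofReal C := by
  rw [← ofReal_norm]
  exact ENNReal.ofReal_le_ofReal h

lemma cubK_pt_le (κ : ℤ → ℤ × ℤ → ℂ) (hκ : ∀ n q, ‖κ n q‖ ≤ 1) (v : ℤ → ℂ) (S m : ℝ) (hS : 0 ≤ S)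
    (hm : 0 ≤ m) (hv : ∑' n, ‖v n‖ₑ ≤ ENNReal.ofReal S) (hvm : ∀ k, ‖v k‖ ≤ m) (n : ℤ) :
    ‖cubK κ v n‖ ≤ S * S * m := by
  refine norm_le_of_enorm_le _ _ (by positivity) ?_
  calc ‖cubK κ v n‖ₑ ≤ triS (fun x => ‖v x‖ₑ) (fun x => ‖v x‖ₑ) (fun x => ‖v x‖ₑ) n := by
        rw [← tsum_enorm_cubT]
        exact enorm_tsum_le_tsum_enorm.trans (ENNReal.tsum_le_tsum fun q => enorm_kap_le hκ n q _)
    _ ≤ (∑' n, ‖v n‖ₑ) * (∑' n, ‖v n‖ₑ) * ENNReal.ofReal m :=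
        triS_sup3 _ _ _ n _ fun k => enorm_le_ofReal _ _ (hvm k)
    _ ≤ ENNReal.ofReal S * ENNReal.ofReal S * ENNReal.ofReal m := by gcongr
    _ = _ := by rw [← ENNReal.ofReal_mul hS, ← ENNReal.ofReal_mul (by positivity)]

lemma cubK_pt_lip (κ : ℤ → ℤ × ℤ → ℂ) (hκ : ∀ n q, ‖κ n q‖ ≤ 1) (v w : ℤ → ℂ) (S m D : ℝ)
    (hS : 0 ≤ S) (hm : 0 ≤ m) (hD : 0 ≤ D)
    (hv : ∑' n, ‖v n‖ₑ ≤ ENNReal.ofReal S) (hw : ∑' n, ‖w n‖ₑ ≤ ENNReal.ofReal S)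
    (hvw : ∑' n, ‖v n - w n‖ₑ ≤ ENNReal.ofReal D)
    (hvm : ∀ k, ‖v k‖ ≤ m) (hwm : ∀ k, ‖w k‖ ≤ m) (n : ℤ) :
    ‖cubK κ v n - cubK κ w n‖ ≤ 3 * (S * D * m) := by
  have sv := (tsum_norm_le_of_enorm v S hS hv).1
  have sw := (tsum_norm_le_of_enorm w S hS hw).1
  refine norm_le_of_enorm_le _ _ (by positivity) ?_
  have e3 : ENNReal.ofReal (3 * (S * D * m)) =
      ENNReal.ofReal D * ENNReal.ofReal S * ENNReal.ofReal m
      + ENNReal.ofReal S * ENNReal.ofReal D * ENNReal.ofReal m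
      + ENNReal.ofReal S * ENNReal.ofReal D * ENNReal.ofReal m := by
    rw [← ENNReal.ofReal_mul hD, ← ENNReal.ofReal_mul hS, ← ENNReal.ofReal_mul (by positivity),
      ← ENNReal.ofReal_mul (by positivity), ← ENNReal.ofReal_add (by positivity) (by positivity),
      ← ENNReal.ofReal_add (by positivity) (by positivity)]
    congr 1; ring
  calc ‖cubK κ v n - cubK κ w n‖ₑ ≤
      triS (fun n => ‖v n - w n‖ₑ) (fun n => ‖v n‖ₑ) (fun n => ‖v n‖ₑ) n
      + triS (fun n => ‖w n‖ₑ) (fun n => ‖v n - w n‖ₑ) (fun n => ‖v n‖ₑ) n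
      + triS (fun n => ‖w n‖ₑ) (fun n => ‖w n‖ₑ) (fun n => ‖v n - w n‖ₑ) n := by
        unfold triS cubK
        rw [← (cubKT_summable κ hκ v sv n).tsum_sub (cubKT_summable κ hκ w sw n), ← ENNReal.tsum_add,
          ← ENNReal.tsum_add]
        refine enorm_tsum_le_tsum_enorm.trans (ENNReal.tsum_le_tsum fun q => ?_)
        rw [← mul_sub]
        refine (enorm_kap_le hκ n q _).trans ?_
        have e : cubT v n q - cubT w n q =
            (v q.1 - w q.1) * (starRingEnd ℂ) (v q.2) * v (n - q.1 + q.2)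
            + w q.1 * (starRingEnd ℂ) (v q.2 - w q.2) * v (n - q.1 + q.2)
            + w q.1 * (starRingEnd ℂ) (w q.2) * (v (n - q.1 + q.2) - w (n - q.1 + q.2)) := by
          simp only [cubT, map_sub]; ring
        rw [e, ← enorm_tri, ← enorm_tri, ← enorm_tri]
        refine (enorm_add_le _ _).trans ?_
        gcongr
        exact enorm_add_le _ _
    _ ≤ (∑' n, ‖v n - w n‖ₑ) * (∑' n, ‖v n‖ₑ) * ENNReal.ofReal m
        + (∑' n, ‖w n‖ₑ) * (∑' n, ‖v n - w n‖ₑ) * ENNReal.ofReal m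
        + (∑' n, ‖w n‖ₑ) * (∑' n, ‖v n - w n‖ₑ) * ENNReal.ofReal m := by
        gcongr ?_ + ?_ + ?_
        · exact triS_sup3 _ _ _ n _ fun k => enorm_le_ofReal _ _ (hvm k)
        · exact triS_sup3 _ _ _ n _ fun k => enorm_le_ofReal _ _ (hvm k)
        · exact triS_sup2 _ _ _ n _ fun k => enorm_le_ofReal _ _ (hwm k)
    _ ≤ _ := by
        rw [e3]
        gcongr

/-- support of the two-block data -/
noncomputable def blk (L K : ℕ) : Finset ℤ :=
  Finset.Ico ((L * K : ℕ) : ℤ) (L * K + K) ∪ Finset.Ico ((2 * L * K : ℕ) : ℤ) (2 * L * K + 3 * K)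

/-- two-block data -/
noncomputable def blkf (L K : ℕ) (n : ℤ) : ℂ := if n ∈ blk L K then (((K:ℝ)⁻¹ : ℝ) : ℂ) else 0

lemma blk_mem (L K : ℕ) (hL : 1 ≤ L) (n : ℤ) (h : n ∈ blk L K) :
    ((L * K : ℕ) : ℤ) ≤ n ∧ |(n:ℝ)| ≤ 5 * L * K := by
  have hK : (K:ℤ) ≤ L * K := by
    have : (1:ℤ) ≤ L := by exact_mod_cast hL
    nlinarith [Int.natCast_nonneg K]
  have hLK : (0:ℤ) ≤ L * K := by positivity
  have h2 : ((L * K : ℕ) : ℤ) ≤ n ∧ n ≤ 5 * L * K := by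
    simp only [blk, Finset.mem_union, Finset.mem_Ico] at h
    push_cast at h ⊢
    rcases h with h | h <;> constructor <;> nlinarith
  refine ⟨h2.1, ?_⟩
  have : (0:ℤ) ≤ n := le_trans (by positivity) h2.1
  rw [abs_of_nonneg (by exact_mod_cast this)]
  exact_mod_cast h2.2

lemma blk_card (L K : ℕ) : (blk L K).card ≤ 4 * K := by
  refine (Finset.card_union_le _ _).trans ?_
  simp
  omega

lemma blkf_norm (L K : ℕ) (n : ℤ) : ‖blkf L K n‖ ≤ (K:ℝ)⁻¹ := by
  unfold blkf
  split_ifs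
  · rw [Complex.norm_real, Real.norm_of_nonneg (by positivity)]
  · simp

lemma blkf_off (L K : ℕ) (n : ℤ) (h : n ∉ blk L K) : blkf L K n = 0 := by
  unfold blkf; rw [if_neg h]

lemma blkf_sum (L K : ℕ) (hK : 1 ≤ K) : ∑ n ∈ blk L K, ‖blkf L K n‖ ≤ 4 := by
  have hK' : (0:ℝ) < K := by exact_mod_cast hK
  calc _ ≤ ∑ n ∈ blk L K, (K:ℝ)⁻¹ := Finset.sum_le_sum fun n _ => blkf_norm L K n
    _ = (blk L K).card * (K:ℝ)⁻¹ := by simp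
    _ ≤ (4 * K : ℝ) * (K:ℝ)⁻¹ := by
        gcongr
        exact_mod_cast blk_card L K
    _ = 4 := by field_simp

lemma blkf_cub (L K : ℕ) (hK : 1 ≤ K) (κ : ℤ → ℤ × ℤ → ℂ) (hκ : ∀ n q, ‖κ n q‖ ≤ 1)
    (hκ2 : ∀ n (q : ℤ × ℤ), q.1 ∈ blk L K → q.2 ∈ blk L K → n - q.1 + q.2 ∈ blk L K → 1 / 2 ≤ (κ n q).re)
    (n : ℤ) (h1 : -(K:ℤ) ≤ n) (h2 : n ≤ 0) : 1 / (2 * K) ≤ (cubK κ (blkf L K) n).re := by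
  have hK' : (0:ℝ) < K := by exact_mod_cast hK
  have hs : Summable fun n => ‖blkf L K n‖ := by
    refine summable_of_ne_finset_zero (s := blk L K) fun n hn => ?_
    rw [blkf_off L K n hn, norm_zero]
  have hS := cubKT_summable κ hκ _ hs n
  unfold cubK
  rw [Complex.re_tsum hS]
  have val : ∀ q : ℤ × ℤ, (q.1 ∈ blk L K ∧ q.2 ∈ blk L K ∧ n - q.1 + q.2 ∈ blk L K →
      (κ n q * cubT (blkf L K) n q).re = (κ n q).re * ((K:ℝ)⁻¹) ^ 3) := by
    rintro q ⟨e1, e2, e3⟩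
    have : cubT (blkf L K) n q = (((K:ℝ)⁻¹ ^ 3 : ℝ) : ℂ) := by
      simp only [cubT, blkf, if_pos e1, if_pos e2, if_pos e3, Complex.conj_ofReal]
      push_cast; ring
    rw [this, Complex.re_mul_ofReal]
  have nn : ∀ q : ℤ × ℤ, 0 ≤ (κ n q * cubT (blkf L K) n q).re := by
    intro q
    by_cases h : q.1 ∈ blk L K ∧ q.2 ∈ blk L K ∧ n - q.1 + q.2 ∈ blk L K
    · rw [val q h]
      have := hκ2 n q h.1 h.2.1 h.2.2
      have : 0 ≤ (κ n q).re := by linarith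
      positivity
    · have : cubT (blkf L K) n q = 0 := by
        unfold cubT
        by_cases e1 : q.1 ∈ blk L K
        · by_cases e2 : q.2 ∈ blk L K
          · have e3 : n - q.1 + q.2 ∉ blk L K := fun e3 => h ⟨e1, e2, e3⟩
            rw [blkf_off _ _ _ e3, mul_zero]
          · rw [blkf_off _ _ _ e2]; simp
        · rw [blkf_off _ _ _ e1]; simp
      rw [this, mul_zero, Complex.zero_re]
  set P : Finset (ℤ × ℤ) := Finset.Ico (0:ℤ) K ×ˢ Finset.Ico (0:ℤ) K with hP
  set f : ℤ × ℤ → ℤ × ℤ := fun p => (L * K + p.1, 2 * L * K + p.1 + p.2 - n) with hf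
  have finj : Set.InjOn f P := by
    rintro ⟨x, y⟩ _ ⟨x', y'⟩ _ h
    simp only [hf, Prod.mk.injEq] at h
    ext <;> simp <;> linarith [h.1, h.2]
  have hsr : Summable (fun q => (κ n q * cubT (blkf L K) n q).re) :=
    (Complex.hasSum_re hS.hasSum).summable
  refine le_trans ?_ (hsr.sum_le_tsum (P.image f) (fun q _ => nn q))
  rw [Finset.sum_image finj]
  have each : ∀ p ∈ P, (1/2 : ℝ) * ((K:ℝ)⁻¹) ^ 3 ≤ (κ n (f p) * cubT (blkf L K) n (f p)).re := by
    rintro ⟨x, y⟩ hp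
    simp only [hP, Finset.mem_product, Finset.mem_Ico] at hp
    have m1 : (f (x, y)).1 ∈ blk L K := by
      simp only [hf, blk, Finset.mem_union, Finset.mem_Ico]; left; push_cast; constructor <;> linarith [hp.1.1, hp.1.2]
    have m2 : (f (x, y)).2 ∈ blk L K := by
      simp only [hf, blk, Finset.mem_union, Finset.mem_Ico]; right; push_cast
      constructor <;> linarith [hp.1.1, hp.1.2, hp.2.1, hp.2.2]
    have m3 : n - (f (x, y)).1 + (f (x, y)).2 ∈ blk L K := by
      simp only [hf, blk, Finset.mem_union, Finset.mem_Ico]; left; push_cast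
      constructor <;> linarith [hp.1.1, hp.1.2, hp.2.1, hp.2.2]
    rw [val _ ⟨m1, m2, m3⟩]
    have := hκ2 n (f (x, y)) m1 m2 m3
    gcongr
  refine le_trans ?_ (Finset.sum_le_sum each)
  rw [Finset.sum_const, hP, Finset.card_product]
  simp only [Int.card_Ico, sub_zero, Int.toNat_natCast, nsmul_eq_mul, Nat.cast_mul]
  apply le_of_eq
  field_simp

lemma exp_sub_one_le (x : ℝ) (h0 : 0 ≤ x) (h1 : x ≤ 1) : Real.exp x - 1 ≤ 2 * x := by
  have := Real.abs_exp_sub_one_le (x := x) (by rw [abs_of_nonneg h0]; exact h1)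
  rw [abs_of_nonneg h0] at this
  exact (le_abs_self _).trans this

lemma blkCore (α : ℝ) (hα : 0 < α) (L K : ℕ) (hL : 1 ≤ L) (hK : 1 ≤ K) (A ρ l : ℝ)
    (hl : 0 < l) (hl2 : l ≤ 1 / 20000) (hρ : 0 < ρ)
    (hnear : ρ * (6 * (5 * L * K)) + l / A ^ 2 * (4 * (2 * π * (3 * (5 * L * K))) ^ (2 * α)) ≤ 1 / 4) :
    ∃ V : ℤ → ℝ → ℂ, (∀ n, V n 0 = blkf L K n) ∧
      (∀ n, ∀ τ ∈ Icc 0 l, HasDerivWithinAt (V n)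
        (Complex.I * cubK (kap (om α) A ρ τ) (fun k => V k τ) n) (Icc 0 l) τ) ∧
      (∀ n, ContinuousOn
        (fun τ => Complex.I * cubK (kap (om α) A ρ τ) (fun k => V k τ) n) (Icc 0 l)) ∧
      (∀ τ ∈ Icc 0 l, ∑' n, ‖V n τ‖ₑ ≤ ENNReal.ofReal 5) ∧
      ∀ n : ℤ, -(K:ℤ) ≤ n → n ≤ 0 → l / (4 * K) ≤ ‖V n l‖ := by
  have hK' : (0:ℝ) < K := by exact_mod_cast hK
  have hκ := kap_norm_le (om α) A ρ hρ.le
  have bsum : ∑' n, ‖blkf L K n‖ₑ ≤ ENNReal.ofReal 4 := by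
    rw [tsum_eq_sum (s := blk L K) (fun n hn => by rw [blkf_off _ _ _ hn]; simp)]
    refine le_trans (le_of_eq ?_) (ENNReal.ofReal_le_ofReal (blkf_sum L K hK))
    rw [ENNReal.ofReal_sum_of_nonneg fun _ _ => norm_nonneg _]
    simp
  have hsm : (64:ℝ) / (3 * (4 + 1) ^ 2) * (Real.exp ((3 * (4 + 1) ^ 2) * l) - 1) ≤ 128 * l := by
    have := exp_sub_one_le ((3 * (4 + 1) ^ 2) * l) (by positivity) (by linarith)
    calc _ ≤ (64:ℝ) / (3 * (4 + 1) ^ 2) * (2 * ((3 * (4 + 1) ^ 2) * l)) := by gcongr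
      _ = _ := by ring
  obtain ⟨V, h0, hd, hV, hVc, hVs⟩ := solver (om α) A l ρ hl hρ.le (blk L K) (fun n _ => blkf L K n)
    (fun _ _ => 0) 4 64 (by norm_num) (by norm_num) (fun n hn _ => blkf_off _ _ _ hn)
    (fun _ _ _ => rfl) (fun n τ => hasDerivAt_const _ _) (fun n => continuous_const)
    (fun _ _ => blkf_sum L K hK) (fun τ _ => by
      simp only [zero_sub, enorm_neg, enorm_mul]
      have eI : ‖Complex.I‖ₑ = 1 := by rw [← ofReal_norm]; simp
      simp only [eI, one_mul]
      refine (cubK_enorm _ (hκ τ) _).trans ?_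
      calc _ ≤ (ENNReal.ofReal 4) ^ 3 := by gcongr
        _ = ENNReal.ofReal 64 := by rw [← ENNReal.ofReal_pow (by norm_num)]; norm_num) (by linarith)
  have hVs' : ∀ τ ∈ Icc 0 l, ∑' n, ‖V n τ‖ₑ ≤ ENNReal.ofReal 5 := by
    intro τ hτ
    have := hVs τ hτ
    norm_num at this ⊢
    exact this
  refine ⟨V, h0, hV, hVc, hVs', ?_⟩
  have hd' : ∀ τ ∈ Icc 0 l, ∑' n, ‖V n τ - blkf L K n‖ₑ ≤ ENNReal.ofReal (128 * l) := fun τ hτ =>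
    (hd τ hτ).trans (ENNReal.ofReal_le_ofReal hsm)
  have hVn : ∀ n, ∀ τ ∈ Icc 0 l, ‖V n τ‖ ≤ 5 := fun n τ hτ =>
    norm_le_of_tsum_enorm _ 5 (by norm_num) (hVs' τ hτ) n
  have h0l : (0:ℝ) ∈ Icc 0 l := ⟨le_rfl, hl.le⟩
  -- sup trick
  set m : ℝ := ⨆ p : ℤ × Icc 0 l, ‖V p.1 p.2‖ with hm
  have hbdd : BddAbove (Set.range fun p : ℤ × Icc 0 l => ‖V p.1 p.2‖) :=
    ⟨5, by rintro _ ⟨p, rfl⟩; exact hVn p.1 _ p.2.2⟩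
  have hmle : ∀ n, ∀ τ ∈ Icc 0 l, ‖V n τ‖ ≤ m := fun n τ hτ => le_ciSup hbdd (n, ⟨τ, hτ⟩)
  have hm0 : 0 ≤ m := (norm_nonneg _).trans (hmle 0 0 h0l)
  have hm1 : m ≤ (K:ℝ)⁻¹ + 25 * m * l := by
    refine Real.iSup_le (fun p => ?_) (by positivity)
    obtain ⟨n, τ, hτ⟩ := p
    have h := (convex_Icc 0 l).norm_image_sub_le_of_norm_hasDerivWithin_le (f := V n) (C := 25 * m)
      (fun t ht => hV n t ht) (fun t ht => by
        rw [norm_mul, Complex.norm_I, one_mul]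
        refine (cubK_pt_le _ (hκ t) _ 5 m (by norm_num) hm0 (hVs' t ht) (fun k => hmle k t ht) n).trans ?_
        linarith) h0l hτ
    rw [h0, sub_zero, Real.norm_of_nonneg hτ.1] at h
    have h2 := blkf_norm L K n
    have h3 : ‖V n τ‖ ≤ ‖V n τ - blkf L K n‖ + ‖blkf L K n‖ := by
      simpa using norm_add_le (V n τ - blkf L K n) (blkf L K n)
    have h4 : 25 * m * τ ≤ 25 * m * l := by gcongr; exact hτ.2
    show ‖V n τ‖ ≤ _
    linarith
  have hm2 : m ≤ 2 * (K:ℝ)⁻¹ := by nlinarith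
  -- lower bound
  intro n hn1 hn2
  have hre : ∀ τ ∈ Icc 0 l, 1 / (4 * K) ≤ (cubK (kap (om α) A ρ τ) (fun k => V k τ) n).re := by
    intro τ hτ
    have e1 := blkf_cub L K hK (kap (om α) A ρ τ) (hκ τ) (fun n q a1 a2 a3 => by
      have := kap_near α hα A ρ l (5 * L * K) (1/2) hρ.le (by norm_num) (by linarith) τ hτ n q
        (blk_mem L K hL _ a1).2 (blk_mem L K hL _ a2).2 (blk_mem L K hL _ a3).2
      have h2 := Complex.abs_re_le_norm (kap (om α) A ρ τ n q - 1)
      have h3 := neg_abs_le (kap (om α) A ρ τ n q - 1).re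
      rw [Complex.sub_re, Complex.one_re] at h2 h3
      linarith) n hn1 hn2
    have e2 := cubK_pt_lip (kap (om α) A ρ τ) (hκ τ) (fun k => V k τ) (blkf L K) 5 (2 * (K:ℝ)⁻¹) (128 * l)
      (by norm_num) (by positivity) (by positivity) (hVs' τ hτ)
      (bsum.trans (ENNReal.ofReal_le_ofReal (by norm_num))) (hd' τ hτ)
      (fun k => (hmle k τ hτ).trans hm2) (fun k => (blkf_norm L K k).trans (by
        have : 0 < (K:ℝ)⁻¹ := by positivity
        linarith)) n
    have h2 := Complex.abs_re_le_norm (cubK (kap (om α) A ρ τ) (fun k => V k τ) n - cubK (kap (om α) A ρ τ) (blkf L K) n)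
    have h3 := neg_abs_le (cubK (kap (om α) A ρ τ) (fun k => V k τ) n - cubK (kap (om α) A ρ τ) (blkf L K) n).re
    rw [Complex.sub_re] at h2 h3
    have e3 : 3 * (5 * (128 * l) * (2 * (K:ℝ)⁻¹)) ≤ (1/4) * (K:ℝ)⁻¹ := by
      have : 0 < (K:ℝ)⁻¹ := by positivity
      nlinarith
    have e4 : (1:ℝ) / (2 * K) = (1/2) * (K:ℝ)⁻¹ := by field_simp
    have e5 : (1:ℝ) / (4 * K) = (1/4) * (K:ℝ)⁻¹ := by field_simp
    rw [e4] at e1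
    rw [e5]
    linarith
  have mono : MonotoneOn (fun τ => (V n τ).im - 1 / (4 * K) * τ) (Icc 0 l) := by
    refine monotoneOn_of_hasDerivWithinAt_nonneg (convex_Icc 0 l)
      (f' := fun τ => (cubK (kap (om α) A ρ τ) (fun k => V k τ) n).re - 1 / (4 * K)) ?_ ?_ ?_
    · have : ContinuousOn (V n) (Icc 0 l) := fun τ hτ => (hV n τ hτ).continuousWithinAt
      exact (Complex.continuous_im.comp_continuousOn this).sub (by fun_prop)
    · intro τ hτ
      have h1 := (hV n τ (interior_subset hτ)).mono (interior_subset)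
      have h2 : HasDerivWithinAt (fun τ => (V n τ).im) ((Complex.I * cubK (kap (om α) A ρ τ) (fun k => V k τ) n).im) (interior (Icc 0 l)) τ :=
        (Complex.imCLM.hasFDerivAt.comp_hasDerivWithinAt τ h1)
      have h3 : HasDerivWithinAt (fun τ : ℝ => 1 / (4 * (K:ℝ)) * τ) (1 / (4 * K)) (interior (Icc 0 l)) τ := by
        simpa using ((hasDerivAt_id τ).const_mul (1 / (4 * (K:ℝ)))).hasDerivWithinAt
      refine (h2.sub h3).congr_deriv ?_
      simp
    · intro τ hτ
      have := hre τ (interior_subset hτ)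
      linarith
  have hfin := mono h0l ⟨hl.le, le_rfl⟩ hl.le
  have hz : V n 0 = 0 := by
    rw [h0, blkf_off]
    intro hmem
    have h1 := (blk_mem L K hL n hmem).1
    have : (0:ℤ) < (L * K : ℕ) := by exact_mod_cast Nat.mul_pos hL hK
    omega
  simp only [hz, Complex.zero_im] at hfin
  have h5 : l / (4 * K) = 1 / (4 * K) * l := by ring
  rw [h5]
  have h6 := (le_abs_self _).trans (Complex.abs_im_le_norm (V n l))
  linarith

end

section
open scoped Real Topology NNReal
open Filter Set

/-- The conclusion of the main theorem. -/
def Concl (α s ε : ℝ) : Prop :=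
    ∃ (T : ℝ) (a : ℤ → ℝ → ℂ),
      0 < T ∧ T < ε ∧
      (∀ n : ℤ, ContDiff ℝ 1 (a n)) ∧
      (∀ m : ℕ,
        Summable (fun n : ℤ =>
          ((1:ℝ) + |(n:ℝ)|)^m * ⨆ t : Set.Icc (0:ℝ) T, ‖a n (t:ℝ)‖)) ∧
      (∀ (n : ℤ) (t : ℝ),
        Complex.I * deriv (a n) t
          + (((2 * π * |(n:ℝ)|) ^ (2*α) : ℝ) : ℂ) * a n t
          + ∑' p : {p : ℤ × ℤ × ℤ // n = p.1 - p.2.1 + p.2.2},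
              a p.1.1 t * (starRingEnd ℂ) (a p.1.2.1 t) * a p.1.2.2 t = 0) ∧
      HsSeq s (fun n => a n 0) < ε ∧
      HsSeq s (fun n => a n T) > ε⁻¹

lemma blkConc (α s : ℝ) (hα : 0 < α) (hs : s < 0) (ε : ℝ) (hε : 0 < ε) (L K : ℕ) (hL : 1 ≤ L)
    (hK : 1 ≤ K) (A l : ℝ) (hA : 0 < A) (hl : 0 < l) (hl2 : l ≤ 1 / 20000)
    (hT : l / A ^ 2 < ε)
    (hphase : l / A ^ 2 * (4 * (2 * π * (3 * (5 * L * K))) ^ (2 * α)) ≤ 1 / 8)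
    (hinit : A ^ 2 * (4 / K * (((L:ℝ) * K) ^ 2) ^ s) < ε ^ 2)
    (hfin : 4 * (ε⁻¹) ^ 2 < A ^ 2 * (l / (4 * K)) ^ 2 *
      ∑ n ∈ Finset.Icc (-(K:ℤ)) 0, ((1:ℝ) + (n:ℝ) ^ 2) ^ s) : Concl α s ε := by
  have hK' : (0:ℝ) < K := by exact_mod_cast hK
  have hK1 : (1:ℝ) ≤ K := by exact_mod_cast hK
  have hL1 : (1:ℝ) ≤ L := by exact_mod_cast hL
  set ρ : ℝ := 1 / (240 * L * K) with hρd
  have hρ : 0 < ρ := by positivity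
  have hρK : ρ * (6 * (5 * L * K)) = 1 / 8 := by rw [hρd]; field_simp; norm_num
  have hρK2 : ρ * K ≤ 1 / 240 := by
    have : ρ * K = 1 / (240 * L) := by rw [hρd]; field_simp
    rw [this]
    apply one_div_le_one_div_of_le <;> linarith
  obtain ⟨V, h0, hV, hVc, hVs, hlow⟩ := blkCore α hα L K hL hK A ρ l hl hl2 hρ (by linarith)
  refine reduct α s hα ε A l ρ hA hl hρ 5 (by norm_num) V hV hVc hVs hT ?_ ?_
  · refine Hs_upper s A ρ ε hA hρ.le hε _ (blk L K) (fun n hn => by rw [h0, blkf_off _ _ _ hn]) ?_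
    refine lt_of_le_of_lt ?_ hinit
    gcongr
    calc ∑ n ∈ blk L K, ((1:ℝ) + (n:ℝ)^2) ^ s * ‖V n 0‖^2
        ≤ ∑ n ∈ blk L K, (((L:ℝ) * K) ^ 2) ^ s * ((K:ℝ)⁻¹)^2 := by
          refine Finset.sum_le_sum fun n hn => ?_
          have h1 := blkf_norm L K n
          rw [h0]
          have h2 : ((L:ℝ) * K) ≤ n := by exact_mod_cast (blk_mem L K hL n hn).1
          gcongr ?_ * ?_ ^ 2
          apply Real.rpow_le_rpow_of_nonpos (by positivity) _ hs.le
          have : ((L:ℝ) * K) ^ 2 ≤ (n:ℝ) ^ 2 := by gcongr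
          linarith
      _ = (blk L K).card * ((((L:ℝ) * K) ^ 2) ^ s * ((K:ℝ)⁻¹)^2) := by simp
      _ ≤ (4 * K : ℝ) * ((((L:ℝ) * K) ^ 2) ^ s * ((K:ℝ)⁻¹)^2) := by
          gcongr
          exact_mod_cast blk_card L K
      _ = _ := by field_simp
  · have hl0 : l ∈ Icc 0 l := ⟨hl.le, le_rfl⟩
    refine Hs_lower s A ρ 5 ε⁻¹ hρ _ (fun n => norm_le_of_tsum_enorm _ 5 (by norm_num) (hVs l hl0) n)
      (Finset.Icc (-(K:ℤ)) 0) ?_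
    have : (ε⁻¹) ^ 2 < (1/4) * (A ^ 2 * (l / (4 * K)) ^ 2 *
      ∑ n ∈ Finset.Icc (-(K:ℤ)) 0, ((1:ℝ) + (n:ℝ) ^ 2) ^ s) := by linarith
    refine this.trans_le ?_
    rw [Finset.mul_sum, Finset.mul_sum]
    refine Finset.sum_le_sum fun n hn => ?_
    rw [Finset.mem_Icc] at hn
    have h1 := hlow n hn.1 hn.2
    have h2 : |(n:ℝ)| ≤ K := by
      rw [abs_le]
      constructor
      · exact_mod_cast hn.1
      · have : (n:ℝ) ≤ 0 := by exact_mod_cast hn.2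
        linarith
    have h3 : 1 / 2 ≤ Real.exp (-ρ * |(n:ℝ)|) := by
      have := Real.add_one_le_exp (-ρ * |(n:ℝ)|)
      have : ρ * |(n:ℝ)| ≤ ρ * K := by gcongr
      linarith
    calc _ = ((1:ℝ) + (n:ℝ)^2) ^ s * ((A * (1 / 2)) ^ 2 * (l / (4 * K)) ^ 2) := by ring
      _ ≤ _ := by gcongr

lemma blkFam (α s : ℝ) (hα : 0 < α) (hs : s < 0) (ε : ℝ) (hε : 0 < ε) (L : ℕ) (hL : 1 ≤ L)
    (κ l : ℝ) (hκ : 0 < κ) (hl : 0 < l) (hl2 : l ≤ 1 / 20000)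
    (hi : 4 * κ ^ 2 * (L:ℝ) ^ (2 * s) < ε ^ 2)
    (hp : ∀ᶠ K : ℕ in atTop, l / κ ^ 2 * (4 * (30 * π * L) ^ (2 * α)) * (K:ℝ) ^ (2 * α + 2 * s - 1) ≤ 1 / 8)
    (hf : ∀ᶠ K : ℕ in atTop, 4 * (ε⁻¹) ^ 2 < κ ^ 2 * l ^ 2 / 16 * ((K:ℝ) ^ (-1 - 2 * s) *
      ∑ n ∈ Finset.Icc (-(K:ℤ)) 0, ((1:ℝ) + (n:ℝ) ^ 2) ^ s)) : Concl α s ε := by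
  have hT : ∀ᶠ K : ℕ in atTop, l / κ ^ 2 * (K:ℝ) ^ (2 * s - 1) < ε := by
    have h1 := (tendsto_rpow_neg_atTop (show 0 < 1 - 2 * s by linarith)).comp (tendsto_natCast_atTop_atTop (R := ℝ))
    have h2 := h1.const_mul (l / κ ^ 2)
    rw [mul_zero] at h2
    refine (h2.eventually_lt_const hε).mono fun K h => ?_
    simp only [Function.comp, neg_sub] at h
    exact h
  obtain ⟨K, h1, h2, h3, hK⟩ := (hp.and (hf.and (hT.and (eventually_ge_atTop 1)))).exists
  have hK' : (0:ℝ) < K := by exact_mod_cast hK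
  have hL' : (0:ℝ) < L := by exact_mod_cast hL
  have hA2 : (κ * (K:ℝ) ^ (1 / 2 - s)) ^ 2 = κ ^ 2 * (K:ℝ) ^ (1 - 2 * s) := by
    rw [mul_pow, ← Real.rpow_natCast ((K:ℝ) ^ _), ← Real.rpow_mul hK'.le]
    congr 2; push_cast; ring
  have hdiv : l / (κ ^ 2 * (K:ℝ) ^ (1 - 2 * s)) = l / κ ^ 2 * (K:ℝ) ^ (2 * s - 1) := by
    rw [show 2 * s - 1 = -(1 - 2 * s) by ring, Real.rpow_neg hK'.le]
    field_simp
  refine blkConc α s hα hs ε hε L K hL hK (κ * (K:ℝ) ^ (1 / 2 - s)) l (by positivity) hl hl2 ?_ ?_ ?_ ?_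
  · rw [hA2, hdiv]; exact h3
  · rw [hA2, hdiv]
    refine le_trans (le_of_eq ?_) h1
    rw [show 2 * π * (3 * (5 * (L:ℝ) * K)) = (30 * π * L) * K by ring,
      Real.mul_rpow (by positivity) hK'.le, show 2 * α + 2 * s - 1 = 2 * α + (2 * s - 1) by ring,
      Real.rpow_add hK']
    ring
  · rw [hA2]
    refine lt_of_le_of_lt (le_of_eq ?_) hi
    rw [← Real.rpow_natCast ((L:ℝ) * K) 2, ← Real.rpow_mul (by positivity), Real.mul_rpow hL'.le hK'.le,
      Real.rpow_sub hK', Real.rpow_one]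
    push_cast
    have : (K:ℝ) ^ (2 * s) ≠ 0 := (Real.rpow_pos_of_pos hK' _).ne'
    field_simp
  · rw [hA2]
    refine lt_of_lt_of_le h2 (le_of_eq ?_)
    rw [show -1 - 2 * s = (1 - 2 * s) - 2 by ring, Real.rpow_sub hK' _ 2]
    norm_num
    field_simp
    norm_num
    try ring

lemma caseA (α s : ℝ) (hα : 0 < α) (hs : s ≤ -(1/2)) (hs2 : s ≤ 1 / 2 - α) (ε : ℝ) (hε : 0 < ε) :
    Concl α s ε := by
  set κ := ε / 4 with hκ
  have hκ0 : 0 < κ := by positivity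
  set W : ℝ := 4 * (30 * π * (1:ℕ)) ^ (2 * α) with hW
  have hW0 : 0 < W := by positivity
  set l := min (1 / 20000) (κ ^ 2 / (8 * W)) with hl
  have hl0 : 0 < l := by positivity
  have hlW : l / κ ^ 2 * W ≤ 1 / 8 := by
    have : l ≤ κ ^ 2 / (8 * W) := min_le_right _ _
    calc _ ≤ (κ ^ 2 / (8 * W)) / κ ^ 2 * W := by gcongr
      _ = _ := by field_simp
  refine blkFam α s hα (by linarith) ε hε 1 le_rfl κ l hκ0 hl0 (min_le_left _ _) ?_ ?_ ?_
  · simp only [Nat.cast_one, Real.one_rpow, hκ]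
    nlinarith [sq_nonneg ε]
  · filter_upwards [eventually_ge_atTop 1] with K hK
    have hK1 : (1:ℝ) ≤ K := by exact_mod_cast hK
    have : (K:ℝ) ^ (2 * α + 2 * s - 1) ≤ 1 := Real.rpow_le_one_of_one_le_of_nonpos hK1 (by linarith)
    rw [← hW]
    calc _ ≤ l / κ ^ 2 * W * 1 := by gcongr
      _ ≤ _ := by linarith
  · have hh := Real.tendsto_sum_range_one_div_nat_succ_atTop
    have h2 := hh.const_mul_atTop (show 0 < κ ^ 2 * l ^ 2 / 16 * (2:ℝ) ^ s by positivity)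
    filter_upwards [h2.eventually_gt_atTop (4 * (ε⁻¹) ^ 2), eventually_ge_atTop 1] with K hK hK1
    refine hK.trans_le ?_
    rw [mul_assoc]
    refine mul_le_mul_of_nonneg_left ?_ (by positivity)
    have hK0 : (0:ℝ) < K := by exact_mod_cast hK1
    have inj : Set.InjOn (fun i : ℕ => (-((i:ℤ) + 1))) (Finset.range K) := by
      intro a _ b _ h
      simp at h
      exact h
    have sub : (Finset.range K).image (fun i : ℕ => (-((i:ℤ) + 1))) ⊆ Finset.Icc (-(K:ℤ)) 0 := by
      intro n hn
      simp only [Finset.mem_image, Finset.mem_range] at hn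
      obtain ⟨i, hi, rfl⟩ := hn
      rw [Finset.mem_Icc]; omega
    calc (2:ℝ) ^ s * ∑ i ∈ Finset.range K, (1:ℝ) / (i + 1)
        ≤ (K:ℝ) ^ (-1 - 2 * s) * ∑ i ∈ Finset.range K, ((1:ℝ) + ((-((i:ℤ) + 1) : ℤ):ℝ) ^ 2) ^ s := by
          rw [Finset.mul_sum, Finset.mul_sum]
          refine Finset.sum_le_sum fun i hi => ?_
          have hiK : ((i:ℝ) + 1) ≤ K := by
            exact_mod_cast Finset.mem_range.1 hi
          have hi0 : (0:ℝ) < (i:ℝ) + 1 := by positivity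
          have e1 : (2 * ((i:ℝ) + 1) ^ 2) ^ s ≤ ((1:ℝ) + ((-((i:ℤ) + 1) : ℤ):ℝ) ^ 2) ^ s := by
            apply Real.rpow_le_rpow_of_nonpos (by positivity) _ (by linarith)
            push_cast
            have : (0:ℝ) ≤ i := by positivity
            nlinarith
          have e2 : (2 * ((i:ℝ) + 1) ^ 2) ^ s = (2:ℝ) ^ s * ((i:ℝ) + 1) ^ (2 * s) := by
            rw [Real.mul_rpow (by norm_num) (by positivity), ← Real.rpow_natCast, ← Real.rpow_mul hi0.le]
            norm_num
          have e3 : ((i:ℝ) + 1) ^ (-1 - 2 * s) ≤ (K:ℝ) ^ (-1 - 2 * s) :=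
            Real.rpow_le_rpow hi0.le hiK (by linarith)
          calc (2:ℝ) ^ s * (1 / (i + 1)) = ((i:ℝ) + 1) ^ (-1 - 2 * s) * ((2:ℝ) ^ s * ((i:ℝ) + 1) ^ (2 * s)) := by
                rw [mul_left_comm, ← Real.rpow_add hi0, show -1 - 2 * s + 2 * s = -1 by ring, Real.rpow_neg_one,
                  one_div]
            _ ≤ (K:ℝ) ^ (-1 - 2 * s) * ((1:ℝ) + ((-((i:ℤ) + 1) : ℤ):ℝ) ^ 2) ^ s := by
                rw [← e2]; gcongr
      _ ≤ _ := by
          refine mul_le_mul_of_nonneg_left ?_ (by positivity)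
          rw [← Finset.sum_image (f := fun n : ℤ => ((1:ℝ) + (n:ℝ) ^ 2) ^ s) inj]
          exact Finset.sum_le_sum_of_subset_of_nonneg sub (fun _ _ _ => by positivity)

lemma rpow_nat_small (r C δ : ℝ) (hr : 0 < r) (hδ : 0 < δ) :
    ∀ᶠ K : ℕ in atTop, C * (K:ℝ) ^ (-r) < δ := by
  have h1 := (tendsto_rpow_neg_atTop hr).comp (tendsto_natCast_atTop_atTop (R := ℝ))
  have h2 := h1.const_mul C
  rw [mul_zero] at h2
  exact h2.eventually_lt_const hδ

lemma caseB (α s : ℝ) (hα : 0 < α) (hs : -(1/2) < s) (hs0 : s < 0) (hs2 : s < 1 / 2 - α) (ε : ℝ) (hε : 0 < ε) :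
    Concl α s ε := by
  set l : ℝ := 1 / 20000 with hl
  have h2s : (1:ℝ) / 2 ≤ (2:ℝ) ^ s := by
    rw [show (1:ℝ) / 2 = (2:ℝ) ^ (-1:ℝ) by rw [Real.rpow_neg_one]; norm_num]
    exact Real.rpow_le_rpow_of_exponent_le (by norm_num) (by linarith)
  obtain ⟨κ, hκ⟩ : ∃ κ : ℝ, 0 < κ ∧ 4 * (ε⁻¹) ^ 2 < κ ^ 2 * l ^ 2 / 16 * (1 / 2) := by
    refine ⟨16 * ε⁻¹ / l, by positivity, ?_⟩
    have : (16 * ε⁻¹ / l) ^ 2 * l ^ 2 / 16 * (1 / 2) = 8 * ε⁻¹ ^ 2 := by field_simp; norm_num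
    rw [this]
    have : 0 < ε⁻¹ ^ 2 := by positivity
    linarith
  obtain ⟨hκ0, hκ1⟩ := hκ
  obtain ⟨L, hL1, hL⟩ := ((rpow_nat_small (-(2 * s)) (4 * κ ^ 2) (ε ^ 2) (by linarith) (by positivity)).and
    (eventually_ge_atTop 1)).exists
  rw [neg_neg] at hL1
  refine blkFam α s hα hs0 ε hε L hL κ l hκ0 (by positivity) le_rfl hL1 ?_ ?_
  · have := rpow_nat_small (-(2 * α + 2 * s - 1)) (l / κ ^ 2 * (4 * (30 * π * L) ^ (2 * α))) (1/8)
      (by linarith) (by norm_num)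
    rw [neg_neg] at this
    exact this.mono fun K h => h.le
  · filter_upwards [eventually_ge_atTop 1] with K hK
    have hK0 : (0:ℝ) < K := by exact_mod_cast hK
    have hK1 : (1:ℝ) ≤ K := by exact_mod_cast hK
    refine hκ1.trans_le ?_
    gcongr
    refine h2s.trans ?_
    calc (2:ℝ) ^ s = (K:ℝ) ^ (-1 - 2 * s) * (K * (2 * (K:ℝ) ^ 2) ^ s) := by
          rw [Real.mul_rpow (by norm_num) (by positivity), ← Real.rpow_natCast, ← Real.rpow_mul hK0.le,
            Real.rpow_sub hK0, Real.rpow_neg_one]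
          push_cast
          have : (K:ℝ) ^ (2 * s) ≠ 0 := (Real.rpow_pos_of_pos hK0 _).ne'
          field_simp
      _ ≤ (K:ℝ) ^ (-1 - 2 * s) * ∑ n ∈ Finset.Icc (-(K:ℤ)) 0, (2 * (K:ℝ) ^ 2) ^ s := by
          gcongr
          rw [Finset.sum_const, nsmul_eq_mul]
          gcongr
          simp
          omega
      _ ≤ _ := by
          gcongr ?_ * ?_
          refine Finset.sum_le_sum fun n hn => ?_
          rw [Finset.mem_Icc] at hn
          apply Real.rpow_le_rpow_of_nonpos (by positivity) _ hs0.le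
          have a1 : -(K:ℝ) ≤ n := by exact_mod_cast hn.1
          have a2 : (n:ℝ) ≤ 0 := by exact_mod_cast hn.2
          nlinarith

end

section
open scoped Real Topology NNReal ENNReal
open Filter Set

/-- Trigonometric polynomials, as finitely supported coefficient sequences. -/
abbrev TP := AddMonoidAlgebra ℂ ℤ

namespace TP

set_option linter.unusedSectionVars false

/-- The coefficient sequence as an element of `ℓ^p`. -/
noncomputable def toLp (p : ℝ≥0∞) (f : TP) : lp (fun _ : ℤ => ℂ) p :=
  ⟨fun n => f.coeff n, by
    by_cases hp : p.toReal = 0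
    · rcases (ENNReal.toReal_eq_zero_iff p).1 hp with h | h
      · subst h
        apply memℓp_zero
        exact f.coeff.hasFiniteSupport
      · subst h
        apply memℓp_infty
        refine Set.Finite.bddAbove ?_
        refine ((f.coeff.support.finite_toSet.image (fun n => ‖f.coeff n‖)).union (Set.finite_singleton 0)).subset ?_
        rintro _ ⟨n, rfl⟩
        by_cases hn : f.coeff n = 0
        · right; simp [hn]
        · left; exact ⟨n, by simpa using hn, rfl⟩
    · apply memℓp_gen
      apply summable_of_hasFiniteSupport
      refine f.coeff.hasFiniteSupport.subset ?_
      intro n hn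
      simp only [Function.mem_support] at hn ⊢
      intro h
      exact hn (by simp [h, Real.zero_rpow hp])⟩

/-- The `ℓ^p` norm of the coefficients. -/
noncomputable def nn (p : ℝ≥0∞) (f : TP) : ℝ := ‖toLp p f‖

variable {p : ℝ≥0∞} [Fact (1 ≤ p)]

lemma toLp_apply (p : ℝ≥0∞) (f : TP) (n : ℤ) : toLp p f n = f.coeff n := rfl

lemma toLp_add (f g : TP) : toLp p (f + g) = toLp p f + toLp p g := rfl
lemma toLp_sub (f g : TP) : toLp p (f - g) = toLp p f - toLp p g := rfl
lemma toLp_smul (c : ℂ) (f : TP) : toLp p (c • f) = c • toLp p f := rfl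

lemma nn_nonneg (f : TP) : 0 ≤ nn p f := norm_nonneg _
lemma nn_zero : nn p 0 = 0 := by
  have : toLp p 0 = 0 := rfl
  rw [nn, this, norm_zero]
lemma nn_add (f g : TP) : nn p (f + g) ≤ nn p f + nn p g := by
  unfold nn; rw [toLp_add]; exact norm_add_le _ _
lemma nn_sub (f g : TP) : nn p (f - g) ≤ nn p f + nn p g := by
  unfold nn; rw [toLp_sub]; exact norm_sub_le _ _
lemma nn_smul (c : ℂ) (f : TP) : nn p (c • f) = ‖c‖ * nn p f := by
  unfold nn; rw [toLp_smul, norm_smul]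
lemma nn_neg (f : TP) : nn p (-f) = nn p f := by
  have := nn_smul (p := p) (-1) f
  simpa using this
lemma nn_sum {ι : Type*} (s : Finset ι) (f : ι → TP) : nn p (∑ i ∈ s, f i) ≤ ∑ i ∈ s, nn p (f i) := by
  classical
  induction s using Finset.induction_on with
  | empty => simp [nn_zero]
  | insert a s ha ih =>
    rw [Finset.sum_insert ha, Finset.sum_insert ha]
    exact (nn_add _ _).trans (by linarith)

lemma coeff_le (f : TP) (n : ℤ) : ‖f.coeff n‖ ≤ nn p f := by
  have hp : p ≠ 0 := by
    have := Fact.out (p := 1 ≤ p)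
    intro h; subst h; simp at this
  exact lp.norm_apply_le_norm hp (toLp p f) n

lemma nn_single_mul (hp : p ≠ ⊤) (k : ℤ) (c : ℂ) (g : TP) :
    nn p (AddMonoidAlgebra.single k c * g) = ‖c‖ * nn p g := by
  have h1 : nn p (AddMonoidAlgebra.single k c * g) = nn p (c • g) := by
    have hp1 := Fact.out (p := 1 ≤ p)
    have hp0 : 0 < p.toReal := ENNReal.toReal_pos (by intro h; subst h; simp at hp1) hp
    unfold nn
    rw [lp.norm_eq_tsum_rpow hp0, lp.norm_eq_tsum_rpow hp0]
    congr 1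
    simp only [toLp_apply, AddMonoidAlgebra.coeff_single_mul_apply]
    exact (Equiv.addLeft (-k)).tsum_eq (fun n => ‖(c • g).coeff n‖ ^ p.toReal)
  rw [h1, nn_smul]

lemma nn1_eq (f : TP) (F : Finset ℤ) (hF : ∀ n ∉ F, f.coeff n = 0) :
    nn 1 f = ∑ n ∈ F, ‖f.coeff n‖ := by
  unfold nn
  rw [lp.norm_eq_tsum_rpow (by simp)]
  simp only [ENNReal.toReal_one, Real.rpow_one, div_one, toLp_apply]
  exact tsum_eq_sum (fun n hn => by rw [hF n hn, norm_zero])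

lemma nn2_eq (f : TP) (F : Finset ℤ) (hF : ∀ n ∉ F, f.coeff n = 0) :
    nn 2 f ^ 2 = ∑ n ∈ F, ‖f.coeff n‖ ^ 2 := by
  unfold nn
  rw [lp.norm_eq_tsum_rpow (by simp), ← Real.rpow_natCast (_ ^ _), ← Real.rpow_mul (by positivity)]
  simp only [ENNReal.toReal_ofNat, toLp_apply, Nat.cast_ofNat, one_div, Real.rpow_ofNat]
  norm_num
  exact tsum_eq_sum (fun n hn => by rw [hF n hn]; simp)

lemma nn_mul (hp : p ≠ ⊤) (f g : TP) : nn p (f * g) ≤ nn 1 f * nn p g := by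
  have h : f * g = ∑ k ∈ f.coeff.support, AddMonoidAlgebra.single k (f.coeff k) * g := by
    conv_lhs => rw [← AddMonoidAlgebra.sum_coeff_single f]
    rw [Finsupp.sum, Finset.sum_mul]
  rw [h, nn1_eq f f.coeff.support (by simp), Finset.sum_mul]
  refine (nn_sum _ _).trans (le_of_eq ?_)
  exact Finset.sum_congr rfl fun k _ => nn_single_mul hp k _ g

lemma nn1_mul (f g : TP) : nn 1 (f * g) ≤ nn 1 f * nn 1 g := nn_mul (by simp) f g
lemma nn2_mul (f g : TP) : nn 2 (f * g) ≤ nn 1 f * nn 2 g := nn_mul (by simp) f g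

lemma sup_mul (f g : TP) (C : ℝ) (hC : ∀ n, ‖g.coeff n‖ ≤ C) (n : ℤ) :
    ‖(f * g).coeff n‖ ≤ nn 1 f * C := by
  rw [AddMonoidAlgebra.coeff_mul_apply_left, Finsupp.sum, nn1_eq f f.coeff.support (by simp), Finset.sum_mul]
  refine (norm_sum_le _ _).trans (Finset.sum_le_sum fun k _ => ?_)
  rw [norm_mul]
  exact mul_le_mul_of_nonneg_left (hC _) (norm_nonneg _)

lemma nn1_one : nn 1 (1 : TP) = 1 := by
  rw [nn1_eq 1 {0}]
  · simp
  · intro n hn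
    simp only [Finset.mem_singleton] at hn
    rw [AddMonoidAlgebra.one_def, AddMonoidAlgebra.coeff_single, Finsupp.single_apply, if_neg (Ne.symm hn)]

lemma nn1_pow (f : TP) (j : ℕ) : nn 1 (f ^ j) ≤ nn 1 f ^ j := by
  induction j with
  | zero => simp [nn1_one]
  | succ j ih =>
    rw [pow_succ, pow_succ]
    exact (nn1_mul _ _).trans (mul_le_mul_of_nonneg_right ih (nn_nonneg _))

/-- Fourier multipliers. -/
noncomputable def mult (m : ℤ → ℂ) (f : TP) : TP :=
  AddMonoidAlgebra.ofCoeff (Finsupp.onFinset f.coeff.support (fun n => m n * f.coeff n)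
    (fun n h => by simp only [Finsupp.mem_support_iff]; exact right_ne_zero_of_mul h))

@[simp] lemma mult_coeff (m : ℤ → ℂ) (f : TP) (n : ℤ) : (mult m f).coeff n = m n * f.coeff n := rfl

lemma ext' {f g : TP} (h : ∀ n, f.coeff n = g.coeff n) : f = g :=
  AddMonoidAlgebra.ext (Finsupp.ext h)

lemma mult_add (m : ℤ → ℂ) (f g : TP) : mult m (f + g) = mult m f + mult m g :=
  ext' fun n => by simp [mul_add]
lemma mult_sub (m : ℤ → ℂ) (f g : TP) : mult m (f - g) = mult m f - mult m g :=
  ext' fun n => by simp [mul_sub]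
lemma mult_smul (m : ℤ → ℂ) (c : ℂ) (f : TP) : mult m (c • f) = c • mult m f :=
  ext' fun n => by simp; ring

lemma nn2_mult (m : ℤ → ℂ) (f : TP) (C : ℝ) (hC : 0 ≤ C) (h : ∀ n, f.coeff n ≠ 0 → ‖m n‖ ≤ C) :
    nn 2 (mult m f) ≤ C * nn 2 f := by
  apply le_of_sq_le_sq _ (mul_nonneg hC (nn_nonneg _))
  rw [mul_pow, nn2_eq f f.coeff.support (by simp), nn2_eq (mult m f) f.coeff.support (by intro n hn; simp at hn; simp [hn]), Finset.mul_sum]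
  refine Finset.sum_le_sum fun n hn => ?_
  rw [mult_coeff, norm_mul, mul_pow]
  have := h n (by simpa using hn)
  gcongr

lemma nn1_mult (m : ℤ → ℂ) (f : TP) (C : ℝ) (h : ∀ n, f.coeff n ≠ 0 → ‖m n‖ ≤ C) :
    nn 1 (mult m f) ≤ C * nn 1 f := by
  rw [nn1_eq f f.coeff.support (by simp), nn1_eq (mult m f) f.coeff.support (by intro n hn; simp at hn; simp [hn]), Finset.mul_sum]
  refine Finset.sum_le_sum fun n hn => ?_
  rw [mult_coeff, norm_mul]
  have := h n (by simpa using hn)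
  gcongr

/-- The derivation `f_n ↦ n f_n`. -/
noncomputable def D : Derivation ℂ TP TP :=
  Derivation.mk'
    { toFun := mult (fun n => (n:ℂ))
      map_add' := mult_add _
      map_smul' := fun c f => mult_smul _ c f } (by
    intro a b
    show mult _ (a * b) = a * mult _ b + b * mult _ a
    have sing : ∀ (k : ℤ) (c : ℂ), mult (fun n => (n:ℂ)) (AddMonoidAlgebra.single k c) =
        AddMonoidAlgebra.single k (k * c) := by
      intro k c
      apply ext'
      intro n
      rw [mult_coeff]
      simp only [AddMonoidAlgebra.coeff_single, Finsupp.single_apply]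
      split_ifs with h
      · rw [h]
      · simp
    have z : mult (fun n => (n:ℂ)) 0 = 0 := ext' fun n => by simp
    induction a using AddMonoidAlgebra.induction_linear with
    | zero => simp [z]
    | add x y hx hy => rw [add_mul, mult_add, hx, hy, mult_add]; ring
    | single k c =>
      induction b using AddMonoidAlgebra.induction_linear with
      | zero => simp [z]
      | add x y hx hy => rw [mul_add, mult_add, hx, hy, mult_add]; ring
      | single k' c' =>
        rw [AddMonoidAlgebra.single_mul_single, sing, sing, sing, AddMonoidAlgebra.single_mul_single,
          AddMonoidAlgebra.single_mul_single, add_comm k' k, ← AddMonoidAlgebra.single_add]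
        congr 1
        push_cast
        ring)

lemma D_apply (f : TP) : D f = mult (fun n => (n:ℂ)) f := rfl

/-- Conjugation of trigonometric polynomials. -/
noncomputable def st : TP →+* TP :=
  ((LaurentPolynomial.invert (R := ℂ)).toRingEquiv.toRingHom).comp
    (AddMonoidAlgebra.mapRingHom ℤ (starRingEnd ℂ))

lemma st_coeff (f : TP) (n : ℤ) : (st f).coeff n = (starRingEnd ℂ) (f.coeff (-n)) := by
  show (LaurentPolynomial.invert (R := ℂ) _).coeff n = _
  rw [LaurentPolynomial.invert_apply]
  simp

lemma st_smul (c : ℂ) (f : TP) : st (c • f) = (starRingEnd ℂ c) • st f :=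
  ext' fun n => by simp [st_coeff]

lemma coeff_mul_tsum (f g : TP) (n : ℤ) : (f * g).coeff n = ∑' k, f.coeff k * g.coeff (n - k) := by
  rw [AddMonoidAlgebra.coeff_mul_apply_left, Finsupp.sum, tsum_eq_sum (s := f.coeff.support)]
  · exact Finset.sum_congr rfl fun k _ => by rw [neg_add_eq_sub]
  · intro k hk
    simp at hk
    simp [hk]

lemma mul_st_zero (f g : TP) (F : Finset ℤ) (hF : ∀ n ∉ F, f.coeff n = 0) : (f * st g).coeff 0 = ∑ n ∈ F, f.coeff n * (starRingEnd ℂ) (g.coeff n) := by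
  rw [coeff_mul_tsum, tsum_eq_sum (s := F)]
  · exact Finset.sum_congr rfl fun k _ => by rw [st_coeff]; simp
  · intro k hk
    rw [hF k hk, zero_mul]

lemma mul_st_self (f : TP) : (f * st f).coeff 0 = ((nn 2 f ^ 2 : ℝ) : ℂ) := by
  rw [mul_st_zero f f f.coeff.support (by simp), nn2_eq f f.coeff.support (by simp)]
  push_cast
  exact Finset.sum_congr rfl fun n _ => by rw [Complex.mul_conj, Complex.normSq_eq_norm_sq]; push_cast; rfl

lemma mul_st_le (f g : TP) : ‖(f * st g).coeff 0‖ ≤ nn 2 f * nn 2 g := by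
  classical
  set F := f.coeff.support ∪ g.coeff.support with hF
  have h1 : ∀ n ∉ F, f.coeff n = 0 := by intro n hn; simp [hF] at hn; exact hn.1
  have h2 : ∀ n ∉ F, g.coeff n = 0 := by intro n hn; simp [hF] at hn; exact hn.2
  rw [mul_st_zero f g F h1]
  refine (norm_sum_le _ _).trans ?_
  apply le_of_sq_le_sq _ (mul_nonneg (nn_nonneg _) (nn_nonneg _))
  rw [mul_pow, nn2_eq f F h1, nn2_eq g F h2]
  refine le_trans (le_of_eq ?_) (Finset.sum_mul_sq_le_sq_mul_sq F (fun n => ‖f.coeff n‖) (fun n => ‖g.coeff n‖))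
  simp

/-- near-isometry -/
lemma nn2_iso (Q f : TP) (e : ℝ) (he : nn 1 (Q * st Q - 1) ≤ e) :
    |nn 2 (Q * f) ^ 2 - nn 2 f ^ 2| ≤ e * nn 2 f ^ 2 := by
  have h1 : (((Q * st Q - 1) * f) * st f).coeff 0 = ((nn 2 (Q * f) ^ 2 - nn 2 f ^ 2 : ℝ) : ℂ) := by
    push_cast
    have := mul_st_self (Q * f)
    have h2 := mul_st_self f
    push_cast at this h2
    rw [← this, ← h2, map_mul, ← Finsupp.sub_apply, ← AddMonoidAlgebra.coeff_sub]
    congr 2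
    ring
  have h2 := mul_st_le ((Q * st Q - 1) * f) f
  rw [h1, Complex.norm_real, Real.norm_eq_abs] at h2
  refine h2.trans ?_
  have h3 := nn2_mul (Q * st Q - 1) f
  have h4 : nn 1 (Q * st Q - 1) * nn 2 f ≤ e * nn 2 f := mul_le_mul_of_nonneg_right he (nn_nonneg _)
  calc _ ≤ (e * nn 2 f) * nn 2 f := mul_le_mul_of_nonneg_right (h3.trans h4) (nn_nonneg _)
    _ = _ := by ring

lemma cubN_eq (b : TP) (n : ℤ) : cubN (fun k => b.coeff k) n = (b * st b * b).coeff n := by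
  have hs : Summable (cubT (fun k => b.coeff k) n) := by
    apply summable_of_hasFiniteSupport
    refine (b.coeff.hasFiniteSupport.prod b.coeff.hasFiniteSupport).subset ?_
    rintro ⟨x, y⟩ h
    simp only [Function.mem_support, cubT] at h
    refine ⟨?_, ?_⟩
    · intro h0; apply h; simp only [] at h0 ⊢; rw [h0]; ring
    · intro h0; apply h; simp only [] at h0 ⊢; rw [h0]; simp
  rw [cubN, hs.tsum_prod, mul_assoc, coeff_mul_tsum]
  refine tsum_congr fun x => ?_
  rw [coeff_mul_tsum, ← tsum_mul_left, ← (Equiv.neg ℤ).tsum_eq]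
  refine tsum_congr fun y => ?_
  simp only [cubT, Equiv.neg_apply, st_coeff, neg_neg]
  rw [← sub_eq_add_neg, mul_assoc]

/-- `f` is supported in `|n| ≤ a`. -/
def Sup (f : TP) (a : ℕ) : Prop := ∀ n : ℤ, (a:ℤ) < |n| → f.coeff n = 0

lemma Sup.mono {f : TP} {a b : ℕ} (h : Sup f a) (hab : a ≤ b) : Sup f b := fun n hn => h n (by omega)
lemma Sup.smul {f : TP} {a : ℕ} (h : Sup f a) (c : ℂ) : Sup (c • f) a := fun n hn => by simp [h n hn]
lemma Sup.sum {ι : Type*} {s : Finset ι} {f : ι → TP} {a : ℕ} (h : ∀ i ∈ s, Sup (f i) a) : Sup (∑ i ∈ s, f i) a := by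
  intro n hn
  rw [AddMonoidAlgebra.coeff_sum, Finsupp.finsetSum_apply]
  exact Finset.sum_eq_zero fun i hi => h i hi n hn
lemma Sup.mul {f g : TP} {a b : ℕ} (hf : Sup f a) (hg : Sup g b) : Sup (f * g) (a + b) := by
  intro n hn
  rw [coeff_mul_tsum]
  convert tsum_zero with k
  by_cases hk : (a:ℤ) < |k|
  · rw [hf k hk, zero_mul]
  · rw [hg (n - k), mul_zero]
    have := abs_sub_abs_le_abs_sub n k
    push_cast at hn
    omega
lemma Sup.one : Sup 1 0 := by
  intro n hn
  have : n ≠ 0 := by intro h; subst h; simp at hn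
  rw [AddMonoidAlgebra.one_def, AddMonoidAlgebra.coeff_single, Finsupp.single_apply, if_neg this.symm]
lemma Sup.pow {f : TP} {a : ℕ} (h : Sup f a) (j : ℕ) : Sup (f ^ j) (j * a) := by
  induction j with
  | zero => simpa using Sup.one
  | succ j ih => rw [pow_succ, Nat.succ_mul]; exact ih.mul h
lemma Sup.mult {f : TP} {a : ℕ} (h : Sup f a) (m : ℤ → ℂ) : Sup (mult m f) a := fun n hn => by simp [h n hn]

end TP

end

section
open scoped Real Topology NNReal ENNReal
open Filter Set

section expo
set_option linter.unusedSectionVars false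
variable (k : Type*) [Field k] [CharZero k] {A : Type*} [CommRing A] [Algebra k A]

/-- Truncated exponential. -/
noncomputable def eT (J : ℕ) (x : A) : A :=
  ∑ j ∈ Finset.range (J + 1), ((j.factorial : k))⁻¹ • x ^ j

/-- Tail in the product of two truncated exponentials. -/
noncomputable def tl (J : ℕ) (x y : A) : A :=
  ∑ p ∈ (Finset.range (J + 1) ×ˢ Finset.range (J + 1)).filter (fun p => ¬ (p.1 + p.2 ≤ J)),
    (((p.1.factorial : k))⁻¹ * ((p.2.factorial : k))⁻¹) • (x ^ p.1 * y ^ p.2)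

lemma eT_mul (J : ℕ) (x y : A) : eT k J x * eT k J y = eT k J (x + y) + tl k J x y := by
  unfold eT tl
  rw [Finset.sum_mul_sum, ← Finset.sum_product',
    ← Finset.sum_filter_add_sum_filter_not _ (fun p : ℕ × ℕ => p.1 + p.2 ≤ J)]
  congr 1
  · rw [← Finset.sum_fiberwise_of_maps_to (s := (Finset.range (J + 1) ×ˢ Finset.range (J + 1)).filter
      (fun p => (p.1 + p.2 ≤ J))) (t := Finset.range (J + 1)) (g := fun p => p.1 + p.2)]
    · refine Finset.sum_congr rfl fun n hn => ?_
      have hset : (((Finset.range (J + 1) ×ˢ Finset.range (J + 1)).filter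
          (fun p => (p.1 + p.2 ≤ J))).filter (fun p => p.1 + p.2 = n)) = Finset.HasAntidiagonal.antidiagonal n := by
        ext ⟨i, j⟩
        simp only [Finset.mem_range] at hn
        simp only [Finset.mem_filter, Finset.mem_product, Finset.mem_range, Finset.HasAntidiagonal.mem_antidiagonal]
        omega
      rw [hset, Commute.add_pow' (Commute.all x y), Finset.smul_sum]
      refine Finset.sum_congr rfl fun p hp => ?_
      rw [Finset.HasAntidiagonal.mem_antidiagonal] at hp
      rw [smul_mul_smul_comm, ← Nat.cast_smul_eq_nsmul k, smul_smul]
      congr 1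
      rw [← hp, Nat.choose_symm_add, Nat.add_choose, Nat.cast_div (Nat.factorial_mul_factorial_dvd_factorial_add _ _)]
      · push_cast
        have h1 : ((p.1 + p.2).factorial : k) ≠ 0 := by exact_mod_cast Nat.factorial_ne_zero _
        have h2 : ((p.1).factorial : k) ≠ 0 := by exact_mod_cast Nat.factorial_ne_zero _
        have h3 : ((p.2).factorial : k) ≠ 0 := by exact_mod_cast Nat.factorial_ne_zero _
        field_simp
      · have h2 : ((p.1).factorial : k) ≠ 0 := by exact_mod_cast Nat.factorial_ne_zero _
        have h3 : ((p.2).factorial : k) ≠ 0 := by exact_mod_cast Nat.factorial_ne_zero _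
        push_cast
        exact mul_ne_zero h2 h3
    · intro p hp
      simp only [Finset.mem_filter, Finset.mem_product, Finset.mem_range] at hp ⊢
      omega
  · refine Finset.sum_congr rfl fun p hp => ?_
    rw [smul_mul_smul_comm]

lemma eT_zero (J : ℕ) : eT k J (0 : A) = 1 := by
  unfold eT
  rw [Finset.sum_range_succ']
  simp

lemma eT_succ (J : ℕ) (x : A) : eT k (J + 1) x = eT k J x + (((J + 1).factorial : k))⁻¹ • x ^ (J + 1) := by
  unfold eT
  rw [Finset.sum_range_succ]

lemma eT_deriv (D : Derivation k A A) (J : ℕ) (x : A) : D (eT k (J + 1) x) = eT k J x * D x := by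
  unfold eT
  rw [Finset.sum_range_succ', map_add, map_sum, Finset.sum_mul]
  have : D (((Nat.factorial 0 : k))⁻¹ • x ^ 0) = 0 := by simp
  rw [this, add_zero]
  refine Finset.sum_congr rfl fun j _ => ?_
  rw [Derivation.map_smul, Derivation.leibniz_pow, ← Nat.cast_smul_eq_nsmul k, smul_smul, Nat.factorial_succ]
  have h1 : ((j:k) + 1) ≠ 0 := by exact_mod_cast Nat.succ_ne_zero j
  have h2 : ((j).factorial : k) ≠ 0 := by exact_mod_cast Nat.factorial_ne_zero _
  rw [Nat.add_sub_cancel, smul_eq_mul, smul_mul_assoc]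
  congr 1
  push_cast
  field_simp

end expo

lemma eT_le (l : ℝ) (hl : 0 ≤ l) (J : ℕ) : eT ℝ J l ≤ Real.exp l := by
  have := Real.sum_le_exp_of_nonneg hl (J + 1)
  refine le_trans (le_of_eq ?_) this
  unfold eT
  exact Finset.sum_congr rfl fun j _ => by rw [smul_eq_mul]; field_simp

lemma eT_tendsto (l : ℝ) : Tendsto (fun J => eT ℝ J l) atTop (𝓝 (Real.exp l)) := by
  have h := (NormedSpace.expSeries_div_hasSum_exp (𝔸 := ℝ) l).tendsto_sum_nat
  rw [← Real.exp_eq_exp_ℝ] at h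
  have h2 := h.comp (tendsto_add_atTop_nat 1)
  refine h2.congr fun J => ?_
  unfold eT
  exact Finset.sum_congr rfl fun j _ => by rw [smul_eq_mul]; field_simp

lemma tl_nonneg (l : ℝ) (hl : 0 ≤ l) (J : ℕ) : 0 ≤ tl ℝ J l l := by
  unfold tl
  refine Finset.sum_nonneg fun p _ => ?_
  rw [smul_eq_mul]; positivity

lemma tl_tendsto (l : ℝ) : Tendsto (fun J => tl ℝ J l l) atTop (𝓝 0) := by
  have h : ∀ J, tl ℝ J l l = eT ℝ J l * eT ℝ J l - eT ℝ J (l + l) := by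
    intro J; rw [eT_mul]; ring
  simp only [h]
  have := ((eT_tendsto l).mul (eT_tendsto l)).sub (eT_tendsto (l + l))
  rwa [Real.exp_add, sub_self] at this

namespace TP

lemma nn1_pow_le (q : TP) (hq : nn 1 q ≤ 1) (c : ℂ) (l : ℝ) (hc : ‖c‖ ≤ l) (j : ℕ) :
    nn 1 ((c • q) ^ j) ≤ l ^ j := by
  refine (nn1_pow _ _).trans ?_
  gcongr
  · exact nn_nonneg _
  rw [nn_smul]
  calc ‖c‖ * nn 1 q ≤ ‖c‖ * 1 := by gcongr
    _ ≤ l := by linarith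

lemma nn1_eT (q : TP) (hq : nn 1 q ≤ 1) (c : ℂ) (l : ℝ) (hc : ‖c‖ ≤ l) (J : ℕ) :
    nn 1 (eT ℂ J (c • q)) ≤ Real.exp l := by
  have hl : 0 ≤ l := (norm_nonneg _).trans hc
  refine le_trans ?_ (eT_le l hl J)
  unfold eT
  refine (nn_sum _ _).trans (Finset.sum_le_sum fun j _ => ?_)
  rw [nn_smul, norm_inv, Complex.norm_natCast, smul_eq_mul]
  gcongr
  exact nn1_pow_le q hq c l hc j

lemma nn1_tl (q : TP) (hq : nn 1 q ≤ 1) (c d : ℂ) (l : ℝ) (hc : ‖c‖ ≤ l) (hd : ‖d‖ ≤ l) (J : ℕ) :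
    nn 1 (tl ℂ J (c • q) (d • q)) ≤ tl ℝ J l l := by
  have hl : 0 ≤ l := (norm_nonneg _).trans hc
  unfold tl
  refine (nn_sum _ _).trans (Finset.sum_le_sum fun p _ => ?_)
  rw [nn_smul, norm_mul, norm_inv, norm_inv, Complex.norm_natCast, Complex.norm_natCast, smul_eq_mul]
  gcongr
  refine (nn1_mul _ _).trans ?_
  gcongr
  · exact nn_nonneg _
  · exact nn1_pow_le q hq c l hc _
  · exact nn1_pow_le q hq d l hd _

lemma st_eT (J : ℕ) (x : TP) : st (eT ℂ J x) = eT ℂ J (st x) := by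
  unfold eT
  rw [map_sum]
  refine Finset.sum_congr rfl fun j _ => ?_
  rw [st_smul, map_pow]
  simp

lemma Sup_eT {q : TP} {a : ℕ} (h : Sup q a) (c : ℂ) (J : ℕ) : Sup (eT ℂ J (c • q)) (J * a) := by
  unfold eT
  refine Sup.sum fun j hj => Sup.smul (Sup.mono ((Sup.smul h c).pow j) ?_) _
  rw [Finset.mem_range] at hj
  exact Nat.mul_le_mul_right _ (by omega)

/-- Unitarity defect. -/
lemma defect (q : TP) (hq : nn 1 q ≤ 1) (hs : st q = q) (τ l : ℝ) (h0 : 0 ≤ τ) (hl : τ ≤ l) (J : ℕ) :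
    nn 1 (eT ℂ J ((Complex.I * τ) • q) * st (eT ℂ J ((Complex.I * τ) • q)) - 1) ≤ tl ℝ J l l := by
  have hn : ‖Complex.I * (τ:ℂ)‖ ≤ l := by simp [abs_of_nonneg h0, hl]
  have e : st ((Complex.I * τ) • q) = (-(Complex.I * τ)) • q := by
    rw [st_smul, hs]; simp
  rw [st_eT, e, eT_mul, neg_smul, add_neg_cancel, eT_zero, add_sub_cancel_left, ← neg_smul]
  exact nn1_tl q hq _ _ l hn (by rwa [norm_neg]) J

end TP

end

section
open scoped Real Topology NNReal ENNReal
open Filter Set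

namespace TP

/-- Real profile. -/
noncomputable def rphi (N : ℕ) (n : ℤ) : ℝ := if |n| ≤ N then (2 * (N:ℝ) + 1)⁻¹ else 0

/-- Initial profile. -/
noncomputable def phi (N : ℕ) : TP :=
  AddMonoidAlgebra.ofCoeff (Finsupp.onFinset (Finset.Icc (-(N:ℤ)) N) (fun n => ((rphi N n : ℝ) : ℂ))
    (fun n h => by
      rw [Finset.mem_Icc, ← abs_le]
      by_contra hc
      exact h (by simp [rphi, hc])))

lemma phi_coeff (N : ℕ) (n : ℤ) : (phi N).coeff n = ((rphi N n : ℝ) : ℂ) := rfl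

lemma rphi_nonneg (N : ℕ) (n : ℤ) : 0 ≤ rphi N n := by
  unfold rphi; split_ifs <;> positivity

lemma phi_coeff_le (N : ℕ) (n : ℤ) : ‖(phi N).coeff n‖ ≤ (2 * (N:ℝ) + 1)⁻¹ := by
  rw [phi_coeff, Complex.norm_real, Real.norm_eq_abs, abs_of_nonneg (rphi_nonneg _ _)]
  unfold rphi; split_ifs
  · rfl
  · positivity

lemma phi_sup (N : ℕ) : Sup (phi N) N := by
  intro n hn
  rw [phi_coeff, rphi, if_neg (by omega)]
  simp

lemma Sup.fin {f : TP} {N : ℕ} (h : Sup f N) (n : ℤ) (hn : n ∉ Finset.Icc (-(N:ℤ)) N) : f.coeff n = 0 := by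
  apply h
  rw [Finset.mem_Icc, ← abs_le] at hn
  omega

lemma phi_st (N : ℕ) : st (phi N) = phi N := by
  apply ext'
  intro n
  rw [st_coeff, phi_coeff, phi_coeff, Complex.conj_ofReal, rphi, rphi, abs_neg]

lemma card_Icc (N : ℕ) : ((Finset.Icc (-(N:ℤ)) N).card : ℝ) = 2 * N + 1 := by
  rw [Int.card_Icc]
  have : ((N:ℤ) + 1 - -(N:ℤ)).toNat = 2 * N + 1 := by omega
  rw [this]; push_cast; rfl

lemma phi_norm_mem (N : ℕ) (n : ℤ) (hn : n ∈ Finset.Icc (-(N:ℤ)) N) : ‖(phi N).coeff n‖ = (2 * (N:ℝ) + 1)⁻¹ := by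
  rw [Finset.mem_Icc, ← abs_le] at hn
  rw [phi_coeff, Complex.norm_real, Real.norm_eq_abs, abs_of_nonneg (rphi_nonneg _ _), rphi, if_pos hn]

lemma phi_nn1 (N : ℕ) : nn 1 (phi N) = 1 := by
  rw [nn1_eq _ _ (phi_sup N).fin, Finset.sum_congr rfl (phi_norm_mem N), Finset.sum_const, nsmul_eq_mul, card_Icc]
  field_simp

lemma phi_nn2 (N : ℕ) : nn 2 (phi N) ^ 2 = (2 * (N:ℝ) + 1)⁻¹ := by
  rw [nn2_eq _ _ (phi_sup N).fin, Finset.sum_congr rfl (fun n hn => by rw [phi_norm_mem N n hn]), Finset.sum_const,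
    nsmul_eq_mul, card_Icc]
  field_simp

lemma nn2_ge (f : TP) (G : Finset ℤ) : ∑ n ∈ G, ‖f.coeff n‖ ^ 2 ≤ nn 2 f ^ 2 := by
  classical
  rw [nn2_eq f (G ∪ f.coeff.support) (by intro n hn; simp at hn; exact hn.2)]
  exact Finset.sum_le_sum_of_subset_of_nonneg Finset.subset_union_left (fun _ _ _ => by positivity)

lemma phi_mul_coeff (N : ℕ) (g : TP) (n : ℤ) :
    (phi N * g).coeff n = ∑ k ∈ Finset.Icc (-(N:ℤ)) N, ((rphi N k : ℝ) : ℂ) * g.coeff (n - k) := by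
  rw [coeff_mul_tsum, tsum_eq_sum (s := Finset.Icc (-(N:ℤ)) N)]
  · rfl
  · intro k hk
    rw [(phi_sup N).fin k hk, zero_mul]

lemma phi3_coeff (m : ℕ) (n : ℤ) (h1 : 2 * (m:ℤ) ≤ n) (h2 : n ≤ 4 * (m:ℤ)) :
    ((m:ℝ) + 1) ^ 2 * ((2 * ((4 * m : ℕ):ℝ) + 1)⁻¹) ^ 3 ≤ ‖((phi (4 * m)) ^ 3).coeff n‖ := by
  set N := 4 * m with hN
  set r := rphi N with hr
  have e : ((phi N) ^ 3).coeff n = ((∑ k ∈ Finset.Icc (-(N:ℤ)) N, r k * ∑ k' ∈ Finset.Icc (-(N:ℤ)) N,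
      r k' * r (n - k - k') : ℝ) : ℂ) := by
    rw [show phi N ^ 3 = phi N * (phi N * phi N) by ring, phi_mul_coeff]
    push_cast
    refine Finset.sum_congr rfl fun k _ => ?_
    rw [phi_mul_coeff]
    rfl
  have r0 : ∀ n, 0 ≤ r n := rphi_nonneg N
  have hc : ∀ n : ℤ, |n| ≤ N → r n = (2 * (N:ℝ) + 1)⁻¹ := fun n hn => if_pos hn
  have sub : Finset.Icc (0:ℤ) m ⊆ Finset.Icc (-(N:ℤ)) N := by
    intro k hk
    rw [Finset.mem_Icc] at hk ⊢
    omega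
  rw [e, Complex.norm_real, Real.norm_eq_abs]
  refine le_trans ?_ (le_abs_self _)
  set c := (2 * (N:ℝ) + 1)⁻¹ with hcd
  have hcard : ((Finset.Icc (0:ℤ) m).card : ℝ) = m + 1 := by
    rw [Int.card_Icc]
    have : ((m:ℤ) + 1 - 0).toNat = m + 1 := by omega
    rw [this]; push_cast; rfl
  have inner : ∀ k ∈ Finset.Icc (0:ℤ) m, ((m:ℝ) + 1) * c ^ 2 ≤ ∑ k' ∈ Finset.Icc (-(N:ℤ)) N, r k' * r (n - k - k') := by
    intro k hk
    refine le_trans ?_ (Finset.sum_le_sum_of_subset_of_nonneg sub (fun i _ _ => mul_nonneg (r0 _) (r0 _)))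
    rw [← hcard, ← nsmul_eq_mul, ← Finset.sum_const]
    refine Finset.sum_le_sum fun k' hk' => ?_
    rw [Finset.mem_Icc] at hk hk'
    rw [hc k' (by rw [abs_le]; omega), hc _ (by rw [abs_le]; omega)]
    exact (pow_two _).le
  refine le_trans ?_ (Finset.sum_le_sum_of_subset_of_nonneg sub (fun i _ _ => mul_nonneg (r0 _)
    (Finset.sum_nonneg fun _ _ => mul_nonneg (r0 _) (r0 _))))
  calc ((m:ℝ) + 1) ^ 2 * c ^ 3 = ∑ k ∈ Finset.Icc (0:ℤ) m, c * (((m:ℝ) + 1) * c ^ 2) := by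
        rw [Finset.sum_const, nsmul_eq_mul, hcard]; ring
    _ ≤ _ := by
        refine Finset.sum_le_sum fun k hk => ?_
        have hk' := Finset.mem_Icc.1 hk
        rw [hc k (by rw [abs_le]; omega)]
        exact mul_le_mul_of_nonneg_left (inner k hk) (by positivity)

/-- Lower bound for `φ² Dφ`. -/
lemma phi_lower (m : ℕ) (hm : 1 ≤ m) :
    1 / 2 ^ 10 * (((4 * m : ℕ) : ℝ) * nn 2 (phi (4 * m))) ≤ nn 2 (phi (4 * m) ^ 2 * D (phi (4 * m))) := by
  set N := 4 * m with hN
  have hm0 : (1:ℝ) ≤ m := by exact_mod_cast hm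
  have hNm : (N:ℝ) = 4 * m := by rw [hN]; push_cast; rfl
  have e : D (phi N ^ 3) = (3:ℂ) • (phi N ^ 2 * D (phi N)) := by
    rw [Derivation.leibniz_pow, ← Nat.cast_smul_eq_nsmul ℂ]
    simp
  have e2 : nn 2 (D (phi N ^ 3)) = 3 * nn 2 (phi N ^ 2 * D (phi N)) := by
    rw [e, nn_smul]; simp
  have key : (1 / 2 ^ 8 * ((N : ℝ) * nn 2 (phi N))) ^ 2 ≤ nn 2 (D (phi N ^ 3)) ^ 2 := by
    refine le_trans ?_ (nn2_ge _ (Finset.Icc (2 * (m:ℤ)) (4 * m)))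
    have hcard : ((Finset.Icc (2 * (m:ℤ)) (4 * m)).card : ℝ) = 2 * m + 1 := by
      rw [Int.card_Icc]
      have : (4 * (m:ℤ) + 1 - 2 * m).toNat = 2 * m + 1 := by omega
      rw [this]; push_cast; rfl
    have each : ∀ n ∈ Finset.Icc (2 * (m:ℤ)) (4 * m), (2 * (m:ℝ) * (((m:ℝ) + 1) ^ 2 * ((2 * (N:ℝ) + 1)⁻¹) ^ 3)) ^ 2 ≤
        ‖(D (phi N ^ 3)).coeff n‖ ^ 2 := by
      intro n hn
      rw [Finset.mem_Icc] at hn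
      have h1 := phi3_coeff m n hn.1 hn.2
      rw [D_apply, mult_coeff, norm_mul]
      have h2 : 2 * (m:ℝ) ≤ ‖(n:ℂ)‖ := by
        rw [Complex.norm_intCast]
        refine le_trans ?_ (le_abs_self _)
        exact_mod_cast hn.1
      gcongr
    refine le_trans ?_ (Finset.sum_le_sum each)
    rw [Finset.sum_const, nsmul_eq_mul, hcard, mul_pow, mul_pow, phi_nn2, hNm]
    set c := (2 * (4 * (m:ℝ)) + 1)⁻¹ with hc
    have hc0 : 0 < c := by positivity
    have hcm : 1 / 8 ≤ ((m:ℝ) + 1) * c := by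
      rw [hc, ← div_eq_mul_inv, div_le_div_iff₀ (by norm_num) (by positivity)]
      linarith
    have hcm2 : 1 / 4 ≤ (2 * (m:ℝ) + 1) * c := by
      rw [hc, ← div_eq_mul_inv, div_le_div_iff₀ (by norm_num) (by positivity)]
      linarith
    calc (1 / 2 ^ 8) ^ 2 * ((4 * (m:ℝ)) ^ 2 * c) = (2 * m) ^ 2 * (1/4) * (1/8) ^ 4 * c := by ring
      _ ≤ (2 * m) ^ 2 * ((2 * (m:ℝ) + 1) * c) * (((m:ℝ) + 1) * c) ^ 4 * c := by gcongr
      _ = _ := by ring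
  have h3 := abs_le_of_sq_le_sq' key (nn_nonneg _) |>.2
  have h0 : 0 ≤ (N:ℝ) * nn 2 (phi N) := mul_nonneg (by positivity) (nn_nonneg _)
  rw [e2] at h3
  linarith

lemma coeff_geT (g q : TP) (c : ℂ) (J : ℕ) (n : ℤ) : (g * eT ℂ J (c • q)).coeff n =
    ∑ j ∈ Finset.range (J + 1), ((j.factorial : ℂ)⁻¹ * c ^ j) * (g * q ^ j).coeff n := by
  unfold eT
  rw [Finset.mul_sum, AddMonoidAlgebra.coeff_sum, Finsupp.finsetSum_apply]
  refine Finset.sum_congr rfl fun j _ => ?_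
  rw [smul_pow, smul_smul, mul_smul_comm, AddMonoidAlgebra.coeff_smul_apply, smul_eq_mul]

lemma cont_geT (g q : TP) (J : ℕ) (n : ℤ) :
    Continuous (fun τ : ℝ => (g * eT ℂ J ((Complex.I * τ) • q)).coeff n) := by
  simp only [coeff_geT]
  fun_prop

lemma deriv_geT (g q : TP) (J : ℕ) (n : ℤ) (τ : ℝ) :
    HasDerivAt (fun τ : ℝ => (g * eT ℂ (J + 1) ((Complex.I * τ) • q)).coeff n)
      ((((Complex.I) • (g * q)) * eT ℂ J ((Complex.I * τ) • q)).coeff n) τ := by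
  have h1 : HasDerivAt (fun τ : ℝ => Complex.I * (τ:ℂ)) Complex.I τ := by
    simpa using (Complex.ofRealCLM.hasDerivAt (x := τ)).const_mul Complex.I
  have h2 : HasDerivAt (fun τ : ℝ => ∑ j ∈ Finset.range (J + 1 + 1), ((j.factorial : ℂ)⁻¹ * (Complex.I * (τ:ℂ)) ^ j) * (g * q ^ j).coeff n)
      (∑ j ∈ Finset.range (J + 1 + 1), ((j.factorial : ℂ)⁻¹ * (((j:ℕ):ℂ) * (Complex.I * (τ:ℂ)) ^ (j - 1) * Complex.I)) * (g * q ^ j).coeff n) τ :=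
    HasDerivAt.fun_sum fun j _ => (((h1.pow j)).const_mul _).mul_const _
  simp only [coeff_geT]
  convert h2 using 1
  rw [Finset.sum_range_succ' (n := J + 1)]
  simp only [Nat.cast_zero, zero_mul, mul_zero, add_zero]
  refine Finset.sum_congr rfl fun j _ => ?_
  rw [smul_mul_assoc, AddMonoidAlgebra.coeff_smul_apply, smul_eq_mul, Nat.add_sub_cancel, Nat.factorial_succ,
    mul_assoc g q, ← pow_succ']
  have h1 : ((j:ℂ) + 1) ≠ 0 := by exact_mod_cast Nat.succ_ne_zero j
  have h2 : ((j).factorial : ℂ) ≠ 0 := by exact_mod_cast Nat.factorial_ne_zero _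
  push_cast
  field_simp

end TP

end

section
open scoped Real Topology NNReal ENNReal
open Filter Set

namespace TP

lemma q_nn1 (N : ℕ) : nn 1 (phi N ^ 2) ≤ 1 := by
  refine (nn1_pow _ _).trans ?_
  rw [phi_nn1]; norm_num

lemma q_st (N : ℕ) : st (phi N ^ 2) = phi N ^ 2 := by rw [map_pow, phi_st]

lemma rem_nn1 (N J : ℕ) (τ l : ℝ) (h0 : 0 ≤ τ) (hl : τ ≤ l) :
    nn 1 ((((J + 1).factorial : ℂ))⁻¹ • ((Complex.I * τ) • phi N ^ 2) ^ (J + 1)) ≤ l ^ (J + 1) / (J + 1).factorial := by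
  rw [nn_smul, norm_inv, Complex.norm_natCast, div_eq_inv_mul]
  have := nn1_pow_le (phi N ^ 2) (q_nn1 N) (Complex.I * τ) l (by simp [abs_of_nonneg h0, hl]) (J + 1)
  gcongr

lemma resid (N J : ℕ) (τ l : ℝ) (h0 : 0 ≤ τ) (hl : τ ≤ l) (b : TP)
    (hb : b = phi N * eT ℂ (J + 1) ((Complex.I * τ) • phi N ^ 2)) :
    nn 1 ((Complex.I • (phi N * phi N ^ 2)) * eT ℂ J ((Complex.I * τ) • phi N ^ 2) - Complex.I • (b * st b * b)) ≤
      l ^ (J + 1) / (J + 1).factorial + tl ℝ (J + 1) l l * Real.exp l := by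
  set x := (Complex.I * (τ:ℂ)) • phi N ^ 2 with hx
  set Q := eT ℂ (J + 1) x with hQ
  set r := (((J + 1).factorial : ℂ))⁻¹ • x ^ (J + 1) with hr
  have e1 : eT ℂ J x = Q - r := by rw [hQ, eT_succ]; ring
  have e2 : (Complex.I • (phi N * phi N ^ 2)) * eT ℂ J x - Complex.I • (b * st b * b) =
      (-Complex.I) • (phi N ^ 3 * (r + (Q * st Q - 1) * Q)) := by
    rw [smul_mul_assoc, ← smul_sub, neg_smul, ← smul_neg, e1, hb, map_mul, phi_st]
    congr 1
    ring
  have hQ1 : nn 1 Q ≤ Real.exp l := nn1_eT _ (q_nn1 N) _ l (by simp [abs_of_nonneg h0, hl]) _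
  have hd : nn 1 (Q * st Q - 1) ≤ tl ℝ (J + 1) l l := defect _ (q_nn1 N) (q_st N) τ l h0 hl _
  have h3 : nn 1 (phi N ^ 3) ≤ 1 := by
    refine (nn1_pow _ _).trans ?_
    rw [phi_nn1]; norm_num
  rw [e2, nn_smul, norm_neg, Complex.norm_I, one_mul]
  calc _ ≤ nn 1 (phi N ^ 3) * nn 1 (r + (Q * st Q - 1) * Q) := nn1_mul _ _
    _ ≤ 1 * nn 1 (r + (Q * st Q - 1) * Q) := mul_le_mul_of_nonneg_right h3 (nn_nonneg _)
    _ ≤ nn 1 r + nn 1 ((Q * st Q - 1) * Q) := by rw [one_mul]; exact nn_add _ _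
    _ ≤ _ := by
        refine add_le_add (rem_nn1 N J τ l h0 hl) ((nn1_mul _ _).trans ?_)
        exact mul_le_mul hd hQ1 (nn_nonneg _) (tl_nonneg _ (h0.trans hl) _)

/-- low frequency cutoff -/
noncomputable def lo (B : ℕ) (n : ℤ) : ℂ := if |n| ≤ B then 1 else 0
/-- high frequency cutoff -/
noncomputable def hi (B : ℕ) (n : ℤ) : ℂ := if |n| ≤ B then 0 else 1

lemma lo_hi (B : ℕ) (f : TP) : mult (lo B) f + mult (hi B) f = f := by
  apply ext'
  intro n
  rw [AddMonoidAlgebra.coeff_add, Finsupp.add_apply, mult_coeff, mult_coeff, lo, hi]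
  split_ifs <;> simp

lemma lo_le (B : ℕ) (f : TP) : nn 2 (mult (lo B) f) ≤ nn 2 f := by
  have := nn2_mult (lo B) f 1 (by norm_num) (fun n _ => by unfold lo; split_ifs <;> simp)
  linarith

lemma hi_le (B : ℕ) (f : TP) : nn 2 (mult (hi B) f) ≤ nn 2 f := by
  have := nn2_mult (hi B) f 1 (by norm_num) (fun n _ => by unfold hi; split_ifs <;> simp)
  linarith

lemma D_nn2 (N : ℕ) : nn 2 (D (phi N)) ≤ N * nn 2 (phi N) := by
  rw [D_apply]
  refine nn2_mult _ _ _ (by positivity) fun n hn => ?_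
  have : |n| ≤ N := by
    by_contra hc
    exact hn (phi_sup N n (by omega))
  rw [Complex.norm_intCast]
  exact_mod_cast this

lemma D_nn1 (N : ℕ) : nn 1 (D (phi N)) ≤ N := by
  rw [D_apply]
  have := nn1_mult (fun n : ℤ => (n:ℂ)) (phi N) N fun n hn => by
    have : |n| ≤ N := by
      by_contra hc
      exact hn (phi_sup N n (by omega))
    rw [Complex.norm_intCast]
    exact_mod_cast this
  rwa [phi_nn1, mul_one] at this

lemma hiMass (L m J : ℕ) (hm : 1 ≤ m) (l : ℝ) (hl : 0 < l) (h1 : ((L:ℝ) + 3) / l ≤ 1 / 2 ^ 13)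
    (h2 : l ^ (J + 1) / (J + 1).factorial ≤ 1 / 2 ^ 13) (h3 : tl ℝ (J + 1) l l ≤ 3 / 4) :
    1 / 2 ^ 12 * nn 2 (phi (4 * m)) ≤
      nn 2 (mult (hi (L * (4 * m))) (phi (4 * m) * eT ℂ (J + 1) ((Complex.I * l) • phi (4 * m) ^ 2))) := by
  have hlow := phi_lower m hm
  set N := 4 * m with hN
  have hN0 : (0:ℝ) < N := by
    have : 0 < N := by omega
    exact_mod_cast this
  set φ := phi N with hφ
  set x := (Complex.I * (l:ℂ)) • φ ^ 2 with hx
  set Q := eT ℂ (J + 1) x with hQ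
  set r := (((J + 1).factorial : ℂ))⁻¹ • x ^ (J + 1) with hr
  set ν := nn 2 φ with hν
  have hν0 : 0 ≤ ν := nn_nonneg _
  have e1 : eT ℂ J x = Q - r := by rw [hQ, eT_succ]; ring
  have hd : nn 1 (Q * st Q - 1) ≤ 3 / 4 := (defect _ (q_nn1 N) (q_st N) l l hl.le le_rfl _).trans h3
  have up : ∀ f, nn 2 (Q * f) ≤ 2 * nn 2 f := by
    intro f
    have h := (abs_le.1 (nn2_iso Q f _ hd)).2
    refine abs_le_of_sq_le_sq' ?_ (mul_nonneg (by norm_num) (nn_nonneg _)) |>.2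
    nlinarith [sq_nonneg (nn 2 f)]
  have dn : ∀ f, 1 / 2 * nn 2 f ≤ nn 2 (Q * f) := by
    intro f
    have h := (abs_le.1 (nn2_iso Q f _ hd)).1
    refine abs_le_of_sq_le_sq' ?_ (nn_nonneg _) |>.2
    nlinarith [sq_nonneg (nn 2 f)]
  set h := φ * D φ * (φ * Q) with hh
  set B := (L + 2) * N with hB
  -- derivative identity
  have id1 : (2 * (Complex.I * (l:ℂ))) • h = (D (φ * Q) - Q * D φ) + (2 * (Complex.I * (l:ℂ))) • ((φ ^ 2 * r) * D φ) := by
    have hDx : D x = (Complex.I * (l:ℂ)) • (2 * (φ * D φ)) := by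
      rw [hx, Derivation.map_smul, Derivation.leibniz_pow]
      congr 1
      simp [two_mul, two_smul]
    rw [Derivation.leibniz, hQ, eT_deriv, ← hQ, hDx, e1, hh]
    simp only [smul_eq_mul, Algebra.smul_def, map_mul, map_ofNat]
    ring
  have hr1 : nn 1 r ≤ 1 / 2 ^ 13 := (rem_nn1 N J l l hl.le le_rfl).trans h2
  have c1 : nn 2 (mult (lo B) (D (φ * Q))) ≤ B * (2 * ν) := by
    have e : mult (lo B) (D (φ * Q)) = mult (fun n => lo B n * n) (φ * Q) := by
      apply ext'; intro n; rw [D_apply, mult_coeff, mult_coeff, mult_coeff, mul_assoc]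
    rw [e]
    refine (nn2_mult _ _ (B:ℝ) (by positivity) fun n _ => ?_).trans ?_
    · unfold lo
      split_ifs with hc
      · rw [one_mul, Complex.norm_intCast]
        exact_mod_cast hc
      · simp
    · rw [mul_comm φ Q]
      exact mul_le_mul_of_nonneg_left (up φ) (by positivity)
  have c2 : nn 2 (mult (lo B) (Q * D φ)) ≤ 2 * (N * ν) := by
    refine (lo_le _ _).trans ((up _).trans ?_)
    have := D_nn2 N
    linarith
  have c3 : nn 2 (mult (lo B) ((φ ^ 2 * r) * D φ)) ≤ 1 / 2 ^ 13 * (N * ν) := by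
    refine (lo_le _ _).trans ((nn2_mul _ _).trans ?_)
    have a1 : nn 1 (φ ^ 2 * r) ≤ 1 / 2 ^ 13 := by
      refine (nn1_mul _ _).trans ?_
      have := q_nn1 N
      calc _ ≤ 1 * (1 / 2 ^ 13 : ℝ) := mul_le_mul this hr1 (nn_nonneg _) (by norm_num)
        _ = _ := by ring
    exact mul_le_mul a1 (D_nn2 N) (nn_nonneg _) (by norm_num)
  have n2l : ‖(2 * (Complex.I * (l:ℂ)))‖ = 2 * l := by simp [abs_of_pos hl]
  have c4 : nn 2 (mult (lo B) h) ≤ 1 / 2 ^ 12 * (N * ν) := by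
    have : 2 * l * nn 2 (mult (lo B) h) ≤ B * (2 * ν) + 2 * (N * ν) + 2 * l * (1 / 2 ^ 13 * (N * ν)) := by
      rw [← n2l, ← nn_smul, ← mult_smul, id1, mult_add, mult_sub, mult_smul]
      refine (nn_add _ _).trans (add_le_add ((nn_sub _ _).trans (add_le_add c1 c2)) ?_)
      rw [nn_smul]
      exact mul_le_mul_of_nonneg_left c3 (norm_nonneg _)
    have hBr : (B:ℝ) = (L + 2) * N := by rw [hB]; push_cast; rfl
    rw [hBr] at this
    have h1' : (L:ℝ) + 3 ≤ 1 / 2 ^ 13 * l := by rwa [div_le_iff₀ hl] at h1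
    have hNν : 0 ≤ N * ν := by positivity
    have : 2 * l * nn 2 (mult (lo B) h) ≤ 2 * l * (1 / 2 ^ 12 * (N * ν)) := by
      refine this.trans ?_
      have := mul_le_mul_of_nonneg_right h1' hNν
      linarith
    exact le_of_mul_le_mul_left this (by positivity)
  have c5 : 1 / 2 ^ 11 * (N * ν) ≤ nn 2 h := by
    have : h = Q * (φ ^ 2 * D φ) := by rw [hh]; ring
    rw [this]
    refine le_trans ?_ (dn _)
    linarith
  have c6 : 1 / 2 ^ 12 * (N * ν) ≤ nn 2 (mult (hi B) h) := by
    have := nn_add (p := 2) (mult (lo B) h) (mult (hi B) h)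
    rw [lo_hi] at this
    linarith
  have c7 : mult (hi B) h = mult (hi B) (φ * D φ * mult (hi (L * N)) (φ * Q)) := by
    have e : h = φ * D φ * mult (lo (L * N)) (φ * Q) + φ * D φ * mult (hi (L * N)) (φ * Q) := by
      rw [← mul_add, lo_hi]
    rw [e, mult_add]
    have z : mult (hi B) (φ * D φ * mult (lo (L * N)) (φ * Q)) = 0 := by
      have s1 : Sup (mult (lo (L * N)) (φ * Q)) (L * N) := by
        intro n hn
        rw [mult_coeff, lo, if_neg (by omega), zero_mul]
      have s2 : Sup (φ * D φ * mult (lo (L * N)) (φ * Q)) B :=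
        (((phi_sup N).mul ((phi_sup N).mult _)).mul s1).mono (by rw [hB]; nlinarith)
      apply ext'
      intro n
      rw [mult_coeff, hi]
      split_ifs with hc
      · simp
      · rw [s2 n (by omega)]; simp
    rw [z, zero_add]
  have c8 : nn 2 (mult (hi B) h) ≤ N * nn 2 (mult (hi (L * N)) (φ * Q)) := by
    rw [c7]
    refine (hi_le _ _).trans ((nn2_mul _ _).trans (mul_le_mul_of_nonneg_right ?_ (nn_nonneg _)))
    refine (nn1_mul _ _).trans ?_
    rw [phi_nn1, one_mul]
    exact D_nn1 N
  have : N * (1 / 2 ^ 12 * ν) ≤ N * nn 2 (mult (hi (L * N)) (φ * Q)) := by linarith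
  exact le_of_mul_le_mul_left this hN0

end TP

end

section
open scoped Real Topology NNReal ENNReal
open Filter Set

lemma TP.enorm_nn1 (f : TP) : ∑' n, ‖f.coeff n‖ₑ = ENNReal.ofReal (TP.nn 1 f) := by
  rw [TP.nn1_eq f f.coeff.support (by simp), tsum_eq_sum (s := f.coeff.support)
    (fun n hn => by simp at hn; simp [hn]), ENNReal.ofReal_sum_of_nonneg fun _ _ => norm_nonneg _]
  simp

open TP in
lemma tpCore (α : ℝ) (hα : 0 < α) (N J : ℕ) (A ρ l δ0 η1 δs : ℝ) (hl : 0 < l) (hρ : 0 ≤ ρ)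
    (hδ0 : 0 ≤ δ0) (hδ1 : δ0 ≤ 1)
    (hph : ρ * (6 * ((2 * J + 3) * N)) + l / A ^ 2 * (4 * (2 * π * (3 * ((2 * J + 3) * N))) ^ (2 * α)) ≤ δ0 / 2)
    (hη : l ^ (J + 1) / (J + 1).factorial + tl ℝ (J + 1) l l * Real.exp l ≤ η1)
    (hsm : (η1 + δ0 * Real.exp l ^ 3) / (3 * (Real.exp l + 1) ^ 2) *
      (Real.exp ((3 * (Real.exp l + 1) ^ 2) * l) - 1) ≤ δs) (hδs : δs < 1) :
    ∃ V : ℤ → ℝ → ℂ, (∀ n, V n 0 = (phi N).coeff n) ∧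
      (∀ n, ∀ τ ∈ Icc 0 l, HasDerivWithinAt (V n)
        (Complex.I * cubK (kap (om α) A ρ τ) (fun k => V k τ) n) (Icc 0 l) τ) ∧
      (∀ n, ContinuousOn
        (fun τ => Complex.I * cubK (kap (om α) A ρ τ) (fun k => V k τ) n) (Icc 0 l)) ∧
      (∀ τ ∈ Icc 0 l, ∑' n, ‖V n τ‖ₑ ≤ ENNReal.ofReal (Real.exp l + 1)) ∧
      ∑' n, ‖V n l - (phi N * eT ℂ (J + 1) ((Complex.I * l) • phi N ^ 2)).coeff n‖ₑ ≤ ENNReal.ofReal δs := by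
  have hη1 : 0 ≤ η1 := le_trans (by
    have := tl_nonneg l hl.le (J + 1)
    positivity) hη
  set B : ℝ → TP := fun τ => phi N * eT ℂ (J + 1) ((Complex.I * τ) • phi N ^ 2) with hB
  set B' : ℝ → TP := fun τ => (Complex.I • (phi N * phi N ^ 2)) * eT ℂ J ((Complex.I * τ) • phi N ^ 2) with hB'
  set M : ℕ := (2 * J + 3) * N with hM
  have hMr : ((2 * J + 3) * N : ℝ) = (M:ℝ) := by rw [hM]; push_cast; ring
  have supB : ∀ τ, Sup (B τ) M := fun τ =>
    ((phi_sup N).mul (Sup_eT ((phi_sup N).pow 2) _ _)).mono (by rw [hM]; ring_nf; rfl)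
  have supB' : ∀ τ, Sup (B' τ) M := fun τ =>
    ((((phi_sup N).mul ((phi_sup N).pow 2)).smul _).mul (Sup_eT ((phi_sup N).pow 2) _ _)).mono
      (by rw [hM]; ring_nf; rfl)
  have nB : ∀ τ ∈ Icc 0 l, nn 1 (B τ) ≤ Real.exp l := by
    intro τ hτ
    refine (nn1_mul _ _).trans ?_
    rw [phi_nn1, one_mul]
    exact nn1_eT _ (q_nn1 N) _ _ (by simp [abs_of_nonneg hτ.1, hτ.2]) _
  have hres : ∀ τ ∈ Icc 0 l, ∑' n, ‖(B' τ).coeff n - Complex.I * cubK (kap (om α) A ρ τ) (fun k => (B τ).coeff k) n‖ₑ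
      ≤ ENNReal.ofReal (η1 + δ0 * Real.exp l ^ 3) := by
    intro τ hτ
    set b : ℤ → ℂ := fun k => (B τ).coeff k with hb
    have h1 := cubK_near (kap (om α) A ρ τ) (kap_norm_le (om α) A ρ hρ τ) b (Real.exp l) δ0 (by positivity) hδ0
      (by rw [hb, TP.enorm_nn1]; exact ENNReal.ofReal_le_ofReal (nB τ hτ)) (by
        intro n q hq
        have hne : ∀ k, b k ≠ 0 → |(k:ℝ)| ≤ M := by
          intro k hk
          by_contra hc
          refine hk (supB τ k ?_)
          push Not at hc
          exact_mod_cast hc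
        unfold cubT at hq
        refine kap_near α hα A ρ l M δ0 hρ hδ1 (by rw [← hMr]; exact hph) τ hτ n q (hne _ ?_) (hne _ ?_) (hne _ ?_)
        · intro h; simp [h] at hq
        · intro h; simp [h] at hq
        · intro h; simp [h] at hq)
    have h2 : ∑' n, ‖(B' τ).coeff n - Complex.I * cubN b n‖ₑ ≤ ENNReal.ofReal η1 := by
      have h3 := (resid N J τ l hτ.1 hτ.2 (B τ) rfl).trans hη
      refine le_trans (le_of_eq ?_) (ENNReal.ofReal_le_ofReal h3)
      rw [← TP.enorm_nn1]
      refine tsum_congr fun n => ?_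
      rw [hb, cubN_eq, AddMonoidAlgebra.coeff_sub, Finsupp.sub_apply, AddMonoidAlgebra.coeff_smul_apply, smul_eq_mul]
    rw [ENNReal.ofReal_add hη1 (by positivity)]
    refine le_trans ?_ (add_le_add h2 h1)
    rw [← ENNReal.tsum_add]
    refine ENNReal.tsum_le_tsum fun n => ?_
    have eI : ‖Complex.I‖ₑ = 1 := by rw [← ofReal_norm]; simp
    have e : (B' τ).coeff n - Complex.I * cubK (kap (om α) A ρ τ) b n = ((B' τ).coeff n - Complex.I * cubN b n)
      - Complex.I * (cubK (kap (om α) A ρ τ) b n - cubN b n) := by ring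
    rw [e]
    refine enorm_sub_le.trans ?_
    rw [enorm_mul, eI, one_mul]
  obtain ⟨V, h0, hd, hV, hVc, hVs⟩ := solver (om α) A l ρ hl hρ (Finset.Icc (-(M:ℤ)) M)
    (fun n τ => (B τ).coeff n) (fun n τ => (B' τ).coeff n) (Real.exp l) (η1 + δ0 * Real.exp l ^ 3)
    (by positivity) (by positivity) (fun n hn τ => (supB τ).fin n hn) (fun n hn τ => (supB' τ).fin n hn)
    (fun n τ => deriv_geT _ _ _ _ _) (fun n => cont_geT _ _ _ _)
    (fun τ hτ => by rw [← nn1_eq _ _ (supB τ).fin]; exact nB τ hτ) hres (lt_of_le_of_lt hsm hδs)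
  refine ⟨V, fun n => ?_, hV, hVc, hVs, (hd l ⟨hl.le, le_rfl⟩).trans (ENNReal.ofReal_le_ofReal hsm)⟩
  rw [h0]
  simp [hB, eT_zero]

open TP in
/-- High frequency mass survives. -/
lemma tpMass (N J L : ℕ) (l δs : ℝ) (hl : 0 < l) (V : ℤ → ℂ) (hδs : 0 ≤ δs)
    (hδ : δs * Real.exp l ≤ 1 / 2 ^ 26)
    (hmass : 1 / 2 ^ 12 * nn 2 (phi N) ≤
      nn 2 (mult (hi (L * N)) (phi N * eT ℂ (J + 1) ((Complex.I * l) • phi N ^ 2))))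
    (hV : ∑' n, ‖V n - (phi N * eT ℂ (J + 1) ((Complex.I * l) • phi N ^ 2)).coeff n‖ₑ ≤ ENNReal.ofReal δs) :
    1 / 2 ^ 25 * (2 * (N:ℝ) + 1)⁻¹ ≤
      ∑ n ∈ (Finset.Icc (-(((2 * J + 3) * N : ℕ):ℤ)) (((2 * J + 3) * N : ℕ):ℤ)).filter (fun n => ((L * N : ℕ):ℤ) < |n|), ‖V n‖ ^ 2 := by
  set b : TP := phi N * eT ℂ (J + 1) ((Complex.I * l) • phi N ^ 2) with hb
  set M : ℕ := (2 * J + 3) * N with hM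
  set F := (Finset.Icc (-(M:ℤ)) (M:ℤ)).filter (fun n => ((L * N : ℕ):ℤ) < |n|) with hF
  have supb : Sup b M :=
    ((phi_sup N).mul (Sup_eT ((phi_sup N).pow 2) _ _)).mono (by rw [hM]; ring_nf; rfl)
  have hbn : ∀ n, ‖b.coeff n‖ ≤ Real.exp l * (2 * (N:ℝ) + 1)⁻¹ := by
    intro n
    rw [hb, mul_comm]
    refine (sup_mul _ _ _ (phi_coeff_le N) n).trans ?_
    have := nn1_eT (phi N ^ 2) (q_nn1 N) (Complex.I * l) l (by simp [abs_of_nonneg hl.le]) (J + 1)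
    gcongr
  have hs1 : nn 2 (mult (hi (L * N)) b) ^ 2 = ∑ n ∈ F, ‖b.coeff n‖ ^ 2 := by
    rw [nn2_eq _ F]
    · refine Finset.sum_congr rfl fun n hn => ?_
      rw [hF, Finset.mem_filter] at hn
      rw [mult_coeff, hi, if_neg (by omega), one_mul]
    · intro n hn
      rw [hF, Finset.mem_filter, not_and_or] at hn
      rw [mult_coeff, hi]
      rcases hn with hn | hn
      · rw [supb.fin n hn, mul_zero]
      · rw [if_pos (by omega), zero_mul]
  have hs2 : 1 / 2 ^ 24 * (2 * (N:ℝ) + 1)⁻¹ ≤ ∑ n ∈ F, ‖b.coeff n‖ ^ 2 := by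
    rw [← hs1, ← phi_nn2]
    have h0 : 0 ≤ nn 2 (phi N) := nn_nonneg _
    calc _ = (1 / 2 ^ 12 * nn 2 (phi N)) ^ 2 := by ring
      _ ≤ _ := by gcongr
  have hs3 : ∑ n ∈ F, ‖V n - b.coeff n‖ ≤ δs := by
    have : ∑ n ∈ F, ‖V n - b.coeff n‖ₑ ≤ ENNReal.ofReal δs := (ENNReal.sum_le_tsum F).trans hV
    rw [← ENNReal.ofReal_le_ofReal_iff hδs, ENNReal.ofReal_sum_of_nonneg fun _ _ => norm_nonneg _]
    simpa using this
  set c := (2 * (N:ℝ) + 1)⁻¹ with hc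
  have hc0 : 0 < c := by positivity
  have hpt : ∀ n ∈ F, ‖b.coeff n‖ ^ 2 - 2 * (Real.exp l * c) * ‖V n - b.coeff n‖ ≤ ‖V n‖ ^ 2 := by
    intro n _
    have h1 := hbn n
    have h2 : ‖b.coeff n‖ ≤ ‖V n‖ + ‖V n - b.coeff n‖ := by
      rw [norm_sub_rev]
      simpa using norm_add_le (V n) (b.coeff n - V n)
    have h3 := norm_nonneg (V n - b.coeff n)
    have h4 := norm_nonneg (b.coeff n)
    have h5 := norm_nonneg (V n)
    nlinarith [sq_nonneg (‖V n‖ - ‖b.coeff n‖), mul_le_mul_of_nonneg_right h1 h3, mul_le_mul_of_nonneg_left h2 h4]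
  have hsum := Finset.sum_le_sum hpt
  rw [Finset.sum_sub_distrib, ← Finset.mul_sum] at hsum
  have h6 : 2 * (Real.exp l * c) * ∑ n ∈ F, ‖V n - b.coeff n‖ ≤ 2 * (Real.exp l * c) * δs := by gcongr
  have h7 : 2 * (Real.exp l * c) * δs ≤ 1 / 2 ^ 25 * c := by
    calc _ = 2 * (δs * Real.exp l) * c := by ring
      _ ≤ 2 * (1 / 2 ^ 26) * c := by gcongr
      _ = _ := by ring
  linarith

end

section
open scoped Real Topology NNReal ENNReal
open Filter Set

open TP in
lemma tpConc (α s : ℝ) (hα : 0 < α) (hs : 0 < s) (hs1 : s < 1 / 2) (ε : ℝ) (hε : 0 < ε) (L m J : ℕ)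
    (hL : 1 ≤ L) (hm : 1 ≤ m)
    (κ l δ0 η1 δs : ℝ) (hκ : 0 < κ) (hκε : κ < ε) (hl : 0 < l) (hδ0 : 0 < δ0) (hδ1 : δ0 ≤ 1)
    (hT : l / κ ^ 2 * ((4 * m : ℕ):ℝ) ^ (2 * s - 1) < ε)
    (hphase : l / κ ^ 2 * (4 * (2 * π * (3 * (2 * J + 3))) ^ (2 * α)) * ((4 * m : ℕ):ℝ) ^ (2 * α + 2 * s - 1) ≤ δ0 / 4)
    (h1 : ((L:ℝ) + 3) / l ≤ 1 / 2 ^ 13)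
    (h2 : l ^ (J + 1) / (J + 1).factorial ≤ 1 / 2 ^ 13) (h3 : tl ℝ (J + 1) l l ≤ 3 / 4)
    (hη : l ^ (J + 1) / (J + 1).factorial + tl ℝ (J + 1) l l * Real.exp l ≤ η1)
    (hsm : (η1 + δ0 * Real.exp l ^ 3) / (3 * (Real.exp l + 1) ^ 2) *
      (Real.exp ((3 * (Real.exp l + 1) ^ 2) * l) - 1) ≤ δs) (hδs0 : 0 ≤ δs) (hδs : δs < 1)
    (hδ : δs * Real.exp l ≤ 1 / 2 ^ 26)
    (hfin : (ε⁻¹) ^ 2 < κ ^ 2 * (L:ℝ) ^ (2 * s) / 2 ^ 29) : Concl α s ε := by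
  have hmass := hiMass L m J hm l hl h1 h2 h3
  have hN1 : 1 ≤ 4 * m := by omega
  generalize 4 * m = N at *
  have hN : (0:ℝ) < N := by exact_mod_cast hN1
  have hN1' : (1:ℝ) ≤ N := by exact_mod_cast hN1
  have hL' : (0:ℝ) < L := by exact_mod_cast hL
  have hA2 : (κ * (N:ℝ) ^ (1 / 2 - s)) ^ 2 = κ ^ 2 * (N:ℝ) ^ (1 - 2 * s) := by
    rw [mul_pow, ← Real.rpow_natCast ((N:ℝ) ^ _), ← Real.rpow_mul hN.le]
    congr 2; push_cast; ring
  have hdiv : l / (κ ^ 2 * (N:ℝ) ^ (1 - 2 * s)) = l / κ ^ 2 * (N:ℝ) ^ (2 * s - 1) := by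
    rw [show 2 * s - 1 = -(1 - 2 * s) by ring, Real.rpow_neg hN.le]
    field_simp
  have hA : 0 < κ * (N:ℝ) ^ (1 / 2 - s) := by positivity
  set A := κ * (N:ℝ) ^ (1 / 2 - s) with hAd
  set ρ : ℝ := δ0 / (24 * ((2 * J + 3) * N)) with hρd
  have hρ : 0 < ρ := by positivity
  have hρM : ρ * ((2 * J + 3) * N) = δ0 / 24 := by rw [hρd]; field_simp
  have hNs : (N:ℝ) ^ (2 * s) ≠ 0 := (Real.rpow_pos_of_pos hN _).ne'
  have hNN : (N:ℝ) ^ (1 - 2 * s) * (N:ℝ) ^ (2 * s) = N := by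
    rw [← Real.rpow_add hN]; simp
  obtain ⟨V, h0, hV, hVc, hVs, hclose⟩ := tpCore α hα N J A ρ l δ0 η1 δs hl hρ.le hδ0.le hδ1 (by
    rw [hA2, hdiv]
    have e1 : ρ * (6 * ((2 * J + 3) * N)) = δ0 / 4 := by linarith
    have e2 : l / κ ^ 2 * (N:ℝ) ^ (2 * s - 1) * (4 * (2 * π * (3 * ((2 * J + 3) * N))) ^ (2 * α)) ≤ δ0 / 4 := by
      refine le_trans (le_of_eq ?_) hphase
      rw [show 2 * π * (3 * ((2 * (J:ℝ) + 3) * N)) = (2 * π * (3 * (2 * J + 3))) * N by ring,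
        Real.mul_rpow (by positivity) hN.le, show 2 * α + 2 * s - 1 = 2 * α + (2 * s - 1) by ring,
        Real.rpow_add hN]
      ring
    linarith) hη hsm hδs
  refine reduct α s hα ε A l ρ hA hl hρ (Real.exp l + 1) (by positivity) V hV hVc hVs (by rw [hA2, hdiv]; exact hT) ?_ ?_
  · refine Hs_upper s A ρ ε hA hρ.le hε _ (Finset.Icc (-(N:ℤ)) N) (fun n hn => by rw [h0, (phi_sup N).fin n hn]) ?_
    have key : ∑ n ∈ Finset.Icc (-(N:ℤ)) N, ((1:ℝ) + (n:ℝ)^2) ^ s * ‖V n 0‖^2 ≤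
        ∑ n ∈ Finset.Icc (-(N:ℤ)) N, (2 * (N:ℝ) ^ (2 * s)) * ((2 * (N:ℝ) + 1)⁻¹) ^ 2 := by
      refine Finset.sum_le_sum fun n hn => ?_
      rw [h0, phi_norm_mem N n hn]
      gcongr
      rw [Finset.mem_Icc, ← abs_le] at hn
      have hn' : |(n:ℝ)| ≤ N := by exact_mod_cast hn
      have hn2 : (n:ℝ) ^ 2 ≤ (N:ℝ) ^ 2 := by rw [← sq_abs]; gcongr
      calc ((1:ℝ) + (n:ℝ)^2) ^ s ≤ (2 * (N:ℝ) ^ 2) ^ s := by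
            apply Real.rpow_le_rpow (by positivity) (by nlinarith) hs.le
        _ = (2:ℝ) ^ s * (N:ℝ) ^ (2 * s) := by
            rw [Real.mul_rpow (by norm_num) (by positivity), ← Real.rpow_natCast, ← Real.rpow_mul hN.le]
            norm_num
        _ ≤ (2:ℝ) ^ (1:ℝ) * (N:ℝ) ^ (2 * s) := by
            gcongr
            · norm_num
            · linarith
        _ = _ := by rw [Real.rpow_one]
    rw [Finset.sum_const, nsmul_eq_mul, card_Icc] at key
    calc _ ≤ A ^ 2 * ((2 * (N:ℝ) + 1) * ((2 * (N:ℝ) ^ (2 * s)) * ((2 * (N:ℝ) + 1)⁻¹) ^ 2)) := by gcongr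
      _ = κ ^ 2 * (2 * ((N:ℝ) ^ (1 - 2 * s) * (N:ℝ) ^ (2 * s)) / (2 * (N:ℝ) + 1)) := by
          rw [hA2]; field_simp
      _ ≤ κ ^ 2 * 1 := by
          rw [hNN]
          gcongr
          rw [div_le_one (by positivity)]
          linarith
      _ < ε ^ 2 := by rw [mul_one]; gcongr
  · have hl0 : l ∈ Icc 0 l := ⟨hl.le, le_rfl⟩
    have hM2 := tpMass N J L l δs hl (fun n => V n l) hδs0 hδ hmass hclose
    set F := (Finset.Icc (-(((2 * J + 3) * N : ℕ):ℤ)) (((2 * J + 3) * N : ℕ):ℤ)).filter (fun n => ((L * N : ℕ):ℤ) < |n|) with hF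
    refine Hs_lower s A ρ (Real.exp l + 1) ε⁻¹ hρ _
      (fun n => norm_le_of_tsum_enorm _ _ (by positivity) (hVs l hl0) n) F ?_
    refine hfin.trans_le ?_
    have hLN : (((L:ℝ) * N) ^ 2) ^ s = (L:ℝ) ^ (2 * s) * (N:ℝ) ^ (2 * s) := by
      rw [← Real.rpow_natCast ((L:ℝ) * N) 2, ← Real.rpow_mul (by positivity), Real.mul_rpow hL'.le hN.le]
      norm_num
    calc κ ^ 2 * (L:ℝ) ^ (2 * s) / 2 ^ 29 = κ ^ 2 * (L:ℝ) ^ (2 * s) * (1 / 2 ^ 29) := by ring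
      _ ≤ κ ^ 2 * (L:ℝ) ^ (2 * s) * ((1 / 2 ^ 27) * (N / (2 * (N:ℝ) + 1))) := by
          gcongr
          have : 1 / 4 ≤ (N:ℝ) / (2 * N + 1) := by
            rw [div_le_div_iff₀ (by norm_num) (by positivity)]; linarith
          linarith
      _ = ((L:ℝ) ^ (2 * s) * (N:ℝ) ^ (2 * s)) * (A * (1 / 2)) ^ 2 * (1 / 2 ^ 25 * (2 * (N:ℝ) + 1)⁻¹) := by
          rw [mul_pow, hA2]
          nth_rewrite 1 [← hNN]
          field_simp
      _ ≤ (((L:ℝ) * N) ^ 2) ^ s * (A * (1 / 2)) ^ 2 * ∑ n ∈ F, ‖V n l‖ ^ 2 := by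
          rw [hLN]; gcongr
      _ ≤ _ := by
          rw [Finset.mul_sum]
          refine Finset.sum_le_sum fun n hn => ?_
          rw [hF, Finset.mem_filter, Finset.mem_Icc, ← abs_le] at hn
          have a1 : |(n:ℝ)| ≤ (2 * J + 3) * N := by exact_mod_cast hn.1
          have a2 : (L:ℝ) * N ≤ |(n:ℝ)| := by exact_mod_cast hn.2.le
          have a3 : ((L:ℝ) * N) ^ 2 ≤ 1 + (n:ℝ) ^ 2 := by
            rw [← sq_abs (n:ℝ)]
            have : ((L:ℝ) * N) ^ 2 ≤ |(n:ℝ)| ^ 2 := by gcongr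
            linarith
          have a4 : 1 / 2 ≤ Real.exp (-ρ * |(n:ℝ)|) := by
            have := Real.add_one_le_exp (-ρ * |(n:ℝ)|)
            have : ρ * |(n:ℝ)| ≤ ρ * ((2 * J + 3) * N) := by gcongr
            linarith
          rw [mul_assoc]
          gcongr

lemma caseC (α s : ℝ) (hα : 0 < α) (hs : 0 < s) (hs2 : s < 1 / 2 - α) (ε : ℝ) (hε : 0 < ε) :
    Concl α s ε := by
  set κ := ε / 2 with hκd
  have hκ : 0 < κ := by positivity
  obtain ⟨L, hL1, hL⟩ := ((rpow_nat_small (2 * s) ((ε⁻¹) ^ 2 * (2 ^ 29 / κ ^ 2)) 1 (by linarith) (by norm_num)).and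
    (eventually_ge_atTop 1)).exists
  have hL0 : (0:ℝ) < L := by exact_mod_cast hL
  have hfin : (ε⁻¹) ^ 2 < κ ^ 2 * (L:ℝ) ^ (2 * s) / 2 ^ 29 := by
    rw [Real.rpow_neg hL0.le, ← div_eq_mul_inv, div_lt_one (Real.rpow_pos_of_pos hL0 _)] at hL1
    calc (ε⁻¹) ^ 2 = ((ε⁻¹) ^ 2 * (2 ^ 29 / κ ^ 2)) * (κ ^ 2 / 2 ^ 29) := by field_simp
      _ < (L:ℝ) ^ (2 * s) * (κ ^ 2 / 2 ^ 29) := by gcongr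
      _ = _ := by ring
  set l : ℝ := 2 ^ 13 * (L + 3) with hld
  have hl : 0 < l := by positivity
  set S := Real.exp l with hS
  have hS0 : 0 < S := Real.exp_pos _
  set P := 3 * (S + 1) ^ 2 with hP
  have hP0 : 0 < P := by positivity
  set K0 := (Real.exp (P * l) - 1) / P with hK0
  have hK00 : 0 ≤ K0 := by
    have := Real.add_one_le_exp (P * l)
    have : 0 < P * l := by positivity
    apply div_nonneg _ hP0.le
    linarith
  have hS1 : 1 ≤ S := Real.one_le_exp hl.le
  set δs := 1 / 2 ^ 26 / S with hδs
  have hδs0 : 0 < δs := by positivity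
  have hδsS : δs * S = 1 / 2 ^ 26 := by rw [hδs]; field_simp
  set η := δs / (K0 + 1) with hη
  have hη0 : 0 < η := by positivity
  set δ0 := min 1 (η / (2 * S ^ 3)) with hδ0
  have hδ00 : 0 < δ0 := by positivity
  have hδS : δ0 * S ^ 3 ≤ η / 2 := by
    calc _ ≤ η / (2 * S ^ 3) * S ^ 3 := by gcongr; exact min_le_right _ _
      _ = _ := by field_simp
  have t1 : Tendsto (fun J : ℕ => l ^ (J + 1) / ((J + 1).factorial : ℝ)) atTop (𝓝 0) :=
    (FloorSemiring.tendsto_pow_div_factorial_atTop l).comp (tendsto_add_atTop_nat 1)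
  have t2 : Tendsto (fun J : ℕ => tl ℝ (J + 1) l l) atTop (𝓝 0) := (tl_tendsto l).comp (tendsto_add_atTop_nat 1)
  have t3 : Tendsto (fun J : ℕ => l ^ (J + 1) / ((J + 1).factorial : ℝ) + tl ℝ (J + 1) l l * S) atTop (𝓝 0) := by
    simpa using t1.add (t2.mul_const S)
  obtain ⟨J, j1, j2, j3⟩ := ((t1.eventually_lt_const (show (0:ℝ) < 1 / 2 ^ 13 by positivity)).and
    ((t2.eventually_lt_const (show (0:ℝ) < 3 / 4 by positivity)).and
    (t3.eventually_lt_const (show (0:ℝ) < η / 2 by positivity)))).exists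
  have t4 : Tendsto (fun m : ℕ => 4 * m) atTop atTop := tendsto_id.const_mul_atTop' (by norm_num)
  have e1 := t4.eventually (rpow_nat_small (1 - 2 * s) (l / κ ^ 2) ε (by linarith) hε)
  have e2 := t4.eventually (rpow_nat_small (1 - 2 * α - 2 * s)
    (l / κ ^ 2 * (4 * (2 * π * (3 * (2 * J + 3))) ^ (2 * α))) (δ0 / 4) (by linarith) (by positivity))
  obtain ⟨m, m1, m2, m3⟩ := (e1.and (e2.and (eventually_ge_atTop 1))).exists
  rw [show -(1 - 2 * s) = 2 * s - 1 by ring] at m1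
  rw [show -(1 - 2 * α - 2 * s) = 2 * α + 2 * s - 1 by ring] at m2
  refine tpConc α s hα hs (by linarith) ε hε L m J hL m3 κ l δ0 (η / 2) δs hκ (by linarith) hl hδ00 (min_le_left _ _)
    m1 m2.le (le_of_eq ?_) j1.le j2.le j3.le ?_ hδs0.le ?_ hδsS.le hfin
  · rw [hld]; field_simp
  · calc _ = (η / 2 + δ0 * S ^ 3) * K0 := by rw [hK0]; ring
      _ ≤ (η / 2 + η / 2) * K0 := by gcongr
      _ ≤ η * (K0 + 1) := by nlinarith
      _ = δs := by rw [hη]; field_simp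
  · have : δs ≤ δs * S := le_mul_of_one_le_right hδs0.le hS1
    linarith

end

/-- Norm inflation for the defocusing cubic fractional NLS
`i∂_t u + (−∂_x²)^α u + |u|²u = 0` on the circle, stated in terms of the
Fourier coefficients `a_n(t)` of the solution. -/
theorem norm_inflation_fractional_NLS_circle (α s : ℝ) (hα : 0 < α)
    (hcase : ((1:ℝ)/2 - α ≤ -(1/2) ∧ s ≤ 1/2 - α) ∨
             (-(1/2) < (1:ℝ)/2 - α ∧ s < 1/2 - α ∧ s ≠ 0))
    (ε : ℝ) (hε : 0 < ε) :
    ∃ (T : ℝ) (a : ℤ → ℝ → ℂ),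
      0 < T ∧ T < ε ∧
      (∀ n : ℤ, ContDiff ℝ 1 (a n)) ∧
      (∀ m : ℕ,
        Summable (fun n : ℤ =>
          ((1:ℝ) + |(n:ℝ)|)^m * ⨆ t : Set.Icc (0:ℝ) T, ‖a n (t:ℝ)‖)) ∧
      (∀ (n : ℤ) (t : ℝ),
        Complex.I * deriv (a n) t
          + (((2 * π * |(n:ℝ)|) ^ (2*α) : ℝ) : ℂ) * a n t
          + ∑' p : {p : ℤ × ℤ × ℤ // n = p.1 - p.2.1 + p.2.2},
              a p.1.1 t * (starRingEnd ℂ) (a p.1.2.1 t) * a p.1.2.2 t = 0) ∧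
      HsSeq s (fun n => a n 0) < ε ∧
      HsSeq s (fun n => a n T) > ε⁻¹ := by
  show Concl α s ε
  rcases hcase with ⟨h1, h2⟩ | ⟨h1, h2, h3⟩
  · exact caseA α s hα (h2.trans h1) h2 ε hε
  · rcases le_or_gt s (-(1/2)) with h | h
    · exact caseA α s hα h h2.le ε hε
    · rcases lt_or_gt_of_ne h3 with h4 | h4
      · exact caseB α s hα h h4 h2 ε hε
      · exact caseC α s hα h4 h2 ε hε
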